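/- Under the framework assumptions on the structure of the system and on the data, there exists a pair (y,μ) satisfying, for every T > 0, the regularity y ∈ L∞(0,T;V_B^σ), ∂_t y ∈ L²(0,T;V_A^{−r}), τ∂_t y ∈ L²(0,T;H), μ ∈ L²(0,T;V_A^r), β̂(y) ∈ L¹(Ω×(0,T)), and solving the fractional Cahn–Hilliard system: ⟨∂_t y(t), v⟩_{A,r} + (A^r μ(t), A^r v) = 0 for every v ∈ V_A^r and a.a. t > 0; (τ∂_t y(t), y(t)−v) + (B^σ y(t), B^σ(y(t)−v)) + ∫_Ω β̂(y(t)) + (π(y(t)) − u(t), y(t)−v) ≤ (μ(t), y(t)−v) + ∫_Ω β̂(v) for every v ∈ V_B^σ and a.a. t > 0; y(0) = y₀. -/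

import Mathlib

noncomputable section

open MeasureTheory Filter Topology RealInnerProductSpace Set ENNReal NNReal

namespace FracCH

/-- The ambient space `ℝ³`. -/
abbrev E3 := EuclideanSpace ℝ (Fin 3)

/-- Lebesgue measure restricted to `Om`. -/
abbrev mOm (Om : Set E3) : Measure E3 := volume.restrict Om

/-- The Hilbert space `H = L²(Om)`. -/
abbrev Hs (Om : Set E3) := MeasureTheory.Lp ℝ 2 (mOm Om)

/-- The fractional power (in the spectral sense) with exponent `ρ` of the operator whose
eigenvalues are `lam` and whose orthonormal eigenvectors are `e`. -/
def fracPow {Om : Set E3} (lam : ℕ → ℝ) (e : ℕ → Hs Om) (ρ : ℝ) (v : Hs Om) : Hs Om :=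
  ∑' j, ((lam j) ^ ρ * ⟪v, e j⟫) • e j

/-- Membership in the domain of the fractional power of exponent `ρ`. -/
def inDom {Om : Set E3} (lam : ℕ → ℝ) (e : ℕ → Hs Om) (ρ : ℝ) (v : Hs Om) : Prop :=
  Summable fun j => ((lam j) ^ ρ * ⟪v, e j⟫) ^ 2

/-- Mean value of `v` on `Om`. -/
def meanVal {Om : Set E3} (v : Hs Om) : ℝ := (∫ x, v x ∂(mOm Om)) / (volume Om).toReal

/-- Subdifferential of a convex function `b : ℝ → [0,+∞]`. -/
def subdiff (b : ℝ → ℝ≥0∞) (s : ℝ) : Set ℝ :=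
  {ξ | b s < ⊤ ∧ ∀ t : ℝ, ENNReal.ofReal ((b s).toReal + ξ * (t - s)) ≤ b t}

/-- Square of the graph norm of the domain of a fractional power. -/
def gnormSq {Om : Set E3} (lam : ℕ → ℝ) (e : ℕ → Hs Om) (ρ : ℝ) (v : Hs Om) : ℝ :=
  ‖v‖ ^ 2 + ‖fracPow lam e ρ v‖ ^ 2

/-- Square of the dual norm (the norm of `V_A^{-r}`) of a linear functional. -/
def dualNormSq {Om : Set E3} (lam : ℕ → ℝ) (e : ℕ → Hs Om) (ρ : ℝ)
    (f : Hs Om →ₗ[ℝ] ℝ) : ℝ :=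
  sSup {a : ℝ | ∃ v : Hs Om, inDom lam e ρ v ∧ gnormSq lam e ρ v ≤ 1 ∧ a = (f v) ^ 2}

/-- The inner product of the Hilbert space which is the domain of a fractional power
(e.g.`V_B^σ`). -/
def innerFrac {Om : Set E3} (lam : ℕ → ℝ) (e : ℕ → Hs Om) (ρ : ℝ) (a b : Hs Om) : ℝ :=
  ⟪a, b⟫ + ⟪fracPow lam e ρ a, fracPow lam e ρ b⟫

/-- The structural assumptions: `Om ⊂ ℝ³` is open, connected and bounded; `A` and `B` are
unbounded monotone selfadjoint operators with compact resolvents, described by their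
nondecreasing sequences of eigenvalues `lamA`, `lamB` (tending to `+∞`) and complete
orthonormal systems of eigenvectors `eA`, `eB`; `r, σ > 0`, `τ ∈ [0,1]`; either `λ₁ > 0`
or `0 = λ₁ < λ₂` with `e₁` constant; if `λ₁ = 0` the constants belong to `V_B^σ`. -/
def SettingHyps (Om : Set E3) (lamA lamB : ℕ → ℝ) (eA eB : ℕ → Hs Om)
    (r σ τ : ℝ) : Prop :=
  IsOpen Om ∧ IsConnected Om ∧ Bornology.IsBounded Om ∧
  (∀ j, 0 ≤ lamA j) ∧ (∀ j, 0 ≤ lamB j) ∧ Monotone lamA ∧ Monotone lamB ∧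
  Tendsto lamA atTop atTop ∧ Tendsto lamB atTop atTop ∧
  Orthonormal ℝ eA ∧ Orthonormal ℝ eB ∧
  (Submodule.span ℝ (Set.range eA)).topologicalClosure = ⊤ ∧
  (Submodule.span ℝ (Set.range eB)).topologicalClosure = ⊤ ∧
  0 < r ∧ 0 < σ ∧ τ ∈ Set.Icc (0:ℝ) 1 ∧
  (0 < lamA 0 ∨ (lamA 0 = 0 ∧ 0 < lamA 1 ∧ ∃ c : ℝ, ∀ᵐ x ∂(mOm Om), eA 0 x = c)) ∧
  (lamA 0 = 0 → ∀ c : ℝ, ∃ w : Hs Om, inDom lamB eB σ w ∧ (∀ᵐ x ∂(mOm Om), w x = c))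

/-- The assumptions on the nonlinearity `f = β̂ + π̂` and on the data `u`, `y₀`:
`β̂ : ℝ → [0,+∞]` is convex, l.s.c., with `β̂(0) = 0`; `π̂` is `C¹` with Lipschitz
continuous derivative `π`; the coercivity `liminf_{|s|→∞}(β̂(s)+π̂(s))/s² > 0` holds;
`u ∈ W^{1,1}_loc([0,∞);H)` with primitive representation by `u'` and `∂_t u ∈ L¹(0,∞;H)`;
`y₀ ∈ V_B^σ` with `β̂(y₀) ∈ L¹(Om)`; and if `λ₁ = 0` the mean of `y₀` lies in the
interior of `D(β)`. -/
def DataHyps (Om : Set E3) (lamA lamB : ℕ → ℝ) (eB : ℕ → Hs Om) (σ : ℝ)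
    (betah : ℝ → ℝ≥0∞) (pih piF : ℝ → ℝ) (Lpi : ℝ≥0)
    (u u' : ℝ → Hs Om) (y0 : Hs Om) : Prop :=
  (∀ a b t : ℝ, 0 ≤ t → t ≤ 1 →
    betah (t * a + (1 - t) * b) ≤ ENNReal.ofReal t * betah a + ENNReal.ofReal (1 - t) * betah b) ∧
  LowerSemicontinuous betah ∧ betah 0 = 0 ∧
  (∀ s, HasDerivAt pih (piF s) s) ∧ LipschitzWith Lpi piF ∧
  (∃ α : ℝ, 0 < α ∧ ∀ᶠ s : ℝ in Filter.comap (|·|) atTop,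
    ENNReal.ofReal (α * s ^ 2 - pih s) ≤ betah s) ∧
  IntegrableOn u' (Set.Ioi (0:ℝ)) ∧
  (∀ t : ℝ, 0 ≤ t → u t = u 0 + ∫ s in (0:ℝ)..t, u' s) ∧
  inDom lamB eB σ y0 ∧ (∫⁻ x, betah (y0 x) ∂(mOm Om)) < ⊤ ∧
  (lamA 0 = 0 → meanVal y0 ∈ interior {s : ℝ | (subdiff betah s).Nonempty})

/-- The notion of solution `(y, μ)` of the weak formulation of the fractional
Cahn--Hilliard system on the half line `t ≥ 0`.  Here `dy t ∈ V_A^{-r}` represents the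
time derivative `∂_t y(t)` (acting on test functions, and linked to `y` by the integral
identity `(y(t),v) = (y(0),v) + ∫_0^t ⟨∂_t y(s),v⟩ ds`), while `z` represents
`τ ∂_t y ∈ L²(0,T;H)`.  The requirements are the regularity
`y ∈ L^∞(0,T;V_B^σ)`, `∂_t y ∈ L²(0,T;V_A^{-r})`, `τ ∂_t y ∈ L²(0,T;H)`,
`μ ∈ L²(0,T;V_A^r)`, `β̂(y) ∈ L¹(Om×(0,T))` for every `T > 0`, the two variational
equations/inequalities for a.a. `t`, and the initial condition `y(0) = y₀`. -/
def IsSolution (Om : Set E3) (lamA lamB : ℕ → ℝ) (eA eB : ℕ → Hs Om) (r σ τ : ℝ)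
    (betah : ℝ → ℝ≥0∞) (piF : ℝ → ℝ) (u : ℝ → Hs Om) (y0 : Hs Om)
    (y μ : ℝ → Hs Om) (dy : ℝ → Hs Om →ₗ[ℝ] ℝ) (z : ℝ → Hs Om) : Prop :=
  AEStronglyMeasurable y (volume.restrict (Set.Ioi (0:ℝ))) ∧
  (∀ᵐ t ∂(volume.restrict (Set.Ioi (0:ℝ))), inDom lamB eB σ (y t)) ∧
  (∀ T : ℝ, 0 < T → ∃ C : ℝ,
    ∀ᵐ t ∂(volume.restrict (Set.Ioc (0:ℝ) T)), gnormSq lamB eB σ (y t) ≤ C) ∧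
  (∀ v : Hs Om, inDom lamA eA r v → ∀ T : ℝ, 0 < T →
    IntegrableOn (fun s => dy s v) (Set.Ioc (0:ℝ) T)) ∧
  (∀ v : Hs Om, inDom lamA eA r v → ∀ t : ℝ, 0 ≤ t →
    ⟪y t, v⟫ = ⟪y 0, v⟫ + ∫ s in (0:ℝ)..t, dy s v) ∧
  (∀ T : ℝ, 0 < T → IntegrableOn (fun t => dualNormSq lamA eA r (dy t)) (Set.Ioc (0:ℝ) T)) ∧
  AEStronglyMeasurable z (volume.restrict (Set.Ioi (0:ℝ))) ∧
  (∀ᵐ t ∂(volume.restrict (Set.Ioi (0:ℝ))), ∀ v : Hs Om, inDom lamA eA r v →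
    ⟪z t, v⟫ = τ * dy t v) ∧
  (∀ T : ℝ, 0 < T → IntegrableOn (fun t => ‖z t‖ ^ 2) (Set.Ioc (0:ℝ) T)) ∧
  AEStronglyMeasurable μ (volume.restrict (Set.Ioi (0:ℝ))) ∧
  (∀ᵐ t ∂(volume.restrict (Set.Ioi (0:ℝ))), inDom lamA eA r (μ t)) ∧
  (∀ T : ℝ, 0 < T → IntegrableOn (fun t => gnormSq lamA eA r (μ t)) (Set.Ioc (0:ℝ) T)) ∧
  (∀ T : ℝ, 0 < T → (∫⁻ t in Set.Ioc (0:ℝ) T, ∫⁻ x, betah (y t x) ∂(mOm Om)) < ⊤) ∧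
  (∀ᵐ t ∂(volume.restrict (Set.Ioi (0:ℝ))), ∀ v : Hs Om, inDom lamA eA r v →
    dy t v + ⟪fracPow lamA eA r (μ t), fracPow lamA eA r v⟫ = 0) ∧
  (∀ᵐ t ∂(volume.restrict (Set.Ioi (0:ℝ))), ∀ v : Hs Om,
    inDom lamB eB σ v → (∫⁻ x, betah (v x) ∂(mOm Om)) < ⊤ →
    ⟪z t, y t - v⟫
      + ⟪fracPow lamB eB σ (y t), fracPow lamB eB σ (y t) - fracPow lamB eB σ v⟫
      + (∫⁻ x, betah (y t x) ∂(mOm Om)).toReal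
      + ∫ x, (piF (y t x) - u t x) * (y t x - v x) ∂(mOm Om)
      ≤ ⟪μ t, y t - v⟫ + (∫⁻ x, betah (v x) ∂(mOm Om)).toReal) ∧
  y 0 = y0

/-- The ω-limit set of the trajectory `y`, in the weak topology of `V_B^σ`. -/
def omegaLimit {Om : Set E3} (lamB : ℕ → ℝ) (eB : ℕ → Hs Om) (σ : ℝ)
    (y : ℝ → Hs Om) : Set (Hs Om) :=
  {w | inDom lamB eB σ w ∧ ∃ tn : ℕ → ℝ, StrictMono tn ∧ (∀ n, 0 ≤ tn n) ∧
    Tendsto tn atTop atTop ∧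
    ∀ φ : Hs Om, inDom lamB eB σ φ →
      Tendsto (fun n => innerFrac lamB eB σ (y (tn n)) φ) atTop
        (nhds (innerFrac lamB eB σ w φ))}

section HilbertBasics

variable {H : Type*} [NormedAddCommGroup H] [InnerProductSpace ℝ H]

lemma hasSum_coord_mul (b : HilbertBasis ℕ ℝ H) (v w : H) :
    HasSum (fun j => ⟪v, b j⟫ * ⟪w, b j⟫) ⟪v, w⟫ := by
  simpa only [real_inner_comm w] using b.hasSum_inner_mul_inner v w

lemma hasSum_coord_sq (b : HilbertBasis ℕ ℝ H) (v : H) :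
    HasSum (fun j => ⟪v, b j⟫ ^ 2) (‖v‖ ^ 2) := by
  simpa only [sq, real_inner_self_eq_norm_mul_norm] using hasSum_coord_mul b v v

lemma eq_of_coord_eq (b : HilbertBasis ℕ ℝ H) {v w : H} (h : ∀ j, ⟪v, b j⟫ = ⟪w, b j⟫) :
    v = w := by
  have h1 := hasSum_coord_sq b (v - w)
  simp only [inner_sub_left, h, sub_self] at h1
  have h2 : (‖v - w‖ : ℝ) ^ 2 = 0 := h1.unique (by simp [hasSum_zero])
  simpa [sub_eq_zero] using h2

lemma exists_coord_eq (b : HilbertBasis ℕ ℝ H) {c : ℕ → ℝ}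
    (hc : Summable fun j => c j ^ 2) : ∃ w : H, ∀ j, ⟪w, b j⟫ = c j := by
  have hm : Memℓp c 2 := by
    refine memℓp_gen ?_
    simpa using hc
  refine ⟨b.repr.symm ⟨c, hm⟩, fun j => ?_⟩
  rw [real_inner_comm, ← b.repr_apply_apply]
  simp

/-- The bounded operator which is diagonal in a given Hilbert basis. -/
lemma exists_diagonal_operator (b : HilbertBasis ℕ ℝ H) {c : ℕ → ℝ} {C : ℝ}
    (hc : ∀ j, |c j| ≤ C) :
    ∃ T : H →L[ℝ] H, ∀ v j, ⟪T v, b j⟫ = c j * ⟪v, b j⟫ := by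
  have hle : ∀ v j, (c j * ⟪v, b j⟫) ^ 2 ≤ C ^ 2 * ⟪v, b j⟫ ^ 2 := fun v j => by
    rw [mul_pow]
    exact mul_le_mul_of_nonneg_right
      (sq_le_sq.2 ((hc j).trans (le_abs_self C))) (sq_nonneg _)
  have hs : ∀ v, Summable fun j => (c j * ⟪v, b j⟫) ^ 2 := fun v =>
    Summable.of_nonneg_of_le (fun j => sq_nonneg _) (hle v)
      ((hasSum_coord_sq b v).summable.mul_left _)
  choose T hT using fun v => exists_coord_eq b (hs v)
  refine ⟨LinearMap.mkContinuous
    { toFun := T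
      map_add' := fun v w => eq_of_coord_eq b fun j => by
        simp only [inner_add_left, hT]; ring
      map_smul' := fun a v => eq_of_coord_eq b fun j => by
        simp only [inner_smul_left, hT, RingHom.id_apply]; simp; ring } C ?_, fun v j => hT v j⟩
  intro v
  have hC : 0 ≤ C := (abs_nonneg _).trans (hc 0)
  refine abs_le_of_sq_le_sq' ?_ (by positivity) |>.2
  rw [mul_pow]
  refine hasSum_le (fun j => ?_) (hasSum_coord_sq b (T v)) ((hasSum_coord_sq b v).mul_left (C ^ 2))
  rw [hT]; exact hle v j

/-- Bounded sequences in a separable Hilbert space have weakly convergent subsequences. -/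
lemma exists_weak_subseq_limit [CompleteSpace H] [SecondCountableTopology H]
    {x : ℕ → H} {C : ℝ} (hx : ∀ n, ‖x n‖ ≤ C) :
    ∃ (a : H) (φ : ℕ → ℕ), StrictMono φ ∧
      ∀ w, Tendsto (fun n => ⟪x (φ n), w⟫) atTop (𝓝 ⟪a, w⟫) := by
  let D := InnerProductSpace.toDual ℝ H
  obtain ⟨f, -, φ, hφ, hf⟩ := WeakDual.isSeqCompact_closedBall ℝ H (0 : StrongDual ℝ H) C
    (x := fun n => StrongDual.toWeakDual (D (x n))) (fun n => by
      simpa using (D.norm_map (x n)).le.trans (hx n))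
  refine ⟨D.symm (WeakDual.toStrongDual f), φ, hφ, fun w => ?_⟩
  have h1 : Tendsto (fun n => (StrongDual.toWeakDual (D (x (φ n)))) w) atTop (𝓝 (f w)) :=
    ((WeakDual.eval_continuous w).tendsto f).comp hf
  have h2 : ⟪D.symm (WeakDual.toStrongDual f), w⟫ = f w := by
    rw [← InnerProductSpace.toDual_apply_apply (𝕜 := ℝ)]
    simp [D]
  rw [h2]
  simpa [D] using h1

/-- A weakly convergent bounded sequence may be paired with a strongly convergent one. -/
lemma tendsto_inner_weak_strong {x w : ℕ → H} {a c : H} {C : ℝ} (hx : ∀ n, ‖x n‖ ≤ C)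
    (ha : ∀ v, Tendsto (fun n => ⟪x n, v⟫) atTop (𝓝 ⟪a, v⟫)) (hw : Tendsto w atTop (𝓝 c)) :
    Tendsto (fun n => ⟪x n, w n⟫) atTop (𝓝 ⟪a, c⟫) := by
  have h1 : Tendsto (fun n => ⟪x n, w n - c⟫) atTop (𝓝 0) := by
    have h2 : Tendsto (fun n => C * ‖w n - c‖) atTop (𝓝 0) := by
      simpa using (tendsto_iff_norm_sub_tendsto_zero.1 hw).const_mul C
    refine squeeze_zero_norm (fun n => ?_) h2
    exact (norm_inner_le_norm _ _).trans
      (mul_le_mul_of_nonneg_right (hx n) (norm_nonneg _))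
  simpa [← inner_add_right] using h1.add (ha c)

/-- In a compact set, convergence of all coordinates implies strong convergence. -/
lemma exists_tendsto_of_coord_tendsto (b : HilbertBasis ℕ ℝ H) {K : Set H} (hK : IsCompact K)
    {x : ℕ → H} (hx : ∀ n, x n ∈ K) {c : ℕ → ℝ}
    (hc : ∀ j, Tendsto (fun n => ⟪x n, b j⟫) atTop (𝓝 (c j))) :
    ∃ a ∈ K, Tendsto x atTop (𝓝 a) ∧ ∀ j, ⟪a, b j⟫ = c j := by
  have hcl : ∀ a, MapClusterPt a atTop x → ∀ j, ⟪a, b j⟫ = c j := fun a ha j => by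
    have hcont : Continuous fun v : H => ⟪v, b j⟫ := by fun_prop
    obtain ⟨φ, hφ, hx'⟩ := ha.tendsto_subseq
    exact tendsto_nhds_unique ((hcont.tendsto a).comp hx') ((hc j).comp hφ.tendsto_atTop)
  obtain ⟨a, haK, ha⟩ := hK.exists_mapClusterPt (f := atTop) (u := x)
    (tendsto_principal.2 (Eventually.of_forall hx))
  refine ⟨a, haK, ?_, hcl a ha⟩
  refine hK.tendsto_nhds_of_unique_mapClusterPt (Eventually.of_forall hx) fun z _ hz => ?_
  exact eq_of_coord_eq b fun j => (hcl z hz j).trans (hcl a ha j).symm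

/-- Bounded sets of the domain of a diagonal operator with divergent eigenvalues are compact. -/
lemma isCompact_of_coord_sum_le [CompleteSpace H] [SecondCountableTopology H]
    (b : HilbertBasis ℕ ℝ H) {κ : ℕ → ℝ} (hκ : Tendsto κ atTop atTop) {K : Set H}
    (hK : IsClosed K) {R C : ℝ} (hR : ∀ v ∈ K, ‖v‖ ≤ R)
    (hC : ∀ v ∈ K, ∀ n, ∑ j ∈ Finset.range n, (κ j * ⟪v, b j⟫) ^ 2 ≤ C) : IsCompact K := by
  rw [isCompact_iff_isSeqCompact]
  intro x hx
  obtain ⟨a, φ, hφ, ha⟩ := exists_weak_subseq_limit (fun n => hR _ (hx n))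
  have hC0 : 0 ≤ C := by simpa using hC _ (hx 0) 0
  have htail : ∀ v w : H, (∀ n, ∑ j ∈ Finset.range n, (κ j * ⟪v, b j⟫) ^ 2 ≤ C) →
      (∀ n, ∑ j ∈ Finset.range n, (κ j * ⟪w, b j⟫) ^ 2 ≤ C) → ∀ (N : ℕ) (m : ℝ), 0 < m →
      (∀ j, N ≤ j → m ≤ κ j) →
      ‖v - w‖ ^ 2 ≤ ∑ j ∈ Finset.range N, ⟪v - w, b j⟫ ^ 2 + 4 * C / m ^ 2 := by
    intro v w hv hw N m hm hN
    refine le_of_tendsto (hasSum_coord_sq b (v - w)).tendsto_sum_nat ?_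
    filter_upwards [eventually_ge_atTop N] with n hn
    rw [← Finset.sum_range_add_sum_Ico _ hn]
    gcongr
    rw [le_div_iff₀ (by positivity), Finset.sum_mul]
    have h1 : ∀ j ∈ Finset.Ico N n, ⟪v - w, b j⟫ ^ 2 * m ^ 2 ≤
        2 * (κ j * ⟪v, b j⟫) ^ 2 + 2 * (κ j * ⟪w, b j⟫) ^ 2 := by
      intro j hj
      have hmj : m ^ 2 ≤ κ j ^ 2 := by
        have := hN j (Finset.mem_Ico.1 hj).1
        gcongr
      calc ⟪v - w, b j⟫ ^ 2 * m ^ 2 ≤ ⟪v - w, b j⟫ ^ 2 * κ j ^ 2 := by gcongr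
        _ ≤ _ := by
          rw [inner_sub_left]
          nlinarith [sq_nonneg (κ j * ⟪v, b j⟫ + κ j * ⟪w, b j⟫)]
    refine (Finset.sum_le_sum h1).trans ?_
    rw [Finset.sum_add_distrib, ← Finset.mul_sum, ← Finset.mul_sum]
    have h2 : ∀ f : ℕ → ℝ, (∀ j, 0 ≤ f j) →
        ∑ j ∈ Finset.Ico N n, f j ≤ ∑ j ∈ Finset.range n, f j := fun f hf =>
      Finset.sum_le_sum_of_subset_of_nonneg (fun j hj => by
        simp only [Finset.mem_Ico, Finset.mem_range] at hj ⊢; exact hj.2) (fun j _ _ => hf j)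
    have h3 := (h2 (fun j => (κ j * ⟪v, b j⟫) ^ 2) (fun j => sq_nonneg _)).trans (hv n)
    have h4 := (h2 (fun j => (κ j * ⟪w, b j⟫) ^ 2) (fun j => sq_nonneg _)).trans (hw n)
    linarith
  have haC : ∀ n, ∑ j ∈ Finset.range n, (κ j * ⟪a, b j⟫) ^ 2 ≤ C := fun n => by
    have : Tendsto (fun k => ∑ j ∈ Finset.range n, (κ j * ⟪x (φ k), b j⟫) ^ 2) atTop
        (𝓝 (∑ j ∈ Finset.range n, (κ j * ⟪a, b j⟫) ^ 2)) :=
      tendsto_finsetSum _ fun j _ => ((ha (b j)).const_mul _).pow 2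
    exact le_of_tendsto this (Eventually.of_forall fun k => hC _ (hx _) n)
  have hlim : Tendsto (fun k => x (φ k)) atTop (𝓝 a) := by
    rw [tendsto_iff_norm_sub_tendsto_zero, Metric.tendsto_atTop]
    intro ε hε
    obtain ⟨m, hm0, hm⟩ : ∃ m : ℝ, 0 < m ∧ 4 * C / m ^ 2 < ε ^ 2 / 2 := by
      refine ⟨(8 * C + 1) / ε + 1, by positivity, ?_⟩
      rw [div_lt_iff₀ (by positivity)]
      have h5 : (8 * C + 1) < ε * ((8 * C + 1) / ε + 1) := by
        rw [mul_add, mul_div_cancel₀ _ hε.ne']; linarith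
      have h6 : (8 * C + 1) ^ 2 < (ε * ((8 * C + 1) / ε + 1)) ^ 2 := by gcongr
      nlinarith [h6]
    obtain ⟨N, hN⟩ := eventually_atTop.1 (hκ.eventually_ge_atTop m)
    have h7 : Tendsto (fun k => ∑ j ∈ Finset.range N, ⟪x (φ k) - a, b j⟫ ^ 2) atTop (𝓝 0) := by
      have : Tendsto (fun k => ∑ j ∈ Finset.range N, ⟪x (φ k) - a, b j⟫ ^ 2) atTop
          (𝓝 (∑ j ∈ Finset.range N, (⟪a, b j⟫ - ⟪a, b j⟫) ^ 2)) := by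
        simp only [inner_sub_left]
        exact tendsto_finsetSum _ fun j _ => ((ha (b j)).sub_const _).pow 2
      simpa using this
    obtain ⟨M, hM⟩ := eventually_atTop.1 (h7.eventually_lt_const (show 0 < ε ^ 2 / 2 by positivity))
    refine ⟨M, fun k hk => ?_⟩
    have h8 := htail (x (φ k)) a (hC _ (hx _)) haC N m hm0 hN
    have h9 := hM k hk
    simp only [dist_zero_right, norm_norm]
    exact lt_of_pow_lt_pow_left₀ 2 hε.le (by linarith)
  exact ⟨a, hK.mem_of_tendsto hlim (Eventually.of_forall fun k => hx _), φ, hφ, hlim⟩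

end HilbertBasics

section IncrementalScheme

variable {H : Type*} [NormedAddCommGroup H] [InnerProductSpace ℝ H]

/-- A coercive energy `Ψ + P` on a Hilbert space: `Ψ` is convex, lower semicontinuous, with
compact bounded sublevels, and `P` is a perturbation with Lipschitz continuous gradient `G`. -/
structure IsEnergy (Ψ : H → ℝ≥0∞) (P : H → ℝ) (G : H → H) (L α C₀ : ℝ) : Prop where
  lsc : LowerSemicontinuous Ψ
  convex : ∀ v w (s : ℝ), 0 ≤ s → s ≤ 1 →
    Ψ (s • v + (1 - s) • w) ≤ ENNReal.ofReal s * Ψ v + ENNReal.ofReal (1 - s) * Ψ w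
  compact : ∀ C R : ℝ, IsCompact {v | Ψ v ≤ ENNReal.ofReal C ∧ ‖v‖ ≤ R}
  lipschitz : ∀ v w, ‖G v - G w‖ ≤ L * ‖v - w‖
  taylor : ∀ v w, |P w - P v - ⟪G v, w - v⟫| ≤ L * ‖w - v‖ ^ 2
  pos : 0 < α
  coercive : ∀ v, Ψ v < ⊤ → α * ‖v‖ ^ 2 - C₀ ≤ (Ψ v).toReal + P v

namespace IsEnergy

variable {Ψ : H → ℝ≥0∞} {P : H → ℝ} {G : H → H} {L α C₀ : ℝ}

lemma abs_sub_le (hE : IsEnergy Ψ P G L α C₀) (v w : H) :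
    |P w - P v| ≤ ‖G v‖ * ‖w - v‖ + L * ‖w - v‖ ^ 2 := by
  have h1 := hE.taylor v w
  have h2 := abs_real_inner_le_norm (G v) (w - v)
  rw [abs_le] at h1 h2 ⊢
  constructor <;> linarith [h1.1, h1.2, h2.1, h2.2]

lemma continuous_potential (hE : IsEnergy Ψ P G L α C₀) : Continuous P := by
  rw [continuous_iff_continuousAt]
  intro v
  rw [ContinuousAt, tendsto_iff_norm_sub_tendsto_zero]
  have h1 : Continuous fun w : H => ‖G v‖ * ‖w - v‖ + L * ‖w - v‖ ^ 2 := by fun_prop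
  refine squeeze_zero (fun w => norm_nonneg _) (fun w => hE.abs_sub_le v w) ?_
  simpa using h1.tendsto v

lemma continuous_gradient (hE : IsEnergy Ψ P G L α C₀) : Continuous G := by
  rw [continuous_iff_continuousAt]
  intro v
  rw [ContinuousAt, tendsto_iff_norm_sub_tendsto_zero]
  have h1 : Continuous fun w : H => L * ‖w - v‖ := by fun_prop
  refine squeeze_zero (fun w => norm_nonneg _) (fun w => hE.lipschitz w v) ?_
  simpa using h1.tendsto v

lemma abs_potential_le (hE : IsEnergy Ψ P G L α C₀) {v : H} {R : ℝ} (hv : ‖v‖ ≤ R) :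
    |P v| ≤ |P 0| + ‖G 0‖ * R + |L| * R ^ 2 := by
  have h1 := hE.abs_sub_le 0 v
  rw [sub_zero] at h1
  have h2 : |P v| ≤ |P 0| + |P v - P 0| := by
    have := abs_add_le (P 0) (P v - P 0)
    simpa using this
  have h3 : L * ‖v‖ ^ 2 ≤ |L| * R ^ 2 := by
    refine (mul_le_mul_of_nonneg_right (le_abs_self L) (sq_nonneg _)).trans ?_
    gcongr
  have h4 : ‖G 0‖ * ‖v‖ ≤ ‖G 0‖ * R := by gcongr
  linarith

lemma norm_gradient_le (hE : IsEnergy Ψ P G L α C₀) {v : H} {R : ℝ} (hv : ‖v‖ ≤ R) :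
    ‖G v‖ ≤ ‖G 0‖ + |L| * R := by
  have h1 := hE.lipschitz v 0
  rw [sub_zero] at h1
  have h2 : L * ‖v‖ ≤ |L| * R :=
    (mul_le_mul_of_nonneg_right (le_abs_self L) (norm_nonneg _)).trans (by gcongr)
  have h3 := norm_le_norm_add_norm_sub' (G v) (G 0)
  linarith

/-- Existence of minimizers for continuous perturbations growing at most linearly downwards. -/
lemma exists_minimizer (hE : IsEnergy Ψ P G L α C₀) {Q : H → ℝ} (hQ : Continuous Q) {U c : ℝ}
    (hU : 0 ≤ U) (hQl : ∀ v, -(U * ‖v‖) - c ≤ Q v) {p : H} (hp : Ψ p < ⊤) :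
    ∃ y, Ψ y < ⊤ ∧ ∀ v, Ψ v < ⊤ → (Ψ y).toReal + P y + Q y ≤ (Ψ v).toReal + P v + Q v := by
  set J₀ := (Ψ p).toReal + P p + Q p with hJ₀
  set R := (U + |C₀ + c + J₀|) / α + 1 with hR
  have hα := hE.pos
  have hR1 : 1 ≤ R := by
    have : 0 ≤ (U + |C₀ + c + J₀|) / α := by positivity
    linarith
  have hαR : U + |C₀ + c + J₀| < α * R := by
    rw [hR, mul_add, mul_div_cancel₀ _ hα.ne']; linarith
  set B := |P 0| + ‖G 0‖ * R + |L| * R ^ 2 with hB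
  set C₁ := J₀ + B + U * R + c with hC₁
  set K := {v | Ψ v ≤ ENNReal.ofReal C₁ ∧ ‖v‖ ≤ R} with hK
  have hlow : ∀ v, ‖v‖ ≤ R → -B - U * R - c ≤ P v + Q v := fun v hv => by
    have h1 := (abs_le.1 (hE.abs_potential_le hv)).1
    have h2 := hQl v
    have h3 : U * ‖v‖ ≤ U * R := by gcongr
    linarith
  have hmem : ∀ v, Ψ v < ⊤ → (Ψ v).toReal + P v + Q v ≤ J₀ → v ∈ K := by
    intro v hv hvJ
    have hvR : ‖v‖ ≤ R := by
      by_contra! hlt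
      have h1 := hE.coercive v hv
      have h2 := hQl v
      have h3 : |C₀ + c + J₀| ≤ |C₀ + c + J₀| * ‖v‖ :=
        le_mul_of_one_le_right (abs_nonneg _) (hR1.trans hlt.le)
      have h4 : (U + |C₀ + c + J₀|) * ‖v‖ < α * ‖v‖ * ‖v‖ := by
        have : 0 < ‖v‖ := by linarith
        have h5 : α * R < α * ‖v‖ := by gcongr
        have h6 : U + |C₀ + c + J₀| < α * ‖v‖ := hαR.trans h5
        gcongr
      have h7 := le_abs_self (C₀ + c + J₀)
      nlinarith
    refine ⟨?_, hvR⟩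
    rw [← ENNReal.ofReal_toReal hv.ne]
    exact ENNReal.ofReal_le_ofReal (by linarith [hlow v hvR])
  have hpK : p ∈ K := hmem p hp le_rfl
  have hlsc : LowerSemicontinuousOn
      (fun v => Ψ v + ENNReal.ofReal (P v + Q v + (B + U * R + c))) K := by
    refine LowerSemicontinuous.lowerSemicontinuousOn (hE.lsc.add ?_) K
    exact (ENNReal.continuous_ofReal.comp
      ((hE.continuous_potential.add hQ).add continuous_const)).lowerSemicontinuous
  obtain ⟨y, hyK, hy⟩ := hlsc.exists_isMinOn ⟨p, hpK⟩ (hE.compact C₁ R)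
  have hyt : Ψ y < ⊤ := hyK.1.trans_lt ENNReal.ofReal_lt_top
  have hcmp : ∀ v ∈ K, (Ψ y).toReal + P y + Q y ≤ (Ψ v).toReal + P v + Q v := by
    intro v hv
    have hvt : Ψ v < ⊤ := hv.1.trans_lt ENNReal.ofReal_lt_top
    have h1 := hy hv
    simp only [Set.mem_ofPred_eq] at h1
    have h2 := ENNReal.toReal_mono (by finiteness) h1
    rw [ENNReal.toReal_add hyt.ne (by finiteness), ENNReal.toReal_add hvt.ne (by finiteness),
      ENNReal.toReal_ofReal (by linarith [hlow y hyK.2]),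
      ENNReal.toReal_ofReal (by linarith [hlow v hv.2])] at h2
    linarith
  refine ⟨y, hyt, fun v hv => ?_⟩
  by_cases hvJ : (Ψ v).toReal + P v + Q v ≤ J₀
  · exact hcmp v (hmem v hv hvJ)
  · exact (hcmp p hpK).trans (not_le.1 hvJ).le

/-- The variational inequality satisfied by minimizers. -/
lemma variational_inequality (hE : IsEnergy Ψ P G L α C₀) {Q : H → ℝ} {y q : H} {c : ℝ}
    (hy : Ψ y < ⊤)
    (hmin : ∀ v, Ψ v < ⊤ → (Ψ y).toReal + P y + Q y ≤ (Ψ v).toReal + P v + Q v)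
    (hQ : ∀ w, Q w ≤ Q y + ⟪q, w - y⟫ + c * ‖w - y‖ ^ 2) {v : H} (hv : Ψ v < ⊤) :
    (Ψ y).toReal + ⟪G y + q, y - v⟫ ≤ (Ψ v).toReal := by
  have key : ∀ s ∈ Set.Ioc (0 : ℝ) 1,
      (Ψ y).toReal + ⟪G y + q, y - v⟫ ≤ (Ψ v).toReal + s * ((L + c) * ‖v - y‖ ^ 2) := by
    intro s hs
    have hcv := hE.convex v y s hs.1.le hs.2
    have hfin : ENNReal.ofReal s * Ψ v + ENNReal.ofReal (1 - s) * Ψ y ≠ ⊤ :=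
      ENNReal.add_ne_top.2 ⟨ENNReal.mul_ne_top ENNReal.ofReal_ne_top hv.ne,
        ENNReal.mul_ne_top ENNReal.ofReal_ne_top hy.ne⟩
    have h1 := ENNReal.toReal_mono hfin hcv
    rw [ENNReal.toReal_add (ENNReal.mul_ne_top ENNReal.ofReal_ne_top hv.ne)
      (ENNReal.mul_ne_top ENNReal.ofReal_ne_top hy.ne), ENNReal.toReal_mul, ENNReal.toReal_mul,
      ENNReal.toReal_ofReal hs.1.le, ENNReal.toReal_ofReal (by linarith [hs.2])] at h1
    have h2 := hmin _ (hcv.trans_lt hfin.lt_top)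
    have hw : s • v + (1 - s) • y - y = s • (v - y) := by module
    have h3 := (abs_le.1 (hE.taylor y (s • v + (1 - s) • y))).2
    have h4 := hQ (s • v + (1 - s) • y)
    rw [hw, inner_smul_right, norm_smul, mul_pow, Real.norm_eq_abs, sq_abs] at h3 h4
    have h5 : ⟪G y + q, y - v⟫ = -⟪G y, v - y⟫ - ⟪q, v - y⟫ := by
      rw [inner_add_left, ← neg_sub v y, inner_neg_right, inner_neg_right]; ring
    rw [h5]
    have h6 : s * ((Ψ y).toReal + (-⟪G y, v - y⟫ - ⟪q, v - y⟫)) ≤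
        s * ((Ψ v).toReal + s * ((L + c) * ‖v - y‖ ^ 2)) := by nlinarith
    exact le_of_mul_le_mul_left h6 hs.1
  have hlim : Tendsto (fun s : ℝ => (Ψ v).toReal + s * ((L + c) * ‖v - y‖ ^ 2)) (𝓝[>] 0)
      (𝓝 ((Ψ v).toReal + 0 * ((L + c) * ‖v - y‖ ^ 2))) := by
    refine Tendsto.mono_left ?_ nhdsWithin_le_nhds
    exact (Continuous.tendsto (by fun_prop) 0)
  rw [zero_mul, add_zero] at hlim
  refine ge_of_tendsto hlim ?_
  filter_upwards [Ioc_mem_nhdsGT (zero_lt_one' ℝ)] with s hs using key s hs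

/-- One step of the time discretization. -/
lemma exists_step (hE : IsEnergy Ψ P G L α C₀) (b : HilbertBasis ℕ ℝ H) {κ : ℕ → ℝ}
    (hκ : ∀ j, 0 ≤ κ j) {h ε τ : ℝ} (hh : 0 < h) (hε : 0 < ε) (hτ : 0 ≤ τ) (f : H) {p : H}
    (hp : Ψ p < ⊤) :
    ∃ y M ζ : H, Ψ y < ⊤ ∧ (∀ j, ⟪ζ, b j⟫ = κ j * ⟪M, b j⟫) ∧
      (∀ j, ⟪y - p, b j⟫ = -h * (κ j * ⟪ζ, b j⟫ + ε * ⟪M, b j⟫)) ∧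
      (∀ v, Ψ v < ⊤ →
        (Ψ y).toReal + ⟪τ • h⁻¹ • (y - p) + G y - f - M, y - v⟫ ≤ (Ψ v).toReal) ∧
      (Ψ y).toReal + P y - ⟪f, y⟫ +
        h / 2 * (‖ζ‖ ^ 2 + ε * ‖M‖ ^ 2 + τ * ‖h⁻¹ • (y - p)‖ ^ 2) ≤
        (Ψ p).toReal + P p - ⟪f, p⟫ := by
  have hd : ∀ j, 0 < κ j ^ 2 + ε := fun j => by positivity
  obtain ⟨T, hT⟩ := exists_diagonal_operator b (c := fun j => (κ j ^ 2 + ε)⁻¹) (C := ε⁻¹)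
    (fun j => by
      rw [abs_of_pos (inv_pos.2 (hd j))]
      exact inv_anti₀ hε (by nlinarith [sq_nonneg (κ j)]))
  obtain ⟨S, hS⟩ := exists_diagonal_operator b (c := fun j => κ j * (κ j ^ 2 + ε)⁻¹)
    (C := 1 + ε⁻¹) (fun j => by
      rw [abs_of_nonneg (mul_nonneg (hκ j) (inv_pos.2 (hd j)).le), ← div_eq_mul_inv,
        div_le_iff₀ (hd j)]
      have h1 : (1 + ε⁻¹) * (κ j ^ 2 + ε) = κ j ^ 2 + ε + ε⁻¹ * κ j ^ 2 + 1 := by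
        field_simp
        ring
      rw [h1]
      have : 0 ≤ ε⁻¹ * κ j ^ 2 := by positivity
      nlinarith [sq_nonneg (κ j - 1)])
  have hTsymm : ∀ v w, ⟪T v, w⟫ = ⟪T w, v⟫ := fun v w => by
    refine (hasSum_coord_mul b (T v) w).unique ?_
    convert hasSum_coord_mul b (T w) v using 2 with j
    rw [hT, hT]; ring
  have hTsq : ∀ v, ⟪T v, v⟫ = ‖S v‖ ^ 2 + ε * ‖T v‖ ^ 2 := fun v => by
    refine (hasSum_coord_mul b (T v) v).unique ?_
    convert (hasSum_coord_sq b (S v)).add ((hasSum_coord_sq b (T v)).mul_left ε) using 2 with j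
    rw [hT, hS]
    have := (hd j).ne'
    field_simp
  have hTnn : ∀ v, 0 ≤ ⟪T v, v⟫ := fun v => by rw [hTsq]; positivity
  set Q : H → ℝ := fun v => -⟪f, v⟫ + (2 * h)⁻¹ * ⟪T (v - p), v - p⟫ +
    τ * (2 * h)⁻¹ * ‖v - p‖ ^ 2 with hQ
  have hQc : Continuous Q := by
    have : Continuous fun v : H => T (v - p) := T.continuous.comp (by fun_prop)
    fun_prop
  obtain ⟨y, hy, hmin⟩ := hE.exists_minimizer hQc (U := ‖f‖) (c := 0) (norm_nonneg _)
    (fun v => by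
      have h1 := real_inner_le_norm f v
      have h2 : 0 ≤ (2 * h)⁻¹ * ⟪T (v - p), v - p⟫ := mul_nonneg (by positivity) (hTnn _)
      have h3 : 0 ≤ τ * (2 * h)⁻¹ * ‖v - p‖ ^ 2 := by positivity
      simp only [hQ]; linarith) hp
  have hQexp : ∀ w, Q w ≤ Q y + ⟪-f + h⁻¹ • T (y - p) + τ • h⁻¹ • (y - p), w - y⟫ +
      ((2 * h)⁻¹ * ‖T‖ + τ * (2 * h)⁻¹) * ‖w - y‖ ^ 2 := by
    intro w
    have e1 : w - p = (y - p) + (w - y) := by abel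
    have e2 : ⟪f, w⟫ = ⟪f, y⟫ + ⟪f, w - y⟫ := by rw [← inner_add_right]; congr 1; abel
    have e3 : ⟪T (w - p), w - p⟫ = ⟪T (y - p), y - p⟫ + 2 * ⟪T (y - p), w - y⟫ +
        ⟪T (w - y), w - y⟫ := by
      rw [e1, map_add, inner_add_left, inner_add_right, inner_add_right, hTsymm (w - y) (y - p)]
      ring
    have e4 : ‖w - p‖ ^ 2 = ‖y - p‖ ^ 2 + 2 * ⟪y - p, w - y⟫ + ‖w - y‖ ^ 2 := by
      rw [e1]; exact norm_add_sq_real _ _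
    have e5 : ⟪T (w - y), w - y⟫ ≤ ‖T‖ * ‖w - y‖ ^ 2 := by
      refine (real_inner_le_norm _ _).trans ?_
      rw [sq, ← mul_assoc]
      exact mul_le_mul_of_nonneg_right (T.le_opNorm _) (norm_nonneg _)
    have e6 : (2 * h)⁻¹ * ⟪T (w - y), w - y⟫ ≤ (2 * h)⁻¹ * (‖T‖ * ‖w - y‖ ^ 2) :=
      mul_le_mul_of_nonneg_left e5 (by positivity)
    simp only [hQ, e2, e3, e4, inner_add_left, inner_neg_left, real_inner_smul_left]
    have e7 : h⁻¹ = 2 * (2 * h)⁻¹ := by field_simp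
    rw [e7]
    nlinarith
  refine ⟨y, -h⁻¹ • T (y - p), -h⁻¹ • S (y - p), hy, fun j => ?_, fun j => ?_, fun v hv => ?_, ?_⟩
  · simp only [real_inner_smul_left, hT, hS]; ring
  · simp only [real_inner_smul_left, hT, hS]
    have := (hd j).ne'
    field_simp
    ring
  · have h1 := hE.variational_inequality hy hmin hQexp hv
    convert h1 using 3
    module
  · have h1 := hmin p hp
    simp only [hQ, sub_self, map_zero, norm_zero, hTsq] at h1
    simp only [norm_smul, norm_neg, norm_inv, Real.norm_eq_abs, abs_of_pos hh, mul_pow, inv_pow]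
    have h2 : h / 2 * ((h ^ 2)⁻¹ * ‖S (y - p)‖ ^ 2 + ε * ((h ^ 2)⁻¹ * ‖T (y - p)‖ ^ 2) +
        τ * ((h ^ 2)⁻¹ * ‖y - p‖ ^ 2)) = (2 * h)⁻¹ * (‖S (y - p)‖ ^ 2 + ε * ‖T (y - p)‖ ^ 2) +
        τ * (2 * h)⁻¹ * ‖y - p‖ ^ 2 := by
      field_simp
    rw [h2]
    linarith

end IsEnergy
end IncrementalScheme

section DiscreteEstimates

variable {H : Type*} [NormedAddCommGroup H] [InnerProductSpace ℝ H]

/-- Solutions of the implicit time discretization with step `h`, where the operator `A ^ (2 * r)`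
(with eigenvalues `κ j ^ 2`) is perturbed at the `n`-th step by `2⁻ⁿ` times the identity. -/
structure IsScheme (Ψ : H → ℝ≥0∞) (P : H → ℝ) (G : H → H) (b : HilbertBasis ℕ ℝ H)
    (κ : ℕ → ℝ) (τ h : ℝ) (f : ℕ → H) (y₀ : H) (Y M ζ Z : ℕ → H) : Prop where
  zero : Y 0 = y₀
  finite : ∀ n, Ψ (Y n) < ⊤
  coord : ∀ n j, ⟪ζ (n + 1), b j⟫ = κ j * ⟪M (n + 1), b j⟫
  incr : ∀ n j, ⟪Y (n + 1) - Y n, b j⟫ =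
    -h * (κ j * ⟪ζ (n + 1), b j⟫ + (1 / 2) ^ n * ⟪M (n + 1), b j⟫)
  rate : ∀ n, Z (n + 1) = τ • h⁻¹ • (Y (n + 1) - Y n)
  ineq : ∀ n v, Ψ v < ⊤ → (Ψ (Y (n + 1))).toReal +
    ⟪Z (n + 1) + G (Y (n + 1)) - f (n + 1) - M (n + 1), Y (n + 1) - v⟫ ≤ (Ψ v).toReal
  energy : ∀ n, (Ψ (Y (n + 1))).toReal + P (Y (n + 1)) - ⟪f (n + 1), Y (n + 1)⟫ +
    h / 2 * (‖ζ (n + 1)‖ ^ 2 + (1 / 2) ^ n * ‖M (n + 1)‖ ^ 2 + ‖Z (n + 1)‖ ^ 2) ≤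
    (Ψ (Y n)).toReal + P (Y n) - ⟪f (n + 1), Y n⟫

variable {Ψ : H → ℝ≥0∞} {P : H → ℝ} {G : H → H} {L α C₀ : ℝ}

lemma IsEnergy.exists_scheme (hE : IsEnergy Ψ P G L α C₀) (b : HilbertBasis ℕ ℝ H) {κ : ℕ → ℝ}
    (hκ : ∀ j, 0 ≤ κ j) {h τ : ℝ} (hh : 0 < h) (hτ : τ ∈ Set.Icc (0 : ℝ) 1) (f : ℕ → H) {y₀ : H}
    (hy₀ : Ψ y₀ < ⊤) : ∃ Y M ζ Z, IsScheme Ψ P G b κ τ h f y₀ Y M ζ Z := by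
  choose y M ζ hy h1 h2 h3 h4 using fun (n : ℕ) (p : {p // Ψ p < ⊤}) =>
    hE.exists_step b hκ hh (ε := (1 / 2) ^ n) (by positivity) hτ.1 (f (n + 1)) p.2
  let X : ℕ → {p // Ψ p < ⊤} := fun n =>
    Nat.rec ⟨y₀, hy₀⟩ (fun n p => ⟨y n p, hy n p⟩) n
  have hX : ∀ n, (X (n + 1) : H) = y n (X n) := fun n => rfl
  refine ⟨fun n => (X n).1, fun n => M (n - 1) (X (n - 1)), fun n => ζ (n - 1) (X (n - 1)),
    fun n => τ • h⁻¹ • ((X n).1 - (X (n - 1)).1), ?_, ?_, ?_, ?_, ?_, ?_, ?_⟩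
  · rfl
  · intro n; exact (X n).2
  · intro n j; exact h1 n _ j
  · intro n j; exact h2 n _ j
  · intro n; rfl
  · intro n v hv
    exact h3 n (X n) v hv
  · intro n
    refine le_trans ?_ (h4 n (X n))
    simp only [hX, Nat.add_sub_cancel]
    have h5 : ‖τ • h⁻¹ • (y n (X n) - (X n).1)‖ ^ 2 ≤ τ * ‖h⁻¹ • (y n (X n) - (X n).1)‖ ^ 2 := by
      rw [norm_smul, mul_pow, Real.norm_eq_abs, sq_abs]
      refine mul_le_mul_of_nonneg_right ?_ (sq_nonneg _)
      nlinarith [hτ.1, hτ.2]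
    gcongr

/-- A priori estimates for the discrete scheme, uniform in the time step. -/
lemma IsEnergy.exists_scheme_bound (hE : IsEnergy Ψ P G L α C₀) (b : HilbertBasis ℕ ℝ H)
    (κ : ℕ → ℝ) (τ : ℝ) (y₀ : H) {U V : ℝ} (hU : 0 ≤ U) (hV : 0 ≤ V) :
    ∃ C, 0 ≤ C ∧ ∀ (h : ℝ) (f Y M ζ Z : ℕ → H), 0 < h → (∀ n, ‖f n‖ ≤ U) →
      (∀ n, ∑ i ∈ Finset.range n, ‖f (i + 1) - f i‖ ≤ V) →
      IsScheme Ψ P G b κ τ h f y₀ Y M ζ Z → ∀ n, ‖Y n‖ ≤ C ∧ (Ψ (Y n)).toReal ≤ C ∧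
        h * ∑ i ∈ Finset.range n,
          (‖ζ (i + 1)‖ ^ 2 + (1 / 2) ^ i * ‖M (i + 1)‖ ^ 2 + ‖Z (i + 1)‖ ^ 2) ≤ C := by
  have hα := hE.pos
  set F₀ := |(Ψ y₀).toReal + P y₀| + U * ‖y₀‖ with hF₀
  have hF₀n : 0 ≤ F₀ := by positivity
  set R := (U + V + |C₀| + F₀) / α + 1 + ‖y₀‖ with hR
  have hR1 : 1 ≤ R := by
    have : 0 ≤ (U + V + |C₀| + F₀) / α := by positivity
    linarith [norm_nonneg y₀]
  have hαR : U + V + |C₀| + F₀ < α * R := by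
    rw [hR, mul_add, mul_add, mul_div_cancel₀ _ hα.ne']
    nlinarith [mul_nonneg hα.le (norm_nonneg y₀)]
  set B := |P 0| + ‖G 0‖ * R + |L| * R ^ 2 with hB
  have hBn : 0 ≤ B := by positivity
  have hV0 : 0 ≤ V * R := by positivity
  have hU0 : 0 ≤ U * R := by positivity
  refine ⟨R + (F₀ + V * R + B + U * R) + 2 * (F₀ + V * R + B + U * R), by positivity, ?_⟩
  intro h f Y M ζ Z hh hf hfV hS
  set D : ℕ → ℝ := fun i =>
    ‖ζ (i + 1)‖ ^ 2 + (1 / 2) ^ i * ‖M (i + 1)‖ ^ 2 + ‖Z (i + 1)‖ ^ 2 with hD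
  have hDn : ∀ i, 0 ≤ D i := fun i => by simp only [hD]; positivity
  have htel : ∀ n, (Ψ (Y n)).toReal + P (Y n) - ⟪f n, Y n⟫ + h / 2 * ∑ i ∈ Finset.range n, D i ≤
      F₀ + ∑ i ∈ Finset.range n, ‖f (i + 1) - f i‖ * ‖Y i‖ := by
    intro n
    induction n with
    | zero =>
      simp only [Finset.range_zero, Finset.sum_empty, mul_zero, add_zero, hS.zero]
      have h1 := le_abs_self ((Ψ y₀).toReal + P y₀)
      have h2 := (abs_le.1 (abs_real_inner_le_norm (f 0) y₀)).1
      have h3 : ‖f 0‖ * ‖y₀‖ ≤ U * ‖y₀‖ := by gcongr; exact hf 0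
      linarith
    | succ n ih =>
      rw [Finset.sum_range_succ, Finset.sum_range_succ, mul_add]
      have h1 := hS.energy n
      have h2 : ⟪f (n + 1), Y n⟫ = ⟪f n, Y n⟫ + ⟪f (n + 1) - f n, Y n⟫ := by
        rw [← inner_add_left]; congr 1; abel
      have h3 := (abs_le.1 (abs_real_inner_le_norm (f (n + 1) - f n) (Y n))).1
      simp only [hD] at ih ⊢
      linarith
  have hbd : ∀ n, ‖Y n‖ ≤ R := by
    intro n
    induction n using Nat.strong_induction_on with
    | _ n ih =>
      by_contra! hlt
      have h1 := htel n
      have h2 : ∑ i ∈ Finset.range n, ‖f (i + 1) - f i‖ * ‖Y i‖ ≤ V * R := by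
        refine le_trans ?_ (mul_le_mul_of_nonneg_right (hfV n) (by linarith))
        rw [Finset.sum_mul]
        exact Finset.sum_le_sum fun i hi =>
          mul_le_mul_of_nonneg_left (ih i (Finset.mem_range.1 hi)) (norm_nonneg _)
      have h3 : 0 ≤ h / 2 * ∑ i ∈ Finset.range n, D i :=
        mul_nonneg (by positivity) (Finset.sum_nonneg fun i _ => hDn i)
      have h4 := hE.coercive (Y n) (hS.finite n)
      have h5 := real_inner_le_norm (f n) (Y n)
      have h6 : ‖f n‖ * ‖Y n‖ ≤ U * ‖Y n‖ := by gcongr; exact hf n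
      have h7 : (|C₀| + F₀) ≤ (|C₀| + F₀) * ‖Y n‖ :=
        le_mul_of_one_le_right (by positivity) (hR1.trans hlt.le)
      have h8 : V * R ≤ V * ‖Y n‖ := by gcongr
      have h9 : (U + V + |C₀| + F₀) * ‖Y n‖ < α * ‖Y n‖ * ‖Y n‖ := by
        have : 0 < ‖Y n‖ := by linarith
        have h10 : α * R < α * ‖Y n‖ := by gcongr
        have h11 : U + V + |C₀| + F₀ < α * ‖Y n‖ := hαR.trans h10
        gcongr
      nlinarith [le_abs_self C₀]
  intro n
  have h1 := htel n
  have h2 : ∑ i ∈ Finset.range n, ‖f (i + 1) - f i‖ * ‖Y i‖ ≤ V * R := by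
    refine le_trans ?_ (mul_le_mul_of_nonneg_right (hfV n) (by linarith))
    rw [Finset.sum_mul]
    exact Finset.sum_le_sum fun i _ => mul_le_mul_of_nonneg_left (hbd i) (norm_nonneg _)
  have h3 : 0 ≤ h / 2 * ∑ i ∈ Finset.range n, D i :=
    mul_nonneg (by positivity) (Finset.sum_nonneg fun i _ => hDn i)
  have h4 := (abs_le.1 (hE.abs_potential_le (hbd n))).1
  have h5 := real_inner_le_norm (f n) (Y n)
  have h6 : ‖f n‖ * ‖Y n‖ ≤ U * R := by
    gcongr
    · exact hf n
    · exact hbd n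
  have h7 : 0 ≤ (Ψ (Y n)).toReal := ENNReal.toReal_nonneg
  refine ⟨by linarith [hbd n], by linarith, ?_⟩
  change h * ∑ i ∈ Finset.range n, D i ≤ _
  linarith

/-- The qualification condition controlling the component of the chemical potential in the kernel
of the operator: the datum lies strictly between two admissible states. -/
def KernelCondition (Ψ : H → ℝ≥0∞) (b : HilbertBasis ℕ ℝ H) (κ : ℕ → ℝ) (y₀ : H) : Prop :=
  ∃ c : ℝ, 0 < c ∧ ((∀ j, c ≤ κ j) ∨ (κ 0 = 0 ∧ (∀ j, c ≤ κ (j + 1)) ∧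
    ∃ w₁ w₂, Ψ w₁ < ⊤ ∧ Ψ w₂ < ⊤ ∧ ⟪w₁, b 0⟫ < ⟪y₀, b 0⟫ ∧ ⟪y₀, b 0⟫ < ⟪w₂, b 0⟫))

lemma KernelCondition.exists_bound {b : HilbertBasis ℕ ℝ H} {κ : ℕ → ℝ} {y₀ : H}
    (hK : KernelCondition Ψ b κ y₀) {R : ℝ} (hR : 0 ≤ R) :
    ∃ C δ : ℝ, 0 ≤ C ∧ 0 < δ ∧ ∀ y M ζ g : H, ‖y‖ ≤ R →
      (κ 0 = 0 → |⟪y, b 0⟫ - ⟪y₀, b 0⟫| ≤ δ) →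
      (∀ j, ⟪ζ, b j⟫ = κ j * ⟪M, b j⟫) →
      (∀ v, Ψ v < ⊤ → (Ψ y).toReal + ⟪g - M, y - v⟫ ≤ (Ψ v).toReal) →
      ‖M‖ ≤ C * (1 + ‖ζ‖ + ‖g‖) := by
  obtain ⟨c, hc, hK⟩ := hK
  have hcoord : ∀ N ζ : H, (∀ j, |⟪N, b j⟫| * c ≤ |⟪ζ, b j⟫|) →
      ‖N‖ ≤ c⁻¹ * ‖ζ‖ := by
    intro N ζ hN
    refine abs_le_of_sq_le_sq' ?_ (by positivity) |>.2
    rw [mul_pow]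
    refine hasSum_le (fun j => ?_) (hasSum_coord_sq b N) ((hasSum_coord_sq b ζ).mul_left _)
    rw [← mul_pow, sq_le_sq, abs_mul, abs_of_pos (inv_pos.2 hc), inv_mul_eq_div, le_div_iff₀ hc]
    exact hN j
  rcases hK with hK | ⟨hκ₀, hK, w₁, w₂, hw₁, hw₂, hlt₁, hlt₂⟩
  · refine ⟨c⁻¹, 1, by positivity, one_pos, fun y M ζ g _ _ hζ _ => ?_⟩
    refine (hcoord M ζ fun j => ?_).trans ?_
    · rw [hζ, abs_mul, mul_comm]
      exact mul_le_mul_of_nonneg_right ((hK j).trans (le_abs_self _)) (abs_nonneg _)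
    · refine mul_le_mul_of_nonneg_left ?_ (by positivity)
      linarith [norm_nonneg g]
  · set δ := min (⟪y₀, b 0⟫ - ⟪w₁, b 0⟫) (⟪w₂, b 0⟫ - ⟪y₀, b 0⟫) / 2 with hδ
    have hδ0 : 0 < δ := half_pos (lt_min (sub_pos.2 hlt₁) (sub_pos.2 hlt₂))
    have hδ₁ : 2 * δ ≤ ⟪y₀, b 0⟫ - ⟪w₁, b 0⟫ := by
      have := min_le_left (⟪y₀, b 0⟫ - ⟪w₁, b 0⟫) (⟪w₂, b 0⟫ - ⟪y₀, b 0⟫)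
      linarith
    have hδ₂ : 2 * δ ≤ ⟪w₂, b 0⟫ - ⟪y₀, b 0⟫ := by
      have := min_le_right (⟪y₀, b 0⟫ - ⟪w₁, b 0⟫) (⟪w₂, b 0⟫ - ⟪y₀, b 0⟫)
      linarith
    set W := (Ψ w₁).toReal + (Ψ w₂).toReal with hW
    set S := ‖w₁‖ + ‖w₂‖ + R with hS
    have hW₁ : 0 ≤ (Ψ w₁).toReal := ENNReal.toReal_nonneg
    have hW₂ : 0 ≤ (Ψ w₂).toReal := ENNReal.toReal_nonneg
    have hWn : 0 ≤ W := by positivity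
    have hSn : 0 ≤ S := by positivity
    refine ⟨δ⁻¹ * (W + (1 + c⁻¹) * S) + c⁻¹, δ, by positivity, hδ0,
      fun y M ζ g hy hyδ hζ hineq => ?_⟩
    set m := ⟪M, b 0⟫ with hm
    set N := M - m • b 0 with hN
    have hNle : ‖N‖ ≤ c⁻¹ * ‖ζ‖ := by
      refine hcoord N ζ fun j => ?_
      rw [hN, inner_sub_left, real_inner_smul_left]
      rcases j with _ | j
      · simp [hm, b.orthonormal.1 0]
      · rw [b.orthonormal.2 (Nat.succ_ne_zero j).symm, hζ, mul_zero, sub_zero, abs_mul, mul_comm]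
        exact mul_le_mul_of_nonneg_right ((hK j).trans (le_abs_self _)) (abs_nonneg _)
    have hMN : M = N + m • b 0 := by rw [hN]; abel
    have hgen : ∀ w, Ψ w < ⊤ → (Ψ w).toReal ≤ W → ‖w‖ + R ≤ S →
        m * (⟪w, b 0⟫ - ⟪y, b 0⟫) ≤ W + (‖g‖ + c⁻¹ * ‖ζ‖) * S := by
      intro w hw hwW hwS
      have h1 := hineq w hw
      have h2 : 0 ≤ (Ψ y).toReal := ENNReal.toReal_nonneg
      have h3 : ⟪g - M, y - w⟫ = ⟪g - N, y - w⟫ + m * (⟪w, b 0⟫ - ⟪y, b 0⟫) := by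
        rw [hMN, ← sub_sub, inner_sub_left (g - N), real_inner_smul_left, inner_sub_right,
          inner_sub_right (b 0), real_inner_comm y (b 0), real_inner_comm w (b 0),
          ← inner_sub_right]
        ring
      have h4 := (abs_le.1 (abs_real_inner_le_norm (g - N) (y - w))).1
      have h5 : ‖g - N‖ * ‖y - w‖ ≤ (‖g‖ + c⁻¹ * ‖ζ‖) * S := by
        gcongr
        · exact (norm_sub_le _ _).trans (by linarith)
        · exact (norm_sub_le _ _).trans (by linarith)
      linarith
    have hm_le : |m| * δ ≤ W + (‖g‖ + c⁻¹ * ‖ζ‖) * S := by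
      obtain ⟨h1, h2⟩ := abs_le.1 (hyδ hκ₀)
      rcases le_total 0 m with h0 | h0
      · rw [abs_of_nonneg h0]
        refine le_trans ?_ (hgen w₂ hw₂ (by linarith) (by linarith [norm_nonneg w₁]))
        exact mul_le_mul_of_nonneg_left (by linarith) h0
      · rw [abs_of_nonpos h0]
        refine le_trans ?_ (hgen w₁ hw₁ (by linarith) (by linarith [norm_nonneg w₂]))
        nlinarith
    have h6 : ‖M‖ ≤ ‖N‖ + |m| := by
      rw [hMN]
      refine (norm_add_le _ _).trans ?_
      rw [norm_smul, b.orthonormal.1 0, mul_one, Real.norm_eq_abs]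
    have h7 : |m| ≤ δ⁻¹ * (W + (‖g‖ + c⁻¹ * ‖ζ‖) * S) := by
      rw [inv_mul_eq_div, le_div_iff₀ hδ0]; exact hm_le
    have h8 : W + (‖g‖ + c⁻¹ * ‖ζ‖) * S ≤ (W + (1 + c⁻¹) * S) * (1 + ‖ζ‖ + ‖g‖) := by
      have e1 : 0 ≤ W * ‖ζ‖ := by positivity
      have e2 : 0 ≤ W * ‖g‖ := by positivity
      have e3 : 0 ≤ c⁻¹ * S := by positivity
      have e4 : 0 ≤ S * ‖ζ‖ := by positivity
      have e5 : 0 ≤ c⁻¹ * S * ‖g‖ := by positivity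
      nlinarith
    have h9 : δ⁻¹ * (W + (‖g‖ + c⁻¹ * ‖ζ‖) * S) ≤
        δ⁻¹ * ((W + (1 + c⁻¹) * S) * (1 + ‖ζ‖ + ‖g‖)) := by gcongr
    have h10 : c⁻¹ * ‖ζ‖ ≤ c⁻¹ * (1 + ‖ζ‖ + ‖g‖) := by
      gcongr; linarith [norm_nonneg g]
    linarith

/-- The discrete scheme is solvable with estimates which are uniform in the time step. -/
lemma IsEnergy.exists_bounded_scheme (hE : IsEnergy Ψ P G L α C₀) (b : HilbertBasis ℕ ℝ H)
    {κ : ℕ → ℝ} (hκ : ∀ j, 0 ≤ κ j) {τ : ℝ} (hτ : τ ∈ Set.Icc (0 : ℝ) 1) {y₀ : H}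
    (hy₀ : Ψ y₀ < ⊤) (hK : KernelCondition Ψ b κ y₀) {U V : ℝ} (hU : 0 ≤ U) (hV : 0 ≤ V) :
    ∃ C h₀, 0 ≤ C ∧ 0 < h₀ ∧ ∀ (h : ℝ) (f : ℕ → H), 0 < h → h ≤ h₀ → (∀ n, ‖f n‖ ≤ U) →
      (∀ n, ∑ i ∈ Finset.range n, ‖f (i + 1) - f i‖ ≤ V) →
      ∃ Y M ζ Z, IsScheme Ψ P G b κ τ h f y₀ Y M ζ Z ∧ ∀ n, ‖Y n‖ ≤ C ∧
        (Ψ (Y n)).toReal ≤ C ∧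
        h * ∑ i ∈ Finset.range n, (‖ζ (i + 1)‖ ^ 2 + ‖Z (i + 1)‖ ^ 2) ≤ C ∧
        h * ∑ i ∈ Finset.range n, (1 / 2) ^ i * ‖M (i + 1)‖ ≤ C * √h ∧
        ‖M (n + 1)‖ ≤ C * (1 + ‖ζ (n + 1)‖ + ‖Z (n + 1)‖) := by
  obtain ⟨C₁, hC₁, hb⟩ := hE.exists_scheme_bound b κ τ y₀ hU hV
  obtain ⟨C₂, δ, hC₂, hδ, hM⟩ := hK.exists_bound hC₁
  set B := ‖G 0‖ + |L| * C₁ + U with hB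
  have hBn : 0 ≤ B := by positivity
  refine ⟨C₁ + 1 + C₂ * (1 + B), (δ / (1 + C₁)) ^ 2, by positivity, by positivity, ?_⟩
  intro h f hh hh₀ hf hfV
  obtain ⟨Y, M, ζ, Z, hS⟩ := hE.exists_scheme b hκ hh hτ f hy₀
  have hb := hb h f Y M ζ Z hh hf hfV hS
  have hsqrt : √h * √h = h := Real.mul_self_sqrt hh.le
  have herr : ∀ n, h * ∑ i ∈ Finset.range n, (1 / 2) ^ i * ‖M (i + 1)‖ ≤ (1 + C₁) * √h := by
    intro n
    have h1 : ∀ i ∈ Finset.range n, √h * ((1 / 2) ^ i * ‖M (i + 1)‖) ≤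
        (1 / 2) * (1 / 2) ^ i + h * (1 / 2) * ((1 / 2) ^ i * ‖M (i + 1)‖ ^ 2) := by
      intro i _
      have h2 : √h * ‖M (i + 1)‖ ≤ 1 / 2 + h * (1 / 2) * ‖M (i + 1)‖ ^ 2 := by
        nlinarith [sq_nonneg (1 - √h * ‖M (i + 1)‖)]
      have h3 : (0 : ℝ) < (1 / 2) ^ i := by positivity
      nlinarith
    have h2 := Finset.sum_le_sum h1
    rw [Finset.sum_add_distrib, ← Finset.mul_sum, ← Finset.mul_sum, ← Finset.mul_sum] at h2
    have h3 : ∑ i ∈ Finset.range n, (1 / 2 : ℝ) ^ i ≤ 2 := sum_geometric_two_le n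
    have h4 : h * ∑ i ∈ Finset.range n, (1 / 2) ^ i * ‖M (i + 1)‖ ^ 2 ≤ C₁ := by
      refine le_trans ?_ (hb n).2.2
      gcongr with i _
      nlinarith [sq_nonneg ‖ζ (i + 1)‖, sq_nonneg ‖Z (i + 1)‖]
    have h5 : √h * ∑ i ∈ Finset.range n, (1 / 2) ^ i * ‖M (i + 1)‖ ≤ 1 + C₁ := by linarith
    calc h * ∑ i ∈ Finset.range n, (1 / 2) ^ i * ‖M (i + 1)‖
        = √h * ∑ i ∈ Finset.range n, (1 / 2) ^ i * ‖M (i + 1)‖ * √h := by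
          rw [← Finset.sum_mul, mul_comm _ (√h), ← mul_assoc, hsqrt]
      _ ≤ _ := by
          rw [← Finset.sum_mul, ← mul_assoc]
          exact mul_le_mul_of_nonneg_right h5 (Real.sqrt_nonneg h)
  refine ⟨Y, M, ζ, Z, hS, fun n => ?_⟩
  have hpos : 0 ≤ C₂ * (1 + B) := by positivity
  obtain ⟨hb₁, hb₂, hb₃⟩ := hb n
  refine ⟨by linarith, by linarith, ?_, (herr n).trans ?_, ?_⟩
  · refine le_trans ?_ (hb₃.trans (by linarith))
    gcongr with i _
    have : 0 ≤ (1 / 2 : ℝ) ^ i * ‖M (i + 1)‖ ^ 2 := by positivity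
    linarith
  · exact mul_le_mul_of_nonneg_right (by linarith) (Real.sqrt_nonneg h)
  · obtain ⟨hY, -, -⟩ := hb (n + 1)
    have h1 := hM (Y (n + 1)) (M (n + 1)) (ζ (n + 1)) (Z (n + 1) + G (Y (n + 1)) - f (n + 1)) hY
      (fun h0 => ?_) (hS.coord n) (hS.ineq n)
    · have h2 : ‖Z (n + 1) + G (Y (n + 1)) - f (n + 1)‖ ≤ ‖Z (n + 1)‖ + B := by
        have := hE.norm_gradient_le hY
        refine (norm_sub_le _ _).trans ?_
        have := norm_add_le (Z (n + 1)) (G (Y (n + 1)))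
        linarith [hf (n + 1)]
      refine h1.trans ?_
      have h3 : 1 + ‖ζ (n + 1)‖ + ‖Z (n + 1) + G (Y (n + 1)) - f (n + 1)‖ ≤
          (1 + B) * (1 + ‖ζ (n + 1)‖ + ‖Z (n + 1)‖) := by
        nlinarith [norm_nonneg (ζ (n + 1)), norm_nonneg (Z (n + 1))]
      calc _ ≤ C₂ * ((1 + B) * (1 + ‖ζ (n + 1)‖ + ‖Z (n + 1)‖)) := by gcongr
        _ = C₂ * (1 + B) * (1 + ‖ζ (n + 1)‖ + ‖Z (n + 1)‖) := by ring
        _ ≤ _ := by gcongr; linarith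
    · have h2 : ∀ m, |⟪Y m, b 0⟫ - ⟪y₀, b 0⟫| ≤
          h * ∑ i ∈ Finset.range m, (1 / 2) ^ i * ‖M (i + 1)‖ := by
        intro m
        induction m with
        | zero => simp [hS.zero]
        | succ m ih =>
          have h3 := hS.incr m 0
          rw [h0, zero_mul, zero_add, inner_sub_left] at h3
          rw [Finset.sum_range_succ, mul_add]
          have h4 : |⟪M (m + 1), b 0⟫| ≤ ‖M (m + 1)‖ := by
            simpa [b.orthonormal.1 0] using abs_real_inner_le_norm (M (m + 1)) (b 0)
          have h5 : |⟪Y (m + 1), b 0⟫ - ⟪Y m, b 0⟫| ≤ h * ((1 / 2) ^ m * ‖M (m + 1)‖) := by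
            rw [h3, abs_mul, abs_neg, abs_of_pos hh, abs_mul, abs_of_pos (by positivity)]
            gcongr
          have h6 := _root_.abs_sub_le ⟪Y (m + 1), b 0⟫ ⟪Y m, b 0⟫ ⟪y₀, b 0⟫
          linarith
      refine ((h2 (n + 1)).trans (herr _)).trans ?_
      have h3 : √h ≤ δ / (1 + C₁) := (Real.sqrt_le_left (by positivity)).2 hh₀
      rw [le_div_iff₀ (by positivity)] at h3
      linarith

end DiscreteEstimates

section StepFunctions

lemma ceil_div_eq_iff {h : ℝ} (hh : 0 < h) {n : ℕ} {t : ℝ} :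
    ⌈t / h⌉₊ = n + 1 ↔ t ∈ Ioc (n * h) ((n + 1 : ℕ) * h) := by
  rw [Nat.ceil_eq_iff (Nat.succ_ne_zero n), Nat.succ_eq_add_one, Nat.add_sub_cancel,
    lt_div_iff₀ hh, div_le_iff₀ hh, mem_Ioc]

lemma stronglyMeasurable_step {E : Type*} [TopologicalSpace E] (F : ℕ → E) (h : ℝ) :
    StronglyMeasurable fun t : ℝ => F ⌈t / h⌉₊ :=
  (StronglyMeasurable.of_discrete (f := F)).comp_measurable
    (Nat.measurable_ceil.comp (measurable_id.div_const h))

lemma lintegral_step {h : ℝ} (hh : 0 < h) (F : ℕ → ℝ≥0∞) :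
    ∫⁻ t in Ioi (0 : ℝ), F ⌈t / h⌉₊ = ∑' i, ENNReal.ofReal h * F (i + 1) := by
  have hmono : Monotone fun n : ℕ => (n : ℝ) * h := fun m n hmn => by
    dsimp only; gcongr
  have hU : Ioi (0 : ℝ) = ⋃ n : ℕ, Ioc ((n : ℝ) * h) ((n + 1 : ℕ) * h) := by
    ext t
    simp only [mem_Ioi, mem_iUnion]
    constructor
    · intro ht
      obtain ⟨n, hn⟩ := Nat.exists_eq_succ_of_ne_zero (Nat.ceil_pos.2 (div_pos ht hh)).ne'
      exact ⟨n, (ceil_div_eq_iff hh).1 hn⟩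
    · rintro ⟨n, hn, -⟩
      exact lt_of_le_of_lt (by positivity) hn
  rw [hU, lintegral_iUnion (fun n => measurableSet_Ioc)
    (by simpa using hmono.pairwise_disjoint_on_Ioc_succ)]
  refine tsum_congr fun n => ?_
  rw [setLIntegral_congr_fun measurableSet_Ioc (g := fun _ => F (n + 1))
    (fun t ht => by simp only [(ceil_div_eq_iff hh).2 ht]), setLIntegral_const,
    Real.volume_Ioc, mul_comm]
  congr 2
  push_cast
  ring

lemma intervalIntegrable_step {h : ℝ} (hh : 0 < h) (F : ℕ → ℝ) (n : ℕ) {a b : ℝ}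
    (ha : n * h ≤ a) (hab : a ≤ b) (hb : b ≤ (n + 1 : ℕ) * h) :
    IntervalIntegrable (fun t => F ⌈t / h⌉₊) volume a b := by
  rw [intervalIntegrable_iff_integrableOn_Ioc_of_le hab]
  refine (integrableOn_const (C := F (n + 1)) (by simp) (by simp)).congr_fun (fun t ht => ?_)
    measurableSet_Ioc
  dsimp only
  rw [(ceil_div_eq_iff hh).2 ⟨ha.trans_lt ht.1, ht.2.trans hb⟩]

lemma integral_step_piece {h : ℝ} (hh : 0 < h) (F : ℕ → ℝ) (n : ℕ) {a b : ℝ}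
    (ha : n * h ≤ a) (hab : a ≤ b) (hb : b ≤ (n + 1 : ℕ) * h) :
    ∫ t in a..b, F ⌈t / h⌉₊ = (b - a) * F (n + 1) := by
  rw [intervalIntegral.integral_of_le hab, setIntegral_congr_fun (g := fun _ => F (n + 1))
    measurableSet_Ioc (fun t ht => by
      dsimp only; rw [(ceil_div_eq_iff hh).2 ⟨ha.trans_lt ht.1, ht.2.trans hb⟩])]
  simp [hab]

lemma integral_step {h : ℝ} (hh : 0 < h) (F : ℕ → ℝ) (n : ℕ) :
    ∫ t in (0 : ℝ)..n * h, F ⌈t / h⌉₊ = h * ∑ i ∈ Finset.range n, F (i + 1) := by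
  have hle : ∀ k : ℕ, (k : ℝ) * h ≤ (k + 1 : ℕ) * h := fun k => by
    push_cast; linarith
  have h1 := intervalIntegral.sum_integral_adjacent_intervals (a := fun k : ℕ => (k : ℝ) * h)
    (μ := volume) (f := fun t => F ⌈t / h⌉₊) (n := n)
    (fun k _ => intervalIntegrable_step hh F k le_rfl (hle k) le_rfl)
  simp only [Nat.cast_zero, zero_mul] at h1
  rw [← h1, Finset.mul_sum]
  refine Finset.sum_congr rfl fun k _ => ?_
  rw [integral_step_piece hh F k le_rfl (hle k) le_rfl]
  push_cast
  ring

lemma intervalIntegrable_step' {h : ℝ} (hh : 0 < h) (F : ℕ → ℝ) (n : ℕ) :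
    IntervalIntegrable (fun t => F ⌈t / h⌉₊) volume 0 (n * h) := by
  have h1 := IntervalIntegrable.trans_iterate (a := fun k : ℕ => (k : ℝ) * h)
    (μ := volume) (f := fun t => F ⌈t / h⌉₊) (n := n)
    (fun k _ => intervalIntegrable_step hh F k le_rfl (by push_cast; linarith) le_rfl)
  simpa using h1

/-- Integrating a step function up to time `t` or up to the next node differ by a small amount. -/
lemma abs_integral_step_sub_le {h : ℝ} (hh : 0 < h) (F : ℕ → ℝ) {t : ℝ} (ht : 0 ≤ t) :
    |(∫ s in (0 : ℝ)..t, F ⌈s / h⌉₊) - h * ∑ i ∈ Finset.range ⌈t / h⌉₊, F (i + 1)| ≤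
      h * |F ⌈t / h⌉₊| := by
  rcases ht.eq_or_lt with rfl | ht
  · simp
    positivity
  obtain ⟨n, hn⟩ := Nat.exists_eq_succ_of_ne_zero (Nat.ceil_pos.2 (div_pos ht hh)).ne'
  have h1 := (ceil_div_eq_iff hh).1 hn
  have h2 := intervalIntegral.integral_add_adjacent_intervals (a := (0 : ℝ)) (b := n * h) (c := t)
    (intervalIntegrable_step' hh F n) (intervalIntegrable_step hh F n le_rfl h1.1.le h1.2)
  rw [hn, ← h2, integral_step hh, integral_step_piece hh F n le_rfl h1.1.le h1.2,
    Nat.succ_eq_add_one, Finset.sum_range_succ]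
  have h3 : h * ∑ i ∈ Finset.range n, F (i + 1) + (t - n * h) * F (n + 1) -
      h * (∑ i ∈ Finset.range n, F (i + 1) + F (n + 1)) = (t - (n + 1 : ℕ) * h) * F (n + 1) := by
    push_cast; ring
  rw [h3, abs_mul]
  refine mul_le_mul_of_nonneg_right ?_ (abs_nonneg _)
  rw [abs_le]
  push_cast at h1 ⊢
  constructor <;> linarith [h1.1, h1.2]

end StepFunctions

section Approximation

variable {H : Type*} [NormedAddCommGroup H] [InnerProductSpace ℝ H]

/-- Piecewise constant approximate solutions with time step `h` and the estimates they satisfy. -/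
structure IsApprox (Ψ : H → ℝ≥0∞) (G : H → H) (b : HilbertBasis ℕ ℝ H) (κ : ℕ → ℝ)
    (τ h C : ℝ) (u : ℝ → H) (y₀ : H) (Y M ζ Z : ℝ → H) : Prop where
  measurable_Y : StronglyMeasurable Y
  measurable_M : StronglyMeasurable M
  measurable_ζ : StronglyMeasurable ζ
  measurable_Z : StronglyMeasurable Z
  norm_le : ∀ t, ‖Y t‖ ≤ C
  energy_le : ∀ t, Ψ (Y t) ≤ ENNReal.ofReal C
  coord : ∀ t, 0 < t → ∀ j, ⟪ζ t, b j⟫ = κ j * ⟪M t, b j⟫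
  evol : ∀ t, 0 ≤ t → ∀ j,
    |⟪Y t, b j⟫ - ⟪y₀, b j⟫ + κ j * ∫ s in (0 : ℝ)..t, ⟪ζ s, b j⟫| ≤ (1 + κ j) * C * √h
  rate : ∃ e : ℝ → ℝ≥0∞, (∀ t, 0 < t → ∀ j, ‖⟪Z t, b j⟫ + τ * κ j * ⟪ζ t, b j⟫‖ₑ ≤ e t) ∧
    ∫⁻ t in Ioi (0 : ℝ), e t ≤ ENNReal.ofReal (C * √h)
  ineq : ∀ t, 0 < t → ∀ v, Ψ v < ⊤ → (Ψ (Y t)).toReal +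
    ⟪Z t + G (Y t) - u (⌈t / h⌉₊ * h) - M t, Y t - v⟫ ≤ (Ψ v).toReal
  lintegral_le : ∫⁻ t in Ioi (0 : ℝ), (‖ζ t‖ₑ ^ 2 + ‖Z t‖ₑ ^ 2) ≤ ENNReal.ofReal C
  norm_M_le : ∀ t, 0 < t → ‖M t‖ ≤ C * (1 + ‖ζ t‖ + ‖Z t‖)

variable {Ψ : H → ℝ≥0∞} {P : H → ℝ} {G : H → H} {L α C₀ : ℝ}

lemma lintegral_step_le {h : ℝ} (hh : 0 < h) {F : ℕ → ℝ} (hF : ∀ i, 0 ≤ F (i + 1)) {C : ℝ}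
    (hC : ∀ n, h * ∑ i ∈ Finset.range n, F (i + 1) ≤ C) :
    ∫⁻ t in Ioi (0 : ℝ), ENNReal.ofReal (F ⌈t / h⌉₊) ≤ ENNReal.ofReal C := by
  rw [lintegral_step hh (fun n => ENNReal.ofReal (F n))]
  refine ENNReal.tsum_le_of_sum_range_le fun n => ?_
  rw [← Finset.mul_sum, ← ENNReal.ofReal_sum_of_nonneg fun i _ => hF i,
    ← ENNReal.ofReal_mul hh.le]
  exact ENNReal.ofReal_le_ofReal (hC n)

lemma IsEnergy.exists_approx (hE : IsEnergy Ψ P G L α C₀) (b : HilbertBasis ℕ ℝ H)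
    {κ : ℕ → ℝ} (hκ : ∀ j, 0 ≤ κ j) {τ : ℝ} (hτ : τ ∈ Set.Icc (0 : ℝ) 1) {y₀ : H}
    (hy₀ : Ψ y₀ < ⊤) (hK : KernelCondition Ψ b κ y₀) {u : ℝ → H} {U V : ℝ}
    (hU : ∀ t, 0 ≤ t → ‖u t‖ ≤ U)
    (hV : ∀ h : ℝ, 0 < h → ∀ n : ℕ,
      ∑ i ∈ Finset.range n, ‖u ((i + 1 : ℕ) * h) - u (i * h)‖ ≤ V) :
    ∃ C h₀, 0 ≤ C ∧ 0 < h₀ ∧ ∀ h, 0 < h → h ≤ h₀ →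
      ∃ Y M ζ Z, IsApprox Ψ G b κ τ h C u y₀ Y M ζ Z := by
  have hU0 : 0 ≤ U := (norm_nonneg _).trans (hU 0 le_rfl)
  have hV0 : 0 ≤ V := by simpa using hV 1 one_pos 0
  obtain ⟨C, h₀, hC, hh₀, hS⟩ := hE.exists_bounded_scheme b hκ hτ hy₀ hK hU0 hV0
  refine ⟨C + 1, h₀, by positivity, hh₀, fun h hh hhle => ?_⟩
  obtain ⟨Y, M, ζ, Z, hS, hb⟩ := hS h (fun n => u (n * h)) hh hhle
    (fun n => hU _ (by positivity)) (hV h hh)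
  have hpos : ∀ t, 0 < t → ∃ n, ⌈t / h⌉₊ = n + 1 := fun t ht =>
    Nat.exists_eq_succ_of_ne_zero (Nat.ceil_pos.2 (div_pos ht hh)).ne'
  have hcoord : ∀ (v : H) j, |⟪v, b j⟫| ≤ ‖v‖ := fun v j => by
    simpa [b.orthonormal.1 j] using abs_real_inner_le_norm v (b j)
  have hsum : ∀ n j, |⟪Y n, b j⟫ - ⟪y₀, b j⟫ +
      κ j * (h * ∑ i ∈ Finset.range n, ⟪ζ (i + 1), b j⟫)| ≤
      h * ∑ i ∈ Finset.range n, (1 / 2) ^ i * ‖M (i + 1)‖ := by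
    intro n j
    induction n with
    | zero => simp [hS.zero]
    | succ n ih =>
      have h1 := hS.incr n j
      rw [inner_sub_left] at h1
      rw [Finset.sum_range_succ, Finset.sum_range_succ, mul_add h, mul_add h]
      have h2 : ⟪Y (n + 1), b j⟫ - ⟪y₀, b j⟫ + κ j *
          (h * ∑ i ∈ Finset.range n, ⟪ζ (i + 1), b j⟫ + h * ⟪ζ (n + 1), b j⟫) =
          (⟪Y n, b j⟫ - ⟪y₀, b j⟫ + κ j * (h * ∑ i ∈ Finset.range n, ⟪ζ (i + 1), b j⟫)) +
            -(h * ((1 / 2) ^ n * ⟪M (n + 1), b j⟫)) := by linarith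
      rw [h2]
      refine (abs_add_le _ _).trans (add_le_add ih ?_)
      rw [abs_neg, abs_mul, abs_of_pos hh, abs_mul, abs_of_pos (by positivity)]
      gcongr
      exact hcoord _ _
  have hζle : ∀ n, h * ‖ζ (n + 1)‖ ≤ (C + 1) * √h := by
    intro n
    have h1 := (hb (n + 1)).2.2.1
    rw [Finset.sum_range_succ, mul_add] at h1
    have h2 : 0 ≤ h * ∑ i ∈ Finset.range n, (‖ζ (i + 1)‖ ^ 2 + ‖Z (i + 1)‖ ^ 2) := by positivity
    have h3 : h * ‖ζ (n + 1)‖ ^ 2 ≤ C := by nlinarith [sq_nonneg ‖Z (n + 1)‖]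
    have h4 : √h * √h = h := Real.mul_self_sqrt hh.le
    have h5 : √h * ‖ζ (n + 1)‖ ≤ C + 1 := by
      refine abs_le_of_sq_le_sq' ?_ (by positivity) |>.2
      rw [mul_pow, sq, h4]
      nlinarith
    calc h * ‖ζ (n + 1)‖ = √h * ‖ζ (n + 1)‖ * √h := by linear_combination (-‖ζ (n + 1)‖) * h4
      _ ≤ _ := by gcongr
  refine ⟨fun t => Y ⌈t / h⌉₊, fun t => M ⌈t / h⌉₊, fun t => ζ ⌈t / h⌉₊, fun t => Z ⌈t / h⌉₊,
    stronglyMeasurable_step Y h, stronglyMeasurable_step M h, stronglyMeasurable_step ζ h,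
    stronglyMeasurable_step Z h, fun t => by linarith [(hb ⌈t / h⌉₊).1], fun t => ?_,
    fun t ht j => ?_, fun t ht j => ?_,
    ⟨fun t => ENNReal.ofReal ((1 / 2) ^ (⌈t / h⌉₊ - 1) * ‖M ⌈t / h⌉₊‖), fun t ht j => ?_, ?_⟩,
    fun t ht v hv => ?_, ?_, fun t ht => ?_⟩
  · rw [← ENNReal.ofReal_toReal (hS.finite _).ne]
    exact ENNReal.ofReal_le_ofReal (by linarith [(hb ⌈t / h⌉₊).2.1])
  · obtain ⟨n, hn⟩ := hpos t ht
    simp only [hn]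
    exact hS.coord n j
  · have h1 := hsum ⌈t / h⌉₊ j
    have h2 := (hb ⌈t / h⌉₊).2.2.2.1
    have hκj := hκ j
    have h3 : |(∫ s in (0 : ℝ)..t, ⟪ζ ⌈s / h⌉₊, b j⟫) -
        h * ∑ i ∈ Finset.range ⌈t / h⌉₊, ⟪ζ (i + 1), b j⟫| ≤ (C + 1) * √h := by
      rcases ht.eq_or_lt with rfl | ht
      · simp
        positivity
      · refine (abs_integral_step_sub_le hh (fun n => ⟪ζ n, b j⟫) ht.le).trans ?_
        obtain ⟨n, hn⟩ := hpos t ht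
        rw [hn]
        refine le_trans ?_ (hζle n)
        gcongr
        exact hcoord _ _
    set I := ∫ s in (0 : ℝ)..t, ⟪ζ ⌈s / h⌉₊, b j⟫
    set S := h * ∑ i ∈ Finset.range ⌈t / h⌉₊, ⟪ζ (i + 1), b j⟫
    have h4 : ⟪Y ⌈t / h⌉₊, b j⟫ - ⟪y₀, b j⟫ + κ j * I =
        (⟪Y ⌈t / h⌉₊, b j⟫ - ⟪y₀, b j⟫ + κ j * S) + κ j * (I - S) := by ring
    rw [h4]
    refine (abs_add_le _ _).trans ?_
    rw [abs_mul, abs_of_nonneg hκj]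
    have h5 : κ j * |I - S| ≤ κ j * ((C + 1) * √h) := by gcongr
    nlinarith [Real.sqrt_nonneg h]
  · obtain ⟨n, hn⟩ := hpos t ht
    simp only [hn, Nat.add_sub_cancel]
    have h1 : ⟪Z (n + 1), b j⟫ + τ * κ j * ⟪ζ (n + 1), b j⟫ =
        -(τ * ((1 / 2) ^ n * ⟪M (n + 1), b j⟫)) := by
      rw [hS.rate, real_inner_smul_left, real_inner_smul_left, hS.incr]
      field_simp
      ring
    rw [h1, enorm_neg, Real.enorm_eq_ofReal_abs]
    refine ENNReal.ofReal_le_ofReal ?_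
    rw [abs_mul, abs_of_nonneg hτ.1, abs_mul, abs_of_pos (by positivity)]
    have h2 := hcoord (M (n + 1)) j
    calc τ * ((1 / 2) ^ n * |⟪M (n + 1), b j⟫|) ≤ 1 * ((1 / 2) ^ n * ‖M (n + 1)‖) := by
          gcongr
          exact hτ.2
      _ = _ := one_mul _
  · refine lintegral_step_le hh (F := fun n => (1 / 2) ^ (n - 1) * ‖M n‖)
      (fun i => by positivity) fun n => ?_
    simp only [Nat.add_sub_cancel]
    refine (hb n).2.2.2.1.trans ?_
    gcongr
    linarith
  · obtain ⟨n, hn⟩ := hpos t ht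
    simp only [hn]
    exact hS.ineq n v hv
  · have h1 := lintegral_step_le hh (F := fun n => ‖ζ n‖ ^ 2 + ‖Z n‖ ^ 2)
      (fun i => by positivity) (C := C + 1) fun n => (hb n).2.2.1.trans (by linarith)
    refine le_trans (le_of_eq ?_) h1
    refine lintegral_congr fun t => ?_
    rw [ENNReal.ofReal_add (by positivity) (by positivity), ENNReal.ofReal_pow (norm_nonneg _),
      ENNReal.ofReal_pow (norm_nonneg _), ofReal_norm, ofReal_norm]
  · obtain ⟨n, hn⟩ := hpos t ht
    simp only [hn]
    refine (hb n).2.2.2.2.trans ?_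
    gcongr
    linarith

end Approximation

section WeakLimits

variable {H : Type*} [NormedAddCommGroup H]

lemma tendsto_eLpNorm_of_bounded {X : Type*} [MeasurableSpace X] {m : Measure X} {E : Set X}
    (hE : MeasurableSet E) (hmE : m E ≠ ⊤) {w : ℕ → X → H} {w' : X → H} {K : ℝ}
    (hw : ∀ n, AEStronglyMeasurable (w n) m) (hw' : AEStronglyMeasurable w' m)
    (hK : ∀ n, ∀ᵐ t ∂m, t ∈ E → ‖w n t‖ ≤ K) (hK' : ∀ᵐ t ∂m, t ∈ E → ‖w' t‖ ≤ K)
    (hlim : ∀ᵐ t ∂m, t ∈ E → Tendsto (fun n => w n t) atTop (𝓝 (w' t))) :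
    Tendsto (fun n => eLpNorm (E.indicator (w n) - E.indicator w') 2 m) atTop (𝓝 0) := by
  have h1 : ∀ n, eLpNorm (E.indicator (w n) - E.indicator w') 2 m =
      (∫⁻ t in E, ‖w n t - w' t‖ₑ ^ 2 ∂m) ^ (1 / 2 : ℝ) := by
    intro n
    rw [← indicator_sub', eLpNorm_indicator_eq_eLpNorm_restrict hE,
      eLpNorm_eq_lintegral_rpow_enorm_toReal (by norm_num) (by norm_num)]
    simp
  have h2 : Tendsto (fun n => ∫⁻ t in E, ‖w n t - w' t‖ₑ ^ 2 ∂m) atTop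
      (𝓝 (∫⁻ t in E, 0 ∂m)) := by
    refine tendsto_lintegral_of_dominated_convergence' (fun _ => ENNReal.ofReal ((K + K) ^ 2))
      (fun n => (((hw n).sub hw').enorm.pow_const 2).restrict) (fun n => ?_) ?_ ?_
    · filter_upwards [ae_restrict_of_ae (hK n), ae_restrict_of_ae hK', ae_restrict_mem hE]
        with t ht ht' htE
      rw [← ofReal_norm, ← ENNReal.ofReal_pow (norm_nonneg _)]
      refine ENNReal.ofReal_le_ofReal (pow_le_pow_left₀ (norm_nonneg _) ?_ 2)
      exact (norm_sub_le _ _).trans (add_le_add (ht htE) (ht' htE))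
    · rw [setLIntegral_const]
      exact ENNReal.mul_ne_top ENNReal.ofReal_ne_top hmE
    · filter_upwards [ae_restrict_of_ae hlim, ae_restrict_mem hE] with t ht htE
      have h3 : Tendsto (fun n => w n t - w' t) atTop (𝓝 0) := by
        simpa using (ht htE).sub_const (w' t)
      simpa [Function.comp_def] using ((ENNReal.continuous_pow 2).tendsto _).comp h3.enorm
  simp only [h1]
  simp only [lintegral_zero] at h2
  have h3 := (ENNReal.continuous_rpow_const (y := (1 / 2 : ℝ))).tendsto 0
  rw [ENNReal.zero_rpow_of_pos (by norm_num)] at h3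
  exact h3.comp h2

variable [InnerProductSpace ℝ H]

/-- Weak convergence in `L²` on bounded subintervals of the half line. -/
structure IsLocalWeakLimit (x : ℕ → ℝ → H) (x' : ℝ → H) : Prop where
  measurable : AEStronglyMeasurable x' (volume.restrict (Ioi (0 : ℝ)))
  memLp : ∀ T, MemLp x' 2 (volume.restrict (Ioc (0 : ℝ) T))
  tendsto : ∀ (E : Set ℝ) (T : ℝ), MeasurableSet E → E ⊆ Ioc 0 T →
    ∀ (w : ℕ → ℝ → H) (w' : ℝ → H) (K : ℝ),
    (∀ n, AEStronglyMeasurable (w n) (volume.restrict (Ioi (0 : ℝ)))) →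
    (∀ n t, 0 < t → ‖w n t‖ ≤ K) →
    (∀ t, 0 < t → Tendsto (fun n => w n t) atTop (𝓝 (w' t))) →
    Tendsto (fun n => ∫ t in E, ⟪x n t, w n t⟫) atTop (𝓝 (∫ t in E, ⟪x' t, w' t⟫))

lemma isLocalWeakLimit_of_Lp [CompleteSpace H]
    {p : ℕ → Lp H 2 (volume.restrict (Ioi (0 : ℝ)))} {p' : Lp H 2 (volume.restrict (Ioi (0 : ℝ)))}
    {C : ℝ} (hp : ∀ n, ‖p n‖ ≤ C) (hlim : ∀ q, Tendsto (fun n => ⟪p n, q⟫) atTop (𝓝 ⟪p', q⟫))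
    {x : ℕ → ℝ → H}
    (hx : ∀ n, p n =ᵐ[volume.restrict (Ioi (0 : ℝ))] fun t => Real.exp (-t) • x n t) :
    IsLocalWeakLimit x fun t => Real.exp t • p' t := by
  have hcexp : ∀ m : Measure ℝ, AEStronglyMeasurable (fun t : ℝ => Real.exp t) m := fun m =>
    Real.continuous_exp.aestronglyMeasurable
  have hmeas : AEStronglyMeasurable (fun t => Real.exp t • p' t) (volume.restrict (Ioi (0 : ℝ))) :=
    (hcexp _).smul (Lp.aestronglyMeasurable p')
  have hsub : ∀ T : ℝ, Ioc 0 T ⊆ Ioi (0 : ℝ) := fun T t ht => ht.1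
  refine ⟨hmeas, fun T => ?_, ?_⟩
  · have h1 : MemLp (fun t => Real.exp T • p' t) 2 (volume.restrict (Ioc (0 : ℝ) T)) :=
      ((Lp.memLp p').mono_measure (Measure.restrict_mono (hsub T) le_rfl)).const_smul _
    refine h1.of_le (hmeas.mono_measure (Measure.restrict_mono (hsub T) le_rfl)) ?_
    filter_upwards [ae_restrict_mem measurableSet_Ioc] with t ht
    rw [norm_smul, norm_smul, Real.norm_eq_abs, Real.norm_eq_abs, Real.abs_exp, Real.abs_exp]
    gcongr
    exact ht.2
  · intro E T hE hET w w' K hw hK hww'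
    have hEI : E ⊆ Ioi 0 := hET.trans (hsub T)
    have hw' : AEStronglyMeasurable w' (volume.restrict (Ioi (0 : ℝ))) :=
      aestronglyMeasurable_of_tendsto_ae atTop hw
        ((ae_restrict_mem measurableSet_Ioi).mono fun t ht => hww' t ht)
    have hK' : ∀ t, 0 < t → ‖w' t‖ ≤ K := fun t ht =>
      le_of_tendsto (hww' t ht).norm (Eventually.of_forall fun n => hK n t ht)
    have hfin : (volume.restrict (Ioi (0 : ℝ))) E ≠ ⊤ := by
      refine ((measure_mono hET).trans_lt ?_).ne
      exact (Measure.restrict_apply_le _ _).trans_lt (by simp)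
    have hexpK : ∀ t ∈ E, ∀ v : H, ‖v‖ ≤ K → ‖Real.exp t • v‖ ≤ Real.exp T * K := by
      intro t ht v hv
      rw [norm_smul, Real.norm_eq_abs, Real.abs_exp]
      have := (hET ht).2
      gcongr
    have hmem : ∀ v : ℝ → H, AEStronglyMeasurable v (volume.restrict (Ioi (0 : ℝ))) →
        (∀ t, 0 < t → ‖v t‖ ≤ K) →
        MemLp (E.indicator fun t => Real.exp t • v t) 2 (volume.restrict (Ioi (0 : ℝ))) := by
      intro v hv hvK
      rw [memLp_indicator_iff_restrict hE]
      have : IsFiniteMeasure ((volume.restrict (Ioi (0 : ℝ))).restrict E) :=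
        ⟨by rwa [Measure.restrict_apply_univ, lt_top_iff_ne_top]⟩
      refine MemLp.of_bound ((hcexp _).smul hv).restrict (Real.exp T * K) ?_
      filter_upwards [ae_restrict_mem hE] with t ht
      exact hexpK t ht _ (hvK t (hEI ht))
    have hmw := fun n => hmem (w n) (hw n) (hK n)
    have hmw' := hmem w' hw' hK'
    have hq : Tendsto (fun n => (hmw n).toLp _) atTop (𝓝 (hmw'.toLp _)) := by
      rw [Lp.tendsto_Lp_iff_tendsto_eLpNorm'']
      refine tendsto_eLpNorm_of_bounded hE hfin (K := Real.exp T * K)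
        (fun n => (hcexp _).smul (hw n)) ((hcexp _).smul hw') (fun n => ?_) ?_ ?_
      · exact Eventually.of_forall fun t ht => hexpK t ht _ (hK n t (hEI ht))
      · exact Eventually.of_forall fun t ht => hexpK t ht _ (hK' t (hEI ht))
      · exact Eventually.of_forall fun t ht => (hww' t (hEI ht)).const_smul _
    have key := tendsto_inner_weak_strong hp hlim hq
    have hint : ∀ (z v : ℝ → H), ∫ t in E, ⟪z t, v t⟫ =
        ∫ t in Ioi (0 : ℝ), ⟪Real.exp (-t) • z t, E.indicator (fun t => Real.exp t • v t) t⟫ := by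
      intro z v
      have h1 : ∀ t, ⟪Real.exp (-t) • z t, E.indicator (fun t => Real.exp t • v t) t⟫ =
          E.indicator (fun t => ⟪z t, v t⟫) t := by
        intro t
        by_cases ht : t ∈ E
        · rw [indicator_of_mem ht, indicator_of_mem ht, real_inner_smul_left,
            real_inner_smul_right, ← mul_assoc, ← Real.exp_add]
          simp
        · simp [ht]
      simp only [h1]
      rw [setIntegral_indicator hE, inter_eq_self_of_subset_right hEI]
    have e1 : ∀ n, ⟪p n, (hmw n).toLp _⟫ = ∫ t in E, ⟪x n t, w n t⟫ := by
      intro n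
      rw [L2.inner_def, hint]
      refine integral_congr_ae ?_
      filter_upwards [hx n, (hmw n).coeFn_toLp] with t h1 h2
      rw [h1, h2]
    have e2 : ⟪p', hmw'.toLp _⟫ = ∫ t in E, ⟪Real.exp t • p' t, w' t⟫ := by
      rw [L2.inner_def, hint]
      refine integral_congr_ae ?_
      filter_upwards [hmw'.coeFn_toLp] with t h2
      rw [h2, smul_smul, ← Real.exp_add]
      simp
    simpa only [e1, e2] using key

lemma exists_weighted_Lp {x : ℕ → ℝ → H}
    (hx : ∀ n, AEStronglyMeasurable (x n) (volume.restrict (Ioi (0 : ℝ)))) {C : ℝ}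
    (hC0 : 0 ≤ C) (hC : ∀ n, ∫⁻ t in Ioi (0 : ℝ), ‖Real.exp (-t) • x n t‖ₑ ^ 2 ≤ ENNReal.ofReal C) :
    ∃ p : ℕ → Lp H 2 (volume.restrict (Ioi (0 : ℝ))), (∀ n, ‖p n‖ ≤ √C) ∧
      ∀ n, p n =ᵐ[volume.restrict (Ioi (0 : ℝ))] fun t => Real.exp (-t) • x n t := by
  have hm : ∀ n, AEStronglyMeasurable (fun t => Real.exp (-t) • x n t)
      (volume.restrict (Ioi (0 : ℝ))) := fun n =>
    (Real.continuous_exp.comp continuous_neg).aestronglyMeasurable.smul (hx n)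
  have h1 : ∀ n, eLpNorm (fun t => Real.exp (-t) • x n t) 2 (volume.restrict (Ioi (0 : ℝ))) ≤
      ENNReal.ofReal √C := by
    intro n
    rw [eLpNorm_eq_lintegral_rpow_enorm_toReal (by norm_num) (by norm_num), Real.sqrt_eq_rpow]
    simp only [ENNReal.toReal_ofNat, ENNReal.rpow_ofNat]
    rw [← ENNReal.ofReal_rpow_of_nonneg hC0 (by norm_num)]
    exact ENNReal.rpow_le_rpow (hC n) (by norm_num)
  have h2 : ∀ n, MemLp (fun t => Real.exp (-t) • x n t) 2 (volume.restrict (Ioi (0 : ℝ))) :=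
    fun n => ⟨hm n, (h1 n).trans_lt ENNReal.ofReal_lt_top⟩
  refine ⟨fun n => (h2 n).toLp _, fun n => ?_, fun n => (h2 n).coeFn_toLp⟩
  rw [Lp.norm_toLp]
  exact ENNReal.toReal_le_of_le_ofReal (Real.sqrt_nonneg _) (h1 n)

end WeakLimits

section LimitPassage

lemma Ioi_eq_iUnion_Ioc : Ioi (0 : ℝ) = ⋃ n : ℕ, Ioc (0 : ℝ) n := by
  ext t
  simp only [mem_Ioi, mem_iUnion, mem_Ioc]
  exact ⟨fun h => ⟨⌈t⌉₊, h, Nat.le_ceil t⟩, fun ⟨_, h, _⟩ => h⟩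

lemma ae_le_of_forall_setIntegral_le_Ioc {f g : ℝ → ℝ}
    (hf : ∀ T : ℝ, IntegrableOn f (Ioc 0 T)) (hg : ∀ T : ℝ, IntegrableOn g (Ioc 0 T))
    (h : ∀ (E : Set ℝ) (T : ℝ), MeasurableSet E → E ⊆ Ioc 0 T →
      ∫ t in E, f t ≤ ∫ t in E, g t) :
    ∀ᵐ t ∂(volume.restrict (Ioi (0 : ℝ))), f t ≤ g t := by
  rw [Ioi_eq_iUnion_Ioc, ae_restrict_iUnion_iff]
  intro n
  refine ae_le_of_forall_setIntegral_le (hf n) (hg n) fun s hs _ => ?_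
  rw [Measure.restrict_restrict hs]
  exact h _ n (hs.inter measurableSet_Ioc) inter_subset_right

lemma ae_eq_of_forall_setIntegral_eq_Ioc {f g : ℝ → ℝ}
    (hf : ∀ T : ℝ, IntegrableOn f (Ioc 0 T)) (hg : ∀ T : ℝ, IntegrableOn g (Ioc 0 T))
    (h : ∀ (E : Set ℝ) (T : ℝ), MeasurableSet E → E ⊆ Ioc 0 T →
      ∫ t in E, f t = ∫ t in E, g t) :
    ∀ᵐ t ∂(volume.restrict (Ioi (0 : ℝ))), f t = g t := by
  filter_upwards [ae_le_of_forall_setIntegral_le_Ioc hf hg fun E T h1 h2 => (h E T h1 h2).le,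
    ae_le_of_forall_setIntegral_le_Ioc hg hf fun E T h1 h2 => (h E T h1 h2).ge] with t h1 h2
  exact le_antisymm h1 h2

variable {H : Type*} [NormedAddCommGroup H] [InnerProductSpace ℝ H]

lemma integrableOn_inner_of_bounded {x w : ℝ → H} {T K : ℝ}
    (hx : MemLp x 2 (volume.restrict (Ioc (0 : ℝ) T)))
    (hw : AEStronglyMeasurable w (volume.restrict (Ioi (0 : ℝ)))) (hK : ∀ t, 0 < t → ‖w t‖ ≤ K) :
    IntegrableOn (fun t => ⟪x t, w t⟫) (Ioc 0 T) := by
  have h1 : Integrable (fun t => ‖x t‖ * K) (volume.restrict (Ioc (0 : ℝ) T)) :=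
    (hx.integrable (by norm_num)).norm.mul_const K
  refine h1.mono' (hx.1.inner (hw.mono_measure
    (Measure.restrict_mono (fun t ht => ht.1) le_rfl))) ?_
  filter_upwards [ae_restrict_mem measurableSet_Ioc] with t ht
  refine (norm_inner_le_norm _ _).trans ?_
  exact mul_le_mul_of_nonneg_left (hK t ht.1) (norm_nonneg _)

lemma integrableOn_coord {x : ℝ → H} {T : ℝ}
    (hx : MemLp x 2 (volume.restrict (Ioc (0 : ℝ) T))) (v : H) :
    IntegrableOn (fun t => ⟪x t, v⟫) (Ioc 0 T) :=
  (hx.inner_const v).integrable (by norm_num)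

lemma IsLocalWeakLimit.tendsto_coord {x : ℕ → ℝ → H} {x' : ℝ → H} (hx : IsLocalWeakLimit x x')
    {E : Set ℝ} {T : ℝ} (hE : MeasurableSet E) (hET : E ⊆ Ioc 0 T) (v : H) :
    Tendsto (fun n => ∫ t in E, ⟪x n t, v⟫) atTop (𝓝 (∫ t in E, ⟪x' t, v⟫)) :=
  hx.tendsto E T hE hET (fun _ _ => v) (fun _ => v) ‖v‖ (fun _ => aestronglyMeasurable_const)
    (fun _ _ _ => le_rfl) fun _ _ => tendsto_const_nhds

variable {Ψ : H → ℝ≥0∞} {P : H → ℝ} {G : H → H} {L α C₀ : ℝ} {b : HilbertBasis ℕ ℝ H} {κ : ℕ → ℝ}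
  {τ h C : ℝ} {u : ℝ → H} {y₀ : H}

namespace IsApprox

variable {Y M ζ Z : ℝ → H}

lemma memLp_ζ_Z (hA : IsApprox Ψ G b κ τ h C u y₀ Y M ζ Z) :
    MemLp ζ 2 (volume.restrict (Ioi (0 : ℝ))) ∧ MemLp Z 2 (volume.restrict (Ioi (0 : ℝ))) := by
  have hfin := hA.lintegral_le.trans_lt ENNReal.ofReal_lt_top
  constructor
  · refine ⟨hA.measurable_ζ.aestronglyMeasurable, ?_⟩
    rw [eLpNorm_lt_top_iff_lintegral_rpow_enorm_lt_top (by norm_num) (by norm_num)]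
    simp only [ENNReal.toReal_ofNat, ENNReal.rpow_ofNat]
    exact (lintegral_mono fun t => le_self_add).trans_lt hfin
  · refine ⟨hA.measurable_Z.aestronglyMeasurable, ?_⟩
    rw [eLpNorm_lt_top_iff_lintegral_rpow_enorm_lt_top (by norm_num) (by norm_num)]
    simp only [ENNReal.toReal_ofNat, ENNReal.rpow_ofNat]
    exact (lintegral_mono fun t => le_add_self).trans_lt hfin

lemma memLp_ζ (hA : IsApprox Ψ G b κ τ h C u y₀ Y M ζ Z) (T : ℝ) :
    MemLp ζ 2 (volume.restrict (Ioc (0 : ℝ) T)) :=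
  hA.memLp_ζ_Z.1.mono_measure (Measure.restrict_mono (fun _ ht => ht.1) le_rfl)

lemma memLp_Z (hA : IsApprox Ψ G b κ τ h C u y₀ Y M ζ Z) (T : ℝ) :
    MemLp Z 2 (volume.restrict (Ioc (0 : ℝ) T)) :=
  hA.memLp_ζ_Z.2.mono_measure (Measure.restrict_mono (fun _ ht => ht.1) le_rfl)

lemma memLp_M (hA : IsApprox Ψ G b κ τ h C u y₀ Y M ζ Z) (T : ℝ) :
    MemLp M 2 (volume.restrict (Ioc (0 : ℝ) T)) := by
  have h1 : MemLp (fun t => C * (1 + ‖ζ t‖ + ‖Z t‖)) 2 (volume.restrict (Ioc (0 : ℝ) T)) := by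
    have h2 : MemLp (fun _ : ℝ => (1 : ℝ)) 2 (volume.restrict (Ioc (0 : ℝ) T)) := memLp_const 1
    have h3 : MemLp (fun t => 1 + ‖ζ t‖) 2 (volume.restrict (Ioc (0 : ℝ) T)) :=
      h2.add (hA.memLp_ζ T).norm
    have h4 : MemLp (fun t => 1 + ‖ζ t‖ + ‖Z t‖) 2 (volume.restrict (Ioc (0 : ℝ) T)) :=
      h3.add (hA.memLp_Z T).norm
    exact h4.const_mul C
  refine h1.of_le hA.measurable_M.aestronglyMeasurable ?_
  filter_upwards [ae_restrict_mem measurableSet_Ioc] with t ht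
  exact (hA.norm_M_le t ht.1).trans (le_abs_self _)

end IsApprox

variable {hs : ℕ → ℝ} {Y M ζ Z : ℕ → ℝ → H} {μ ζ' z : ℝ → H}

lemma exists_pointwise_limit (hE : IsEnergy Ψ P G L α C₀)
    (hhs : Tendsto hs atTop (𝓝 0))
    (hA : ∀ n, IsApprox Ψ G b κ τ (hs n) C u y₀ (Y n) (M n) (ζ n) (Z n))
    (hζ : IsLocalWeakLimit ζ ζ') :
    ∃ y : ℝ → H, (∀ t, 0 ≤ t → Tendsto (fun n => Y n t) atTop (𝓝 (y t))) ∧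
      (∀ t, 0 ≤ t → ‖y t‖ ≤ C ∧ Ψ (y t) ≤ ENNReal.ofReal C) ∧
      ∀ t, 0 ≤ t → ∀ j, ⟪y t, b j⟫ = ⟪y₀, b j⟫ - κ j * ∫ s in (0 : ℝ)..t, ⟪ζ' s, b j⟫ := by
  have hsq : Tendsto (fun n => √(hs n)) atTop (𝓝 0) := by
    simpa [Function.comp_def] using (Real.continuous_sqrt.tendsto 0).comp hhs
  have key : ∀ t, 0 ≤ t → ∃ a, (‖a‖ ≤ C ∧ Ψ a ≤ ENNReal.ofReal C) ∧
      Tendsto (fun n => Y n t) atTop (𝓝 a) ∧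
      ∀ j, ⟪a, b j⟫ = ⟪y₀, b j⟫ - κ j * ∫ s in (0 : ℝ)..t, ⟪ζ' s, b j⟫ := by
    intro t ht
    have hc : ∀ j, Tendsto (fun n => ⟪Y n t, b j⟫) atTop
        (𝓝 (⟪y₀, b j⟫ - κ j * ∫ s in (0 : ℝ)..t, ⟪ζ' s, b j⟫)) := fun j => by
      have h1 := hζ.tendsto_coord measurableSet_Ioc (subset_refl (Ioc 0 t)) (b j)
      simp only [← intervalIntegral.integral_of_le ht] at h1
      have h2 : Tendsto (fun n => ⟪Y n t, b j⟫ - ⟪y₀, b j⟫ +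
          κ j * ∫ s in (0 : ℝ)..t, ⟪ζ n s, b j⟫) atTop (𝓝 0) := by
        refine squeeze_zero_norm (fun n => (hA n).evol t ht j) ?_
        simpa using hsq.const_mul ((1 + κ j) * C)
      have h3 := (h2.sub (h1.const_mul (κ j))).add_const ⟪y₀, b j⟫
      rw [zero_sub, neg_add_eq_sub] at h3
      exact h3.congr fun n => by ring
    obtain ⟨a, ha, h1, h2⟩ := exists_tendsto_of_coord_tendsto b (hE.compact C C)
      (x := fun n => Y n t) (fun n => ⟨(hA n).energy_le t, (hA n).norm_le t⟩) hc
    exact ⟨a, ⟨ha.2, ha.1⟩, h1, h2⟩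
  choose! y h1 h2 h3 using key
  exact ⟨y, h2, h1, h3⟩

lemma ae_coord_eq (hA : ∀ n, IsApprox Ψ G b κ τ (hs n) C u y₀ (Y n) (M n) (ζ n) (Z n))
    (hM : IsLocalWeakLimit M μ) (hζ : IsLocalWeakLimit ζ ζ') :
    ∀ᵐ t ∂(volume.restrict (Ioi (0 : ℝ))), ∀ j, ⟪ζ' t, b j⟫ = κ j * ⟪μ t, b j⟫ := by
  rw [ae_all_iff]
  intro j
  refine ae_eq_of_forall_setIntegral_eq_Ioc (fun T => integrableOn_coord (hζ.memLp T) _)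
    (fun T => (integrableOn_coord (hM.memLp T) _).const_mul _) fun E T hE hET => ?_
  rw [integral_const_mul]
  refine tendsto_nhds_unique (hζ.tendsto_coord hE hET (b j))
    (((hM.tendsto_coord hE hET (b j)).const_mul (κ j)).congr fun n => ?_)
  rw [← integral_const_mul]
  exact setIntegral_congr_fun hE fun t ht => ((hA n).coord t (hET ht).1 j).symm

lemma ae_rate_eq (hhs : Tendsto hs atTop (𝓝 0))
    (hA : ∀ n, IsApprox Ψ G b κ τ (hs n) C u y₀ (Y n) (M n) (ζ n) (Z n))
    (hζ : IsLocalWeakLimit ζ ζ') (hZ : IsLocalWeakLimit Z z) :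
    ∀ᵐ t ∂(volume.restrict (Ioi (0 : ℝ))), ∀ j, ⟪z t, b j⟫ = -(τ * κ j) * ⟪ζ' t, b j⟫ := by
  rw [ae_all_iff]
  intro j
  have hsq : Tendsto (fun n => √(hs n)) atTop (𝓝 0) := by
    simpa [Function.comp_def] using (Real.continuous_sqrt.tendsto 0).comp hhs
  refine ae_eq_of_forall_setIntegral_eq_Ioc (fun T => integrableOn_coord (hZ.memLp T) _)
    (fun T => (integrableOn_coord (hζ.memLp T) _).const_mul _) fun E T hE hET => ?_
  rw [integral_const_mul]
  have h1 : Tendsto (fun n => (∫ t in E, ⟪Z n t, b j⟫) + τ * κ j * ∫ t in E, ⟪ζ n t, b j⟫)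
      atTop (𝓝 0) := by
    have hmax : Tendsto (fun n => max (C * √(hs n)) 0) atTop (𝓝 0) := by
      have := (hsq.const_mul C).max (tendsto_const_nhds (x := (0 : ℝ)))
      simpa using this
    refine squeeze_zero_norm (fun n => ?_) hmax
    rw [← integral_const_mul, ← integral_add
      ((integrableOn_coord ((hA n).memLp_Z T) _).mono_set hET)
      (((integrableOn_coord ((hA n).memLp_ζ T) _).mono_set hET).const_mul _)]
    obtain ⟨e, he, hle⟩ := (hA n).rate
    have h2 : ‖∫ t in E, (⟪Z n t, b j⟫ + τ * κ j * ⟪ζ n t, b j⟫)‖ₑ ≤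
        ENNReal.ofReal (C * √(hs n)) := by
      refine (enorm_integral_le_lintegral_enorm _).trans ?_
      refine (setLIntegral_mono_ae' hE (g := e)
        (Eventually.of_forall fun t ht => he t (hET ht).1 j)).trans ?_
      exact (lintegral_mono_set (fun t ht => (hET ht).1)).trans hle
    rw [← ofReal_norm, ENNReal.ofReal_le_ofReal_iff'] at h2
    exact h2.elim (fun h => h.trans (le_max_left _ _)) fun h => h.trans (le_max_right _ _)
  have h3 := tendsto_nhds_unique h1 ((hZ.tendsto_coord hE hET (b j)).add
    ((hζ.tendsto_coord hE hET (b j)).const_mul (τ * κ j)))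
  linarith

end LimitPassage

section LimitInequality

lemma memLp_of_bounded {V : Type*} [NormedAddCommGroup V] {w : ℝ → V} {K : ℝ}
    (hw : AEStronglyMeasurable w (volume.restrict (Ioi (0 : ℝ)))) (hK : ∀ t, 0 < t → ‖w t‖ ≤ K)
    (T : ℝ) : MemLp w 2 (volume.restrict (Ioc (0 : ℝ) T)) := by
  refine MemLp.of_bound (hw.mono_measure (Measure.restrict_mono (fun t ht => ht.1) le_rfl)) K ?_
  filter_upwards [ae_restrict_mem measurableSet_Ioc] with t ht using hK t ht.1

lemma exists_dense_seq_energy {V : Type*} [NormedAddCommGroup V]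
    [SecondCountableTopology V] (Ψ : V → ℝ≥0∞) (hΨ : ∃ v, Ψ v < ⊤) :
    ∃ v : ℕ → V, (∀ n, Ψ (v n) < ⊤) ∧ ∀ F : V × ℝ → ℝ, Continuous F →
      (∀ n, 0 ≤ F (v n, (Ψ (v n)).toReal)) → ∀ w, Ψ w < ⊤ → 0 ≤ F (w, (Ψ w).toReal) := by
  let S := {w : V // Ψ w < ⊤}
  let f : S → V × ℝ := fun w => (w.1, (Ψ w.1).toReal)
  have : Nonempty (range f) := by
    obtain ⟨v, hv⟩ := hΨ
    exact ⟨⟨f ⟨v, hv⟩, mem_range_self _⟩⟩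
  choose s hsf using fun n => (TopologicalSpace.denseSeq (range f) n).2
  refine ⟨fun n => (s n).1, fun n => (s n).2, fun F hF h w hw => ?_⟩
  have hd := TopologicalSpace.denseRange_denseSeq (range f)
  refine hd.induction_on (p := fun q : range f => 0 ≤ F q.1) ⟨f ⟨w, hw⟩, mem_range_self _⟩
    (isClosed_le continuous_const (hF.comp continuous_subtype_val)) fun n => ?_
  rw [← hsf n]
  exact h n

variable {H : Type*} [NormedAddCommGroup H] [InnerProductSpace ℝ H]

lemma isLocalWeakLimit_of_tendsto {x : ℕ → ℝ → H} {x' : ℝ → H} {K : ℝ}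
    (hx : ∀ n, AEStronglyMeasurable (x n) (volume.restrict (Ioi (0 : ℝ))))
    (hK : ∀ n t, 0 < t → ‖x n t‖ ≤ K)
    (hlim : ∀ t, 0 < t → Tendsto (fun n => x n t) atTop (𝓝 (x' t))) : IsLocalWeakLimit x x' := by
  have hK' : ∀ t, 0 < t → ‖x' t‖ ≤ K := fun t ht =>
    le_of_tendsto (hlim t ht).norm (Eventually.of_forall fun n => hK n t ht)
  have hmeas : AEStronglyMeasurable x' (volume.restrict (Ioi (0 : ℝ))) := by
    refine aestronglyMeasurable_of_tendsto_ae atTop hx ?_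
    filter_upwards [ae_restrict_mem measurableSet_Ioi] with t ht using hlim t ht
  refine ⟨hmeas, memLp_of_bounded hmeas hK', fun E T hE hET w w' R hw hR hw' => ?_⟩
  have hsub : E ⊆ Ioi 0 := fun t ht => (hET ht).1
  have : IsFiniteMeasure (volume.restrict E) :=
    ⟨by simpa using (measure_mono hET).trans_lt measure_Ioc_lt_top⟩
  refine tendsto_integral_of_dominated_convergence (fun _ => K * R) (fun n =>
    ((hx n).inner (hw n)).mono_measure (Measure.restrict_mono hsub le_rfl))
    (integrable_const _) (fun n => ?_) ?_
  · filter_upwards [ae_restrict_mem hE] with t ht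
    exact (norm_inner_le_norm _ _).trans (mul_le_mul (hK n t (hsub ht)) (hR n t (hsub ht))
      (norm_nonneg _) ((norm_nonneg _).trans (hK n t (hsub ht))))
  · filter_upwards [ae_restrict_mem hE] with t ht
    exact (hlim t (hsub ht)).inner (hw' t (hsub ht))

lemma IsLocalWeakLimit.add_smul {x p : ℕ → ℝ → H} {x' p' : ℝ → H} (c : ℝ)
    (hx : IsLocalWeakLimit x x') (hp : IsLocalWeakLimit p p')
    (hxm : ∀ n T, MemLp (x n) 2 (volume.restrict (Ioc (0 : ℝ) T)))
    (hpm : ∀ n T, MemLp (p n) 2 (volume.restrict (Ioc (0 : ℝ) T))) :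
    IsLocalWeakLimit (fun n t => x n t + c • p n t) fun t => x' t + c • p' t := by
  refine ⟨hx.measurable.add (hp.measurable.const_smul c),
    fun T => (hx.memLp T).add ((hp.memLp T).const_smul c), fun E T hE hET w w' R hw hR hw' => ?_⟩
  have hR' : ∀ t, 0 < t → ‖w' t‖ ≤ R := fun t ht =>
    le_of_tendsto (hw' t ht).norm (Eventually.of_forall fun n => hR n t ht)
  have hmeas : AEStronglyMeasurable w' (volume.restrict (Ioi (0 : ℝ))) := by
    refine aestronglyMeasurable_of_tendsto_ae atTop hw ?_
    filter_upwards [ae_restrict_mem measurableSet_Ioi] with t ht using hw' t ht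
  have key : ∀ {f g v : ℝ → H}, MemLp f 2 (volume.restrict (Ioc (0 : ℝ) T)) →
      MemLp g 2 (volume.restrict (Ioc (0 : ℝ) T)) →
      AEStronglyMeasurable v (volume.restrict (Ioi (0 : ℝ))) → (∀ t, 0 < t → ‖v t‖ ≤ R) →
      ∫ t in E, ⟪f t + c • g t, v t⟫ = (∫ t in E, ⟪f t, v t⟫) + c * ∫ t in E, ⟪g t, v t⟫ := by
    intro f g v hf hg hv hvR
    rw [← integral_const_mul, ← integral_add
      ((integrableOn_inner_of_bounded hf hv hvR).mono_set hET)
      (((integrableOn_inner_of_bounded hg hv hvR).mono_set hET).const_mul _)]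
    simp only [inner_add_left, real_inner_smul_left]
  rw [key (hx.memLp T) (hp.memLp T) hmeas hR']
  simp_rw [fun n => key (hxm n T) (hpm n T) (hw n) (hR n)]
  exact (hx.tendsto E T hE hET w w' R hw hR hw').add
    ((hp.tendsto E T hE hET w w' R hw hR hw').const_mul c)

variable {Ψ : H → ℝ≥0∞} {P : H → ℝ} {G : H → H} {L α C₀ : ℝ} {b : HilbertBasis ℕ ℝ H} {κ : ℕ → ℝ}
  {τ C U : ℝ} {u : ℝ → H} {y₀ : H} {hs : ℕ → ℝ} {Y M ζ Z : ℕ → ℝ → H} {y μ z : ℝ → H}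

lemma tendsto_ceil_mul (hpos : ∀ n, 0 < hs n) (hhs : Tendsto hs atTop (𝓝 0)) {t : ℝ} (ht : 0 < t) :
    Tendsto (fun n => (⌈t / hs n⌉₊ : ℝ) * hs n) atTop (𝓝 t) := by
  have h1 : Tendsto (fun n => t + hs n) atTop (𝓝 t) := by simpa using hhs.const_add t
  refine tendsto_of_tendsto_of_tendsto_of_le_of_le tendsto_const_nhds h1 (fun n => ?_) fun n => ?_
  · exact (div_le_iff₀ (hpos n)).1 (Nat.le_ceil _)
  · have := (Nat.ceil_lt_add_one (div_pos ht (hpos n)).le).le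
    calc (⌈t / hs n⌉₊ : ℝ) * hs n ≤ (t / hs n + 1) * hs n :=
          mul_le_mul_of_nonneg_right this (hpos n).le
      _ = t + hs n := by rw [add_mul, div_mul_cancel₀ _ (hpos n).ne', one_mul]

lemma ae_variational_ineq [SecondCountableTopology H] (hE : IsEnergy Ψ P G L α C₀)
    (hy₀ : Ψ y₀ < ⊤) (hu : ContinuousOn u (Ici 0)) (hU : ∀ t, 0 ≤ t → ‖u t‖ ≤ U)
    (hpos : ∀ n, 0 < hs n) (hhs : Tendsto hs atTop (𝓝 0))
    (hA : ∀ n, IsApprox Ψ G b κ τ (hs n) C u y₀ (Y n) (M n) (ζ n) (Z n))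
    (hM : IsLocalWeakLimit M μ) (hZ : IsLocalWeakLimit Z z)
    (hy : ∀ t, 0 ≤ t → Tendsto (fun n => Y n t) atTop (𝓝 (y t)))
    (hyC : ∀ t, 0 ≤ t → ‖y t‖ ≤ C ∧ Ψ (y t) ≤ ENNReal.ofReal C) :
    ∀ᵐ t ∂(volume.restrict (Ioi (0 : ℝ))), ∀ v, Ψ v < ⊤ →
      (Ψ (y t)).toReal + ⟪z t + G (y t) - u t - μ t, y t - v⟫ ≤ (Ψ v).toReal := by
  borelize H
  have hYm : ∀ n, AEStronglyMeasurable (Y n) (volume.restrict (Ioi (0 : ℝ))) := fun n =>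
    (hA n).measurable_Y.aestronglyMeasurable
  have hym : AEStronglyMeasurable y (volume.restrict (Ioi (0 : ℝ))) := by
    refine aestronglyMeasurable_of_tendsto_ae atTop hYm ?_
    filter_upwards [ae_restrict_mem measurableSet_Ioi] with t ht using hy t (le_of_lt ht)
  have hΨm : Measurable Ψ := hE.lsc.measurable
  let us : ℕ → ℝ → H := fun n t => u (⌈t / hs n⌉₊ * hs n)
  have hus : ∀ n, StronglyMeasurable (us n) := fun n =>
    stronglyMeasurable_step (fun k : ℕ => u (k * hs n)) (hs n)
  have hW : IsLocalWeakLimit (fun n t => G (Y n t) + (-1 : ℝ) • us n t)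
      fun t => G (y t) + (-1 : ℝ) • u t := by
    refine isLocalWeakLimit_of_tendsto (K := ‖G 0‖ + |L| * C + U) (fun n => ?_) (fun n t ht => ?_)
      fun t ht => ?_
    · exact (hE.continuous_gradient.comp_aestronglyMeasurable (hYm n)).add
        ((hus n).aestronglyMeasurable.const_smul _)
    · refine (norm_add_le _ _).trans (add_le_add (hE.norm_gradient_le ((hA n).norm_le t)) ?_)
      rw [norm_smul, norm_neg, norm_one, one_mul]
      exact hU _ (mul_nonneg (Nat.cast_nonneg _) (hpos n).le)
    · refine ((hE.continuous_gradient.tendsto _).comp (hy t ht.le)).add (Tendsto.const_smul ?_ _)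
      refine Tendsto.comp (hu t ht.le) (tendsto_nhdsWithin_iff.2 ⟨tendsto_ceil_mul hpos hhs ht,
        Eventually.of_forall fun n => mul_nonneg (Nat.cast_nonneg _) (hpos n).le⟩)
  have hWm : ∀ n T, MemLp (fun t => G (Y n t) + (-1 : ℝ) • us n t) 2
      (volume.restrict (Ioc (0 : ℝ) T)) := fun n T => by
    refine memLp_of_bounded (K := ‖G 0‖ + |L| * C + U) ?_ (fun t ht => ?_) T
    · exact (hE.continuous_gradient.comp_aestronglyMeasurable (hYm n)).add
        ((hus n).aestronglyMeasurable.const_smul _)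
    · refine (norm_add_le _ _).trans (add_le_add (hE.norm_gradient_le ((hA n).norm_le t)) ?_)
      rw [norm_smul, norm_neg, norm_one, one_mul]
      exact hU _ (mul_nonneg (Nat.cast_nonneg _) (hpos n).le)
  have hZM := hZ.add_smul (-1) hM (fun n T => (hA n).memLp_Z T) fun n T => (hA n).memLp_M T
  have hX := hZM.add_smul 1 hW
    (fun n T => ((hA n).memLp_Z T).add (((hA n).memLp_M T).const_smul _)) hWm
  have hXm : ∀ n T, MemLp (fun t => Z n t + (-1 : ℝ) • M n t +
      (1 : ℝ) • (G (Y n t) + (-1 : ℝ) • us n t)) 2 (volume.restrict (Ioc (0 : ℝ) T)) := fun n T =>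
    (((hA n).memLp_Z T).add (((hA n).memLp_M T).const_smul _)).add ((hWm n T).const_smul _)
  have single : ∀ v, Ψ v < ⊤ → ∀ᵐ t ∂(volume.restrict (Ioi (0 : ℝ))),
      (Ψ (y t)).toReal ≤ (Ψ v).toReal - ⟪z t + (-1 : ℝ) • μ t +
        (1 : ℝ) • (G (y t) + (-1 : ℝ) • u t), y t - v⟫ := by
    intro v hv
    have hint : ∀ {w : ℝ → H}, AEStronglyMeasurable w (volume.restrict (Ioi (0 : ℝ))) →
        (∀ t, 0 < t → Ψ (w t) ≤ ENNReal.ofReal C) → ∀ T,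
        IntegrableOn (fun t => (Ψ (w t)).toReal) (Ioc 0 T) := fun {w} hw hC T => by
      have hm : AEStronglyMeasurable (fun t => (Ψ (w t)).toReal) (volume.restrict (Ioc 0 T)) :=
        ((hΨm.comp_aemeasurable (hw.mono_measure (Measure.restrict_mono
          (fun t ht => ht.1) le_rfl)).aemeasurable).ennreal_toReal).aestronglyMeasurable
      refine Integrable.mono' (integrable_const (max C 0)) hm ?_
      filter_upwards [ae_restrict_mem measurableSet_Ioc] with t ht
      rw [Real.norm_of_nonneg ENNReal.toReal_nonneg, ← ENNReal.toReal_ofReal']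
      exact ENNReal.toReal_mono ENNReal.ofReal_ne_top (hC t ht.1)
    have hinner : ∀ {f w : ℝ → H} {T : ℝ}, MemLp f 2 (volume.restrict (Ioc (0 : ℝ) T)) →
        AEStronglyMeasurable w (volume.restrict (Ioi (0 : ℝ))) → (∀ t, 0 < t → ‖w t‖ ≤ C) →
        IntegrableOn (fun t => ⟪f t, w t - v⟫) (Ioc 0 T) := fun hf hw hC =>
      integrableOn_inner_of_bounded (K := C + ‖v‖) hf
        (hw.sub aestronglyMeasurable_const) fun t ht =>
          (norm_sub_le _ _).trans (add_le_add_left (hC t ht) _)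
    have hint' : ∀ {f w : ℝ → H} {T : ℝ}, MemLp f 2 (volume.restrict (Ioc (0 : ℝ) T)) →
        AEStronglyMeasurable w (volume.restrict (Ioi (0 : ℝ))) → (∀ t, 0 < t → ‖w t‖ ≤ C) →
        IntegrableOn (fun t => (Ψ v).toReal - ⟪f t, w t - v⟫) (Ioc 0 T) := fun hf hw hC =>
      (integrable_const _).sub (hinner hf hw hC)
    refine ae_le_of_forall_setIntegral_le_Ioc (hint hym fun t ht => (hyC t ht.le).2)
      (fun T => hint' (hX.memLp T) hym fun t ht => (hyC t ht.le).1) fun E T hEm hET => ?_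
    have hsub : E ⊆ Ioi 0 := fun t ht => (hET ht).1
    have hfin : IsFiniteMeasure (volume.restrict E) :=
      ⟨by simpa using (measure_mono hET).trans_lt measure_Ioc_lt_top⟩
    have hlim : Tendsto (fun n => ∫ t in E, ((Ψ v).toReal - ⟪Z n t + (-1 : ℝ) • M n t +
        (1 : ℝ) • (G (Y n t) + (-1 : ℝ) • us n t), Y n t - v⟫)) atTop
        (𝓝 (∫ t in E, ((Ψ v).toReal - ⟪z t + (-1 : ℝ) • μ t +
        (1 : ℝ) • (G (y t) + (-1 : ℝ) • u t), y t - v⟫))) := by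
      have h1 := (hX.tendsto E T hEm hET (fun n t => Y n t - v) (fun t => y t - v) (C + ‖v‖)
        (fun n => (hYm n).sub aestronglyMeasurable_const)
        (fun n t _ => (norm_sub_le _ _).trans (add_le_add_left ((hA n).norm_le t) _))
        fun t ht => (hy t ht.le).sub_const v).const_sub (∫ _ in E, (Ψ v).toReal)
      rw [← integral_sub (integrable_const _) ((hinner (hX.memLp T) hym fun t ht =>
        (hyC t ht.le).1).mono_set hET)] at h1
      refine h1.congr fun n => ?_
      rw [← integral_sub (integrable_const _) ((hinner (hXm n T) (hYm n) fun t _ =>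
        (hA n).norm_le t).mono_set hET)]
    have hle : ∀ n, ∫ t in E, (Ψ (Y n t)).toReal ≤ ∫ t in E, ((Ψ v).toReal -
        ⟪Z n t + (-1 : ℝ) • M n t + (1 : ℝ) • (G (Y n t) + (-1 : ℝ) • us n t), Y n t - v⟫) :=
      fun n => by
        refine setIntegral_mono_on ((hint (hYm n) (fun t _ => (hA n).energy_le t) T).mono_set hET)
          ((hint' (hXm n T) (hYm n) fun t _ => (hA n).norm_le t).mono_set hET) hEm fun t ht => ?_
        have h1 := (hA n).ineq t (hsub ht) v hv
        have h2 : Z n t + (-1 : ℝ) • M n t + (1 : ℝ) • (G (Y n t) + (-1 : ℝ) • us n t) =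
            Z n t + G (Y n t) - u (⌈t / hs n⌉₊ * hs n) - M n t := by
          simp only [us]; module
        rw [h2]; linarith
    have hnn := ge_of_tendsto' hlim fun n =>
      (integral_nonneg fun t => ENNReal.toReal_nonneg).trans (hle n)
    have hfatou : ∫⁻ t in E, Ψ (y t) ≤ ENNReal.ofReal (∫ t in E, ((Ψ v).toReal -
        ⟪z t + (-1 : ℝ) • μ t + (1 : ℝ) • (G (y t) + (-1 : ℝ) • u t), y t - v⟫)) := by
      calc ∫⁻ t in E, Ψ (y t) ≤ ∫⁻ t in E, liminf (fun n => Ψ (Y n t)) atTop := by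
            refine setLIntegral_mono_ae' hEm (Eventually.of_forall fun t ht => ?_)
            exact (LowerSemicontinuousAt.le_liminf (hE.lsc (y t))).trans
              (Filter.liminf_le_liminf_of_le (hy t (hsub ht).le))
        _ ≤ liminf (fun n => ∫⁻ t in E, Ψ (Y n t)) atTop :=
            lintegral_liminf_le fun n => hΨm.comp (hA n).measurable_Y.measurable
        _ ≤ liminf (fun n => ENNReal.ofReal (∫ t in E, ((Ψ v).toReal - ⟪Z n t + (-1 : ℝ) • M n t +
            (1 : ℝ) • (G (Y n t) + (-1 : ℝ) • us n t), Y n t - v⟫))) atTop := by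
            refine liminf_le_liminf (Eventually.of_forall fun n => ?_)
            refine le_trans (le_of_eq ?_) (ENNReal.ofReal_le_ofReal (hle n))
            rw [ofReal_integral_eq_lintegral_ofReal
              ((hint (hYm n) (fun t _ => (hA n).energy_le t) T).mono_set hET)
              (Eventually.of_forall fun t => ENNReal.toReal_nonneg)]
            refine lintegral_congr fun t => (ENNReal.ofReal_toReal ?_).symm
            exact ((hA n).energy_le t).trans_lt ENNReal.ofReal_lt_top |>.ne
        _ = _ := ((ENNReal.continuous_ofReal.tendsto _).comp hlim).liminf_eq
    rw [integral_toReal (f := fun t => Ψ (y t)) (hΨm.comp_aemeasurable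
      (hym.mono_measure (Measure.restrict_mono hsub le_rfl)).aemeasurable)]
    · exact (ENNReal.toReal_mono ENNReal.ofReal_ne_top hfatou).trans
        (ENNReal.toReal_ofReal hnn).le
    · filter_upwards [ae_restrict_mem hEm] with t ht
      exact ((hyC t (hsub ht).le).2).trans_lt ENNReal.ofReal_lt_top
  obtain ⟨v, hv, hdense⟩ := exists_dense_seq_energy Ψ ⟨y₀, hy₀⟩
  filter_upwards [ae_all_iff.2 fun n => single (v n) (hv n)] with t ht w hw
  have h1 := hdense (fun q => q.2 - ⟪z t + (-1 : ℝ) • μ t +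
        (1 : ℝ) • (G (y t) + (-1 : ℝ) • u t), y t - q.1⟫ - (Ψ (y t)).toReal) (by fun_prop)
    (fun n => by linarith [ht n]) w hw
  have h2 : z t + (-1 : ℝ) • μ t + (1 : ℝ) • (G (y t) + (-1 : ℝ) • u t) =
      z t + G (y t) - u t - μ t := by module
  rw [h2] at h1
  linarith

end LimitInequality

section AbstractExistence

variable {H : Type*} [NormedAddCommGroup H] [InnerProductSpace ℝ H] [CompleteSpace H]

lemma exists_weak_subseq_limit₃ [SecondCountableTopology H] {x₁ x₂ x₃ : ℕ → H} {C₁ C₂ C₃ : ℝ}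
    (h₁ : ∀ n, ‖x₁ n‖ ≤ C₁) (h₂ : ∀ n, ‖x₂ n‖ ≤ C₂) (h₃ : ∀ n, ‖x₃ n‖ ≤ C₃) :
    ∃ (a₁ a₂ a₃ : H) (φ : ℕ → ℕ), StrictMono φ ∧
      (∀ w, Tendsto (fun n => ⟪x₁ (φ n), w⟫) atTop (𝓝 ⟪a₁, w⟫)) ∧
      (∀ w, Tendsto (fun n => ⟪x₂ (φ n), w⟫) atTop (𝓝 ⟪a₂, w⟫)) ∧
      ∀ w, Tendsto (fun n => ⟪x₃ (φ n), w⟫) atTop (𝓝 ⟪a₃, w⟫) := by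
  obtain ⟨a₁, φ₁, hφ₁, l₁⟩ := exists_weak_subseq_limit h₁
  obtain ⟨a₂, φ₂, hφ₂, l₂⟩ := exists_weak_subseq_limit fun n => h₂ (φ₁ n)
  obtain ⟨a₃, φ₃, hφ₃, l₃⟩ := exists_weak_subseq_limit fun n => h₃ (φ₁ (φ₂ n))
  exact ⟨a₁, a₂, a₃, fun n => φ₁ (φ₂ (φ₃ n)), hφ₁.comp (hφ₂.comp hφ₃),
    fun w => (l₁ w).comp (hφ₂.comp hφ₃).tendsto_atTop,
    fun w => (l₂ w).comp hφ₃.tendsto_atTop, l₃⟩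

variable {Ψ : H → ℝ≥0∞} {P : H → ℝ} {G : H → H} {L α C₀ : ℝ} {b : HilbertBasis ℕ ℝ H} {κ : ℕ → ℝ}
  {τ h C : ℝ} {u : ℝ → H} {y₀ : H}

omit [CompleteSpace H] in
lemma enorm_exp_smul_le {t : ℝ} (ht : 0 < t) (x : H) : ‖Real.exp (-t) • x‖ₑ ^ 2 ≤ ‖x‖ₑ ^ 2 := by
  rw [enorm_smul]
  refine pow_le_pow_left' (mul_le_of_le_one_left' ?_) 2
  rw [Real.enorm_of_nonneg (Real.exp_pos _).le, ENNReal.ofReal_le_one]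
  exact Real.exp_le_one_iff.2 (by linarith)

omit [CompleteSpace H] in
lemma IsApprox.weighted_lintegral_le {Y M ζ Z : ℝ → H} (hC : 0 ≤ C)
    (hA : IsApprox Ψ G b κ τ h C u y₀ Y M ζ Z) :
    ∫⁻ t in Ioi (0 : ℝ), ‖Real.exp (-t) • ζ t‖ₑ ^ 2 ≤ ENNReal.ofReal C ∧
    ∫⁻ t in Ioi (0 : ℝ), ‖Real.exp (-t) • Z t‖ₑ ^ 2 ≤ ENNReal.ofReal C ∧
    ∫⁻ t in Ioi (0 : ℝ), ‖Real.exp (-t) • M t‖ₑ ^ 2 ≤ ENNReal.ofReal (3 * C ^ 2 * (1 + C)) := by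
  refine ⟨?_, ?_, ?_⟩
  · refine le_trans (setLIntegral_mono_ae' measurableSet_Ioi (Eventually.of_forall fun t ht => ?_))
      hA.lintegral_le
    exact (enorm_exp_smul_le ht _).trans le_self_add
  · refine le_trans (setLIntegral_mono_ae' measurableSet_Ioi (Eventually.of_forall fun t ht => ?_))
      hA.lintegral_le
    exact (enorm_exp_smul_le ht _).trans le_add_self
  · have hexp : ∫⁻ t in Ioi (0 : ℝ), ENNReal.ofReal (Real.exp (-t)) = 1 := by
      rw [← ofReal_integral_eq_lintegral_ofReal (integrableOn_exp_neg_Ioi 0)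
        (Eventually.of_forall fun t => (Real.exp_pos _).le), integral_exp_neg_Ioi_zero,
        ENNReal.ofReal_one]
    calc ∫⁻ t in Ioi (0 : ℝ), ‖Real.exp (-t) • M t‖ₑ ^ 2
        ≤ ∫⁻ t in Ioi (0 : ℝ), ENNReal.ofReal (3 * C ^ 2) *
            (ENNReal.ofReal (Real.exp (-t)) + (‖ζ t‖ₑ ^ 2 + ‖Z t‖ₑ ^ 2)) := by
          refine setLIntegral_mono_ae' measurableSet_Ioi (Eventually.of_forall fun t ht => ?_)
          have h1 : Real.exp (-t) ≤ 1 := Real.exp_le_one_iff.2 (by linarith [mem_Ioi.1 ht])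
          have h0 := Real.exp_pos (-t)
          simp only [← ofReal_norm, ← ENNReal.ofReal_pow (norm_nonneg _)]
          rw [← ENNReal.ofReal_add (by positivity) (by positivity),
            ← ENNReal.ofReal_add (by positivity) (by positivity),
            ← ENNReal.ofReal_mul (by positivity)]
          refine ENNReal.ofReal_le_ofReal ?_
          rw [norm_smul, Real.norm_of_nonneg h0.le]
          have h2 := pow_le_pow_left₀ (norm_nonneg _) (hA.norm_M_le t ht) 2
          set a := ‖ζ t‖
          set d := ‖Z t‖
          set e := Real.exp (-t)
          have h3 : (1 + a + d) ^ 2 ≤ 3 * (1 + (a ^ 2 + d ^ 2)) := by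
            nlinarith [sq_nonneg (1 - a), sq_nonneg (1 - d), sq_nonneg (a - d)]
          have h4 : e ^ 2 * (1 + (a ^ 2 + d ^ 2)) ≤ e + (a ^ 2 + d ^ 2) := by
            have h5 : e ^ 2 ≤ e := by nlinarith
            have h6 : e ^ 2 * (a ^ 2 + d ^ 2) ≤ 1 * (a ^ 2 + d ^ 2) :=
              mul_le_mul_of_nonneg_right (h5.trans h1) (by positivity)
            linarith
          calc (e * ‖M t‖) ^ 2 = e ^ 2 * ‖M t‖ ^ 2 := mul_pow _ _ _
            _ ≤ e ^ 2 * (C ^ 2 * (3 * (1 + (a ^ 2 + d ^ 2)))) := by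
                rw [mul_pow] at h2
                gcongr
                exact h2.trans (by gcongr)
            _ = 3 * C ^ 2 * (e ^ 2 * (1 + (a ^ 2 + d ^ 2))) := by ring
            _ ≤ 3 * C ^ 2 * (e + (a ^ 2 + d ^ 2)) := by gcongr
      _ = ENNReal.ofReal (3 * C ^ 2) *
            (1 + ∫⁻ t in Ioi (0 : ℝ), (‖ζ t‖ₑ ^ 2 + ‖Z t‖ₑ ^ 2)) := by
          rw [lintegral_const_mul' _ _ ENNReal.ofReal_ne_top, lintegral_add_left (by fun_prop),
            hexp]
      _ ≤ ENNReal.ofReal (3 * C ^ 2) * (1 + ENNReal.ofReal C) := by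
          gcongr; exact hA.lintegral_le
      _ = ENNReal.ofReal (3 * C ^ 2 * (1 + C)) := by
          rw [ENNReal.ofReal_mul (p := 3 * C ^ 2) (by positivity),
            ENNReal.ofReal_add zero_le_one hC,
            ENNReal.ofReal_one]

/-- Existence for the abstract evolution variational inequality driven by `Ψ + P`. -/
theorem IsEnergy.exists_solution [SecondCountableTopology H] (hE : IsEnergy Ψ P G L α C₀)
    (b : HilbertBasis ℕ ℝ H) (hκ : ∀ j, 0 ≤ κ j) (hτ : τ ∈ Set.Icc (0 : ℝ) 1)
    (hy₀ : Ψ y₀ < ⊤) (hK : KernelCondition Ψ b κ y₀) (hu : ContinuousOn u (Ici 0)) {U V : ℝ}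
    (hU : ∀ t, 0 ≤ t → ‖u t‖ ≤ U)
    (hV : ∀ h : ℝ, 0 < h → ∀ n : ℕ,
      ∑ i ∈ Finset.range n, ‖u ((i + 1 : ℕ) * h) - u (i * h)‖ ≤ V) :
    ∃ (y μ ζ z : ℝ → H) (C : ℝ),
      AEStronglyMeasurable y (volume.restrict (Ioi (0 : ℝ))) ∧
      AEStronglyMeasurable μ (volume.restrict (Ioi (0 : ℝ))) ∧
      AEStronglyMeasurable ζ (volume.restrict (Ioi (0 : ℝ))) ∧
      AEStronglyMeasurable z (volume.restrict (Ioi (0 : ℝ))) ∧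
      (∀ T, MemLp μ 2 (volume.restrict (Ioc (0 : ℝ) T))) ∧
      (∀ T, MemLp ζ 2 (volume.restrict (Ioc (0 : ℝ) T))) ∧
      (∀ T, MemLp z 2 (volume.restrict (Ioc (0 : ℝ) T))) ∧
      (∀ t, 0 ≤ t → ‖y t‖ ≤ C ∧ Ψ (y t) ≤ ENNReal.ofReal C) ∧
      (∀ t, 0 ≤ t → ∀ j, ⟪y t, b j⟫ = ⟪y₀, b j⟫ - κ j * ∫ s in (0 : ℝ)..t, ⟪ζ s, b j⟫) ∧
      (∀ᵐ t ∂(volume.restrict (Ioi (0 : ℝ))), ∀ j, ⟪ζ t, b j⟫ = κ j * ⟪μ t, b j⟫) ∧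
      (∀ᵐ t ∂(volume.restrict (Ioi (0 : ℝ))), ∀ j, ⟪z t, b j⟫ = -(τ * κ j) * ⟪ζ t, b j⟫) ∧
      ∀ᵐ t ∂(volume.restrict (Ioi (0 : ℝ))), ∀ v, Ψ v < ⊤ →
        (Ψ (y t)).toReal + ⟪z t + G (y t) - u t - μ t, y t - v⟫ ≤ (Ψ v).toReal := by
  obtain ⟨C, h₀, hC, hh₀, happ⟩ := hE.exists_approx b hκ hτ hy₀ hK hU hV
  have hpos : ∀ n : ℕ, 0 < h₀ / (n + 1 : ℝ) := fun n => by positivity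
  have hlim : Tendsto (fun n : ℕ => h₀ / (n + 1 : ℝ)) atTop (𝓝 0) := by
    simpa [div_eq_mul_inv] using (tendsto_one_div_add_atTop_nhds_zero_nat (𝕜 := ℝ)).const_mul h₀
  choose Y M ζ Z hA using fun n : ℕ => happ (h₀ / (n + 1 : ℝ)) (hpos n)
    (div_le_self hh₀.le (by linarith [Nat.cast_nonneg (α := ℝ) n]))
  have hexp : ∀ {x : ℝ → H}, StronglyMeasurable x → AEStronglyMeasurable
      x (volume.restrict (Ioi (0 : ℝ))) := fun hx => hx.aestronglyMeasurable
  obtain ⟨p₁, hp₁, he₁⟩ := exists_weighted_Lp (fun n => hexp (hA n).measurable_ζ) hC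
    fun n => ((hA n).weighted_lintegral_le hC).1
  obtain ⟨p₂, hp₂, he₂⟩ := exists_weighted_Lp (fun n => hexp (hA n).measurable_Z) hC
    fun n => ((hA n).weighted_lintegral_le hC).2.1
  obtain ⟨p₃, hp₃, he₃⟩ := exists_weighted_Lp (fun n => hexp (hA n).measurable_M)
    (C := 3 * C ^ 2 * (1 + C)) (by positivity) fun n => ((hA n).weighted_lintegral_le hC).2.2
  have : Fact ((2 : ℝ≥0∞) ≠ ∞) := ⟨by norm_num⟩
  obtain ⟨a₁, a₂, a₃, φ, hφ, l₁, l₂, l₃⟩ := exists_weak_subseq_limit₃ hp₁ hp₂ hp₃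
  have hζ := isLocalWeakLimit_of_Lp (fun n => hp₁ (φ n)) l₁ fun n => he₁ (φ n)
  have hZ := isLocalWeakLimit_of_Lp (fun n => hp₂ (φ n)) l₂ fun n => he₂ (φ n)
  have hM := isLocalWeakLimit_of_Lp (fun n => hp₃ (φ n)) l₃ fun n => he₃ (φ n)
  have hpos' := fun n => hpos (φ n)
  have hlim' := hlim.comp hφ.tendsto_atTop
  have hA' := fun n => hA (φ n)
  obtain ⟨y, hy, hyC, hevol⟩ := exists_pointwise_limit hE hlim' hA' hζ
  refine ⟨y, _, _, _, C, ?_, hM.measurable, hζ.measurable, hZ.measurable, hM.memLp, hζ.memLp,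
    hZ.memLp, hyC, hevol, ae_coord_eq hA' hM hζ, ae_rate_eq hlim' hA' hζ hZ,
    ae_variational_ineq hE hy₀ hu hU hpos' hlim' hA' hM hZ hy hyC⟩
  refine aestronglyMeasurable_of_tendsto_ae atTop
    (fun n => (hA' n).measurable_Y.aestronglyMeasurable) ?_
  filter_upwards [ae_restrict_mem measurableSet_Ioi] with t ht using hy t (le_of_lt ht)

end AbstractExistence

section QuadraticEnergy

variable {H : Type*} [NormedAddCommGroup H] [InnerProductSpace ℝ H]

/-- Half the squared norm of the diagonal operator with entries `ν` in the basis `b`. -/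
def quadEnergy (b : HilbertBasis ℕ ℝ H) (ν : ℕ → ℝ) (v : H) : ℝ≥0∞ :=
  ∑' j, ENNReal.ofReal ((ν j * ⟪v, b j⟫) ^ 2 / 2)

variable (b : HilbertBasis ℕ ℝ H) (ν : ℕ → ℝ)

lemma lowerSemicontinuous_quadEnergy : LowerSemicontinuous (quadEnergy b ν) :=
  lowerSemicontinuous_tsum fun j => Continuous.lowerSemicontinuous
    (ENNReal.continuous_ofReal.comp (by fun_prop))

lemma quadEnergy_convex (v w : H) {s : ℝ} (h0 : 0 ≤ s) (h1 : s ≤ 1) :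
    quadEnergy b ν (s • v + (1 - s) • w) ≤
      ENNReal.ofReal s * quadEnergy b ν v + ENNReal.ofReal (1 - s) * quadEnergy b ν w := by
  rw [quadEnergy, quadEnergy, quadEnergy, ← ENNReal.tsum_mul_left, ← ENNReal.tsum_mul_left,
    ← ENNReal.tsum_add]
  refine ENNReal.tsum_le_tsum fun j => ?_
  have h2 : 0 ≤ 1 - s := by linarith
  rw [← ENNReal.ofReal_mul h0, ← ENNReal.ofReal_mul h2,
    ← ENNReal.ofReal_add (by positivity) (by positivity)]
  refine ENNReal.ofReal_le_ofReal ?_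
  rw [inner_add_left, real_inner_smul_left, real_inner_smul_left]
  nlinarith [mul_nonneg (mul_nonneg h0 h2) (sq_nonneg (ν j * ⟪v, b j⟫ - ν j * ⟪w, b j⟫))]

lemma quadEnergy_lt_top_iff {v : H} :
    quadEnergy b ν v < ⊤ ↔ Summable fun j => (ν j * ⟪v, b j⟫) ^ 2 := by
  constructor
  · intro h
    have h1 := ENNReal.summable_toReal h.ne
    have h2 := h1.mul_left 2
    refine h2.congr fun j => ?_
    rw [ENNReal.toReal_ofReal (by positivity)]
    ring
  · intro h
    rw [quadEnergy, ← ENNReal.ofReal_tsum_of_nonneg (fun j => by positivity) (h.div_const 2)]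
    exact ENNReal.ofReal_lt_top

lemma quadEnergy_toReal {v : H} (h : Summable fun j => (ν j * ⟪v, b j⟫) ^ 2) :
    (quadEnergy b ν v).toReal = (∑' j, (ν j * ⟪v, b j⟫) ^ 2) / 2 := by
  rw [quadEnergy, ← ENNReal.ofReal_tsum_of_nonneg (fun j => by positivity) (h.div_const 2),
    ENNReal.toReal_ofReal (tsum_nonneg fun j => by positivity), tsum_div_const]

lemma sum_coord_le_of_quadEnergy_le {v : H} {C : ℝ} (h : quadEnergy b ν v ≤ ENNReal.ofReal C)
    (n : ℕ) : ∑ j ∈ Finset.range n, (ν j * ⟪v, b j⟫) ^ 2 ≤ 2 * max C 0 := by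
  have hs := (quadEnergy_lt_top_iff b ν).1 (h.trans_lt ENNReal.ofReal_lt_top)
  have h1 := ENNReal.toReal_mono ENNReal.ofReal_ne_top h
  rw [quadEnergy_toReal b ν hs, ENNReal.toReal_ofReal'] at h1
  have h2 := hs.sum_le_tsum (Finset.range n) fun j _ => sq_nonneg _
  linarith

end QuadraticEnergy

section Superposition

variable {X : Type*} [MeasurableSpace X] {m : Measure X}

lemma lowerSemicontinuous_lintegral_comp {f : ℝ → ℝ≥0∞} (hf : LowerSemicontinuous f) :
    LowerSemicontinuous fun v : Lp ℝ 2 m => ∫⁻ x, f (v x) ∂m := by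
  rw [lowerSemicontinuous_iff_isClosed_preimage]
  intro c
  refine IsSeqClosed.isClosed fun v w hv hw => ?_
  obtain ⟨φ, -, hφ⟩ := (tendstoInMeasure_of_tendsto_Lp hw).exists_seq_tendsto_ae
  calc ∫⁻ x, f (w x) ∂m ≤ ∫⁻ x, liminf (fun n => f (v (φ n) x)) atTop ∂m := by
        refine lintegral_mono_ae ?_
        filter_upwards [hφ] with x hx
        exact (LowerSemicontinuousAt.le_liminf (hf (w x))).trans
          (Filter.liminf_le_liminf_of_le hx)
    _ ≤ liminf (fun n => ∫⁻ x, f (v (φ n) x) ∂m) atTop :=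
        lintegral_liminf_le' fun n =>
          hf.measurable.comp_aemeasurable (Lp.aestronglyMeasurable _).aemeasurable
    _ ≤ c := by
        refine (liminf_le_liminf (Eventually.of_forall fun n => hv (φ n))).trans ?_
        simp

lemma lintegral_comp_convex {f : ℝ → ℝ≥0∞} (hf : Measurable f)
    (hc : ∀ a b t : ℝ, 0 ≤ t → t ≤ 1 →
      f (t * a + (1 - t) * b) ≤ ENNReal.ofReal t * f a + ENNReal.ofReal (1 - t) * f b)
    (v w : Lp ℝ 2 m) {s : ℝ} (h0 : 0 ≤ s) (h1 : s ≤ 1) :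
    ∫⁻ x, f ((s • v + (1 - s) • w : Lp ℝ 2 m) x) ∂m ≤
      ENNReal.ofReal s * ∫⁻ x, f (v x) ∂m + ENNReal.ofReal (1 - s) * ∫⁻ x, f (w x) ∂m := by
  have hm : ∀ v : Lp ℝ 2 m, AEMeasurable (fun x => f (v x)) m := fun v =>
    hf.comp_aemeasurable (Lp.aestronglyMeasurable _).aemeasurable
  rw [← lintegral_const_mul'' _ (hm v), ← lintegral_const_mul'' _ (hm w),
    ← lintegral_add_left' ((hm v).const_mul _)]
  refine lintegral_mono_ae ?_
  filter_upwards [Lp.coeFn_add (s • v) ((1 - s) • w), Lp.coeFn_smul s v,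
    Lp.coeFn_smul (1 - s) w] with x h2 h3 h4
  rw [h2, Pi.add_apply, h3, h4]
  exact hc _ _ s h0 h1

lemma norm_sq_eq_integral (v : Lp ℝ 2 m) : ‖v‖ ^ 2 = ∫ x, v x ^ 2 ∂m := by
  rw [← real_inner_self_eq_norm_sq, L2.inner_def]
  simp [sq]

lemma integrable_sq_Lp (v : Lp ℝ 2 m) : Integrable (fun x => v x ^ 2) m :=
  (Lp.memLp v).integrable_sq

variable [IsFiniteMeasure m] {p q : ℝ → ℝ} {K : ℝ≥0}

lemma memLp_comp_of_lipschitz (hq : LipschitzWith K q) (v : Lp ℝ 2 m) :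
    MemLp (fun x => q (v x)) 2 m := by
  have h1 : LipschitzWith K fun s => q s - q 0 := fun a b => by
    simpa [edist_sub_right] using hq a b
  have h2 := (h1.comp_memLp (by simp) (Lp.memLp v)).add (memLp_const (q 0))
  refine h2.congr_norm ?_ (Eventually.of_forall fun x => ?_)
  · exact hq.continuous.comp_aestronglyMeasurable (Lp.aestronglyMeasurable v)
  · simp

/-- The superposition operator on `L²` induced by a Lipschitz function. -/
def nemytskii (hq : LipschitzWith K q) (v : Lp ℝ 2 m) : Lp ℝ 2 m :=
  (memLp_comp_of_lipschitz hq v).toLp _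

lemma coeFn_nemytskii (hq : LipschitzWith K q) (v : Lp ℝ 2 m) :
    nemytskii hq v =ᵐ[m] fun x => q (v x) := MemLp.coeFn_toLp _

lemma norm_nemytskii_sub_le (hq : LipschitzWith K q) (v w : Lp ℝ 2 m) :
    ‖nemytskii hq v - nemytskii hq w‖ ≤ K * ‖v - w‖ := by
  refine Lp.norm_le_mul_norm_of_ae_le_mul ?_
  filter_upwards [Lp.coeFn_sub (nemytskii hq v) (nemytskii hq w), Lp.coeFn_sub v w,
    coeFn_nemytskii hq v, coeFn_nemytskii hq w] with x h1 h2 h3 h4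
  rw [h1, h2, Pi.sub_apply, Pi.sub_apply, h3, h4]
  exact hq.norm_sub_le _ _

lemma abs_taylor_le (hp : ∀ s, HasDerivAt p (q s) s) (hq : LipschitzWith K q) (a c : ℝ) :
    |p c - p a - q a * (c - a)| ≤ K * (c - a) ^ 2 := by
  have h1 : ∀ x ∈ uIcc a c, HasDerivWithinAt (fun s => p s - q a * s) (q x - q a) (uIcc a c) x :=
    fun x _ => by
      have h := (hasDerivAt_id x).const_mul (q a)
      rw [mul_one] at h
      exact ((hp x).sub h).hasDerivWithinAt
  have h2 : ∀ x ∈ uIcc a c, ‖q x - q a‖ ≤ K * |c - a| := fun x hx =>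
    (hq.norm_sub_le _ _).trans (mul_le_mul_of_nonneg_left (abs_sub_left_of_mem_uIcc hx) K.2)
  have h3 := (convex_uIcc a c).norm_image_sub_le_of_norm_hasDerivWithin_le h1 h2
    left_mem_uIcc right_mem_uIcc
  have h4 : p c - q a * c - (p a - q a * a) = p c - p a - q a * (c - a) := by ring
  rw [h4, Real.norm_eq_abs, Real.norm_eq_abs, mul_assoc, abs_mul_abs_self, ← sq] at h3
  exact h3

lemma integrable_comp_of_hasDerivAt (hp : ∀ s, HasDerivAt p (q s) s) (hq : LipschitzWith K q)
    (v : Lp ℝ 2 m) : Integrable (fun x => p (v x)) m := by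
  have hcont : Continuous p := continuous_iff_continuousAt.2 fun s => (hp s).continuousAt
  have hv1 : Integrable (fun x => v x) m := (Lp.memLp v).integrable (by norm_num)
  refine Integrable.mono' (((integrable_const |p 0|).add ((hv1.norm).const_mul |q 0|)).add
    ((integrable_sq_Lp v).const_mul K))
    (hcont.comp_aestronglyMeasurable (Lp.aestronglyMeasurable v))
    (Eventually.of_forall fun x => ?_)
  have h1 := abs_taylor_le hp hq 0 (v x)
  simp only [sub_zero, Pi.add_apply, Real.norm_eq_abs] at h1 ⊢
  have h2 : |p (v x)| ≤ |p (v x) - p 0 - q 0 * v x| + |p 0 + q 0 * v x| := by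
    refine le_trans (le_of_eq ?_) (abs_add_le _ _)
    ring_nf
  have h3 := abs_add_le (p 0) (q 0 * v x)
  rw [abs_mul] at h3
  linarith

lemma abs_integral_taylor_le (hp : ∀ s, HasDerivAt p (q s) s) (hq : LipschitzWith K q)
    (v w : Lp ℝ 2 m) :
    |(∫ x, p (w x) ∂m) - (∫ x, p (v x) ∂m) - ⟪nemytskii hq v, w - v⟫| ≤ K * ‖w - v‖ ^ 2 := by
  have hi := integrable_comp_of_hasDerivAt (m := m) hp hq
  have hsub : Integrable (fun x => p (w x) - p (v x)) m := (hi w).sub (hi v)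
  rw [L2.inner_def, norm_sq_eq_integral, ← integral_sub (hi w) (hi v),
    ← integral_sub hsub (L2.integrable_inner _ _), ← integral_const_mul,
    ← Real.norm_eq_abs]
  refine norm_integral_le_of_norm_le ((integrable_sq_Lp _).const_mul _) ?_
  filter_upwards [Lp.coeFn_sub w v, coeFn_nemytskii hq v] with x h1 h2
  rw [h1, h2, Pi.sub_apply]
  have := abs_taylor_le hp hq (v x) (w x)
  simpa [mul_comm] using this

lemma exists_global_coercive {f : ℝ → ℝ≥0∞} {α : ℝ} (hp : ∀ s, HasDerivAt p (q s) s)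
    (h : ∀ᶠ s : ℝ in Filter.comap (|·|) atTop, ENNReal.ofReal (α * s ^ 2 - p s) ≤ f s) :
    ∃ C : ℝ, ∀ s, ENNReal.ofReal (α * s ^ 2 - p s - C) ≤ f s := by
  have hcont : Continuous p := continuous_iff_continuousAt.2 fun s => (hp s).continuousAt
  rw [eventually_comap] at h
  obtain ⟨R, hR⟩ := eventually_atTop.1 h
  obtain ⟨C, hC⟩ := (isCompact_Icc (a := -|R|) (b := |R|)).bddAbove_image
    (f := fun s => α * s ^ 2 - p s) (by fun_prop)
  refine ⟨max C 0, fun s => ?_⟩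
  rcases le_total R |s| with hs | hs
  · refine le_trans (ENNReal.ofReal_le_ofReal ?_) (hR |s| hs s rfl)
    linarith [le_max_right C 0]
  · have h1 : α * s ^ 2 - p s ≤ C := hC (mem_image_of_mem _ (abs_le.1 (hs.trans (le_abs_self R))))
    rw [ENNReal.ofReal_of_nonpos (by linarith [le_max_left C 0])]
    exact zero_le

lemma integral_coercive {f : ℝ → ℝ≥0∞} {α C : ℝ} (hf : Measurable f)
    (hp : ∀ s, HasDerivAt p (q s) s) (hq : LipschitzWith K q)
    (h : ∀ s, ENNReal.ofReal (α * s ^ 2 - p s - C) ≤ f s) (v : Lp ℝ 2 m)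
    (hv : ∫⁻ x, f (v x) ∂m < ⊤) :
    α * ‖v‖ ^ 2 - C * m.real univ ≤ (∫⁻ x, f (v x) ∂m).toReal + ∫ x, p (v x) ∂m := by
  have hm : AEMeasurable (fun x => f (v x)) m :=
    hf.comp_aemeasurable (Lp.aestronglyMeasurable _).aemeasurable
  have hfin := ae_lt_top' hm hv.ne
  have hi := integrable_comp_of_hasDerivAt hp hq v
  have hi2 := (integrable_sq_Lp v).const_mul α
  have hsub : Integrable (fun x => α * v x ^ 2 - p (v x)) m := hi2.sub hi
  have h1 : ∫ x, (α * v x ^ 2 - p (v x) - C) ∂m ≤ ∫ x, (f (v x)).toReal ∂m := by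
    refine integral_mono_ae (hsub.sub (integrable_const _))
      (integrable_toReal_of_lintegral_ne_top hm hv.ne) ?_
    filter_upwards [hfin] with x hx
    exact (ENNReal.ofReal_le_iff_le_toReal hx.ne).1 (h (v x))
  rw [integral_toReal hm hfin, integral_sub hsub (integrable_const _),
    integral_sub hi2 hi, integral_const_mul, ← norm_sq_eq_integral, integral_const,
    smul_eq_mul] at h1
  linarith

/-- The free energy built from a diagonal quadratic form and a nonlinear density. -/
lemma isEnergy_quadEnergy_add [SecondCountableTopology (Lp ℝ 2 m)]
    (b : HilbertBasis ℕ ℝ (Lp ℝ 2 m)) {ν : ℕ → ℝ}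
    (hν : Tendsto ν atTop atTop) {f : ℝ → ℝ≥0∞} (hf : LowerSemicontinuous f)
    (hc : ∀ a b t : ℝ, 0 ≤ t → t ≤ 1 →
      f (t * a + (1 - t) * b) ≤ ENNReal.ofReal t * f a + ENNReal.ofReal (1 - t) * f b)
    (hp : ∀ s, HasDerivAt p (q s) s) (hq : LipschitzWith K q) {α C : ℝ} (hα : 0 < α)
    (h : ∀ s, ENNReal.ofReal (α * s ^ 2 - p s - C) ≤ f s) :
    IsEnergy (fun v : Lp ℝ 2 m => quadEnergy b ν v + ∫⁻ x, f (v x) ∂m)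
      (fun v => ∫ x, p (v x) ∂m) (nemytskii hq) K α (C * m.real univ) where
  lsc := (lowerSemicontinuous_quadEnergy b ν).add (lowerSemicontinuous_lintegral_comp hf)
  convex v w s h0 h1 := by
    refine (add_le_add (quadEnergy_convex b ν v w h0 h1)
      (lintegral_comp_convex hf.measurable hc v w h0 h1)).trans (le_of_eq ?_)
    ring
  compact c R := by
    refine isCompact_of_coord_sum_le b hν (R := R) (C := 2 * max c 0) ?_ (fun v hv => hv.2)
      fun v hv n => sum_coord_le_of_quadEnergy_le b ν (le_self_add.trans hv.1) n
    refine IsClosed.inter ?_ (isClosed_le continuous_norm continuous_const)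
    exact lowerSemicontinuous_iff_isClosed_preimage.1
      ((lowerSemicontinuous_quadEnergy b ν).add (lowerSemicontinuous_lintegral_comp hf)) _
  lipschitz := norm_nemytskii_sub_le hq
  taylor := abs_integral_taylor_le hp hq
  pos := hα
  coercive v hv := by
    have h2 : ∫⁻ x, f (v x) ∂m < ⊤ := le_add_self.trans_lt hv
    exact (integral_coercive hf.measurable hp hq h v h2).trans
      (add_le_add_left (ENNReal.toReal_mono hv.ne le_add_self) _)

end Superposition

section Variational

variable {H : Type*} [NormedAddCommGroup H] [InnerProductSpace ℝ H] {b : HilbertBasis ℕ ℝ H}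
  {ν : ℕ → ℝ}

lemma quadEnergy_eq_of_coord {v w : H} (h : ∀ j, ⟪w, b j⟫ = ν j * ⟪v, b j⟫) :
    quadEnergy b ν v = ENNReal.ofReal (‖w‖ ^ 2 / 2) := by
  have h1 := hasSum_coord_sq b w
  simp only [h] at h1
  rw [quadEnergy, ← ENNReal.ofReal_tsum_of_nonneg (fun j => by positivity)
    (h1.summable.div_const 2), tsum_div_const, h1.tsum_eq]

lemma variational_ineq_of_energy {J : H → ℝ≥0∞}
    (hJ : ∀ v w : H, ∀ s : ℝ, 0 ≤ s → s ≤ 1 →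
      J (s • v + (1 - s) • w) ≤ ENNReal.ofReal s * J v + ENNReal.ofReal (1 - s) * J w)
    {y v By Bv g : H} (hBy : ∀ j, ⟪By, b j⟫ = ν j * ⟪y, b j⟫)
    (hBv : ∀ j, ⟪Bv, b j⟫ = ν j * ⟪v, b j⟫) (hJy : J y < ⊤) (hJv : J v < ⊤)
    (h : ∀ w, quadEnergy b ν w + J w < ⊤ →
      (quadEnergy b ν y + J y).toReal + ⟪g, y - w⟫ ≤ (quadEnergy b ν w + J w).toReal) :
    ⟪By, By - Bv⟫ + (J y).toReal + ⟪g, y - v⟫ ≤ (J v).toReal := by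
  have key : ∀ s ∈ Ioc (0 : ℝ) 1, ⟪By, By - Bv⟫ + (J y).toReal + ⟪g, y - v⟫ - (J v).toReal ≤
      s * (‖By - Bv‖ ^ 2 / 2) := by
    intro s hs
    have hle := hJ v y s hs.1.le hs.2
    have hfin : ENNReal.ofReal s * J v + ENNReal.ofReal (1 - s) * J y < ⊤ :=
      ENNReal.add_lt_top.2 ⟨ENNReal.mul_lt_top ENNReal.ofReal_lt_top hJv,
        ENNReal.mul_lt_top ENNReal.ofReal_lt_top hJy⟩
    have hBs : ∀ j, ⟪s • Bv + (1 - s) • By, b j⟫ = ν j * ⟪s • v + (1 - s) • y, b j⟫ := fun j => by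
      simp only [inner_add_left, real_inner_smul_left, hBy, hBv]; ring
    have h1 := h (s • v + (1 - s) • y) (by
      rw [quadEnergy_eq_of_coord hBs]
      exact ENNReal.add_lt_top.2 ⟨ENNReal.ofReal_lt_top, hle.trans_lt hfin⟩)
    rw [quadEnergy_eq_of_coord hBs, quadEnergy_eq_of_coord hBy,
      ENNReal.toReal_add ENNReal.ofReal_ne_top hJy.ne,
      ENNReal.toReal_add ENNReal.ofReal_ne_top (hle.trans_lt hfin).ne,
      ENNReal.toReal_ofReal (by positivity), ENNReal.toReal_ofReal (by positivity)] at h1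
    have h2 := ENNReal.toReal_mono hfin.ne hle
    rw [ENNReal.toReal_add (ENNReal.mul_lt_top ENNReal.ofReal_lt_top hJv).ne
      (ENNReal.mul_lt_top ENNReal.ofReal_lt_top hJy).ne, ENNReal.toReal_mul, ENNReal.toReal_mul,
      ENNReal.toReal_ofReal hs.1.le, ENNReal.toReal_ofReal (by linarith [hs.2])] at h2
    have h3 : y - (s • v + (1 - s) • y) = s • (y - v) := by module
    have h4 : s • Bv + (1 - s) • By = By - s • (By - Bv) := by module
    rw [h3, real_inner_smul_right, h4, norm_sub_sq_real, real_inner_smul_right, norm_smul,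
      mul_pow, Real.norm_eq_abs, sq_abs] at h1
    have h5 : s * (⟪By, By - Bv⟫ + (J y).toReal + ⟪g, y - v⟫ - (J v).toReal) ≤
        s * (s * (‖By - Bv‖ ^ 2 / 2)) := by linarith
    exact le_of_mul_le_mul_left h5 hs.1
  have hlim : Tendsto (fun s : ℝ => s * (‖By - Bv‖ ^ 2 / 2)) (𝓝[>] 0) (𝓝 0) := by
    have : Continuous fun s : ℝ => s * (‖By - Bv‖ ^ 2 / 2) := by fun_prop
    simpa using (this.tendsto 0).mono_left nhdsWithin_le_nhds
  have := ge_of_tendsto hlim (Filter.mem_of_superset (Ioc_mem_nhdsGT zero_lt_one) key)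
  linarith

end Variational

section Forcing

variable {H : Type*} [NormedAddCommGroup H] [NormedSpace ℝ H] {u u' : ℝ → H}

lemma continuousOn_of_eq_primitive [CompleteSpace H] (hi : IntegrableOn u' (Ioi (0 : ℝ)))
    (hu : ∀ t : ℝ, 0 ≤ t → u t = u 0 + ∫ s in (0 : ℝ)..t, u' s) : ContinuousOn u (Ici 0) := by
  have h1 : Integrable (indicator (Ioi (0 : ℝ)) u') :=
    (integrable_indicator_iff measurableSet_Ioi).2 hi
  have h2 : Continuous fun t => u 0 + ∫ s in (0 : ℝ)..t, indicator (Ioi (0 : ℝ)) u' s :=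
    continuous_const.add (intervalIntegral.continuous_primitive
      (fun a b => h1.intervalIntegrable) 0)
  refine h2.continuousOn.congr fun t ht => ?_
  dsimp only
  rw [hu t ht, intervalIntegral.integral_of_le ht, intervalIntegral.integral_of_le ht]
  congr 1
  refine setIntegral_congr_fun measurableSet_Ioc fun s hs => ?_
  exact (indicator_of_mem (mem_Ioi.2 hs.1) u').symm

lemma norm_sub_le_integral_norm (hi : IntegrableOn u' (Ioi (0 : ℝ)))
    (hu : ∀ t : ℝ, 0 ≤ t → u t = u 0 + ∫ s in (0 : ℝ)..t, u' s) {s t : ℝ} (hs : 0 ≤ s)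
    (hst : s ≤ t) : ‖u t - u s‖ ≤ ∫ x in s..t, ‖u' x‖ := by
  have hint : ∀ a b : ℝ, 0 ≤ a → a ≤ b → IntervalIntegrable u' volume a b := fun a b ha hab =>
    (intervalIntegrable_iff_integrableOn_Ioc_of_le hab).2
      (hi.mono_set fun x hx => ha.trans_lt hx.1)
  rw [hu t (hs.trans hst), hu s hs, add_sub_add_left_eq_sub,
    intervalIntegral.integral_interval_sub_left (hint 0 t le_rfl (hs.trans hst))
      (hint 0 s le_rfl hs)]
  exact intervalIntegral.norm_integral_le_integral_norm hst

omit [NormedSpace ℝ H] in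
lemma integral_norm_le_of_nonneg (hi : IntegrableOn u' (Ioi (0 : ℝ))) {t : ℝ} (ht : 0 ≤ t) :
    ∫ x in (0 : ℝ)..t, ‖u' x‖ ≤ ∫ x in Ioi (0 : ℝ), ‖u' x‖ := by
  rw [intervalIntegral.integral_of_le ht]
  exact setIntegral_mono_set hi.norm (Eventually.of_forall fun x => norm_nonneg _)
    (Eventually.of_forall fun x hx => hx.1)

lemma sum_norm_sub_le (hi : IntegrableOn u' (Ioi (0 : ℝ)))
    (hu : ∀ t : ℝ, 0 ≤ t → u t = u 0 + ∫ s in (0 : ℝ)..t, u' s) {h : ℝ} (hh : 0 < h) (n : ℕ) :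
    ∑ i ∈ Finset.range n, ‖u ((i + 1 : ℕ) * h) - u (i * h)‖ ≤ ∫ x in Ioi (0 : ℝ), ‖u' x‖ := by
  have hle : ∀ i : ℕ, (i : ℝ) * h ≤ (i + 1 : ℕ) * h := fun i => by push_cast; linarith
  calc ∑ i ∈ Finset.range n, ‖u ((i + 1 : ℕ) * h) - u (i * h)‖
      ≤ ∑ i ∈ Finset.range n, ∫ x in (i * h : ℝ)..((i + 1 : ℕ) * h), ‖u' x‖ :=
        Finset.sum_le_sum fun i _ => norm_sub_le_integral_norm hi hu (by positivity) (hle i)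
    _ = ∫ x in (((0 : ℕ) : ℝ) * h)..(n * h), ‖u' x‖ :=
        intervalIntegral.sum_integral_adjacent_intervals (a := fun k : ℕ => (k : ℝ) * h)
          fun i _ => (intervalIntegrable_iff_integrableOn_Ioc_of_le (hle i)).2
            (IntegrableOn.mono_set (show IntegrableOn (fun x => ‖u' x‖) (Ioi 0) volume from hi.norm)
              fun x hx => (show (0 : ℝ) ≤ i * h by positivity).trans_lt hx.1)
    _ ≤ _ := by
        rw [Nat.cast_zero, zero_mul]
        exact integral_norm_le_of_nonneg hi (by positivity)

end Forcing

section FractionalPower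

variable {Om : Set E3} {lam : ℕ → ℝ} {e : ℕ → Hs Om} {ρ : ℝ} {b : HilbertBasis ℕ ℝ (Hs Om)}

lemma exists_hilbertBasis (he : Orthonormal ℝ e)
    (hspan : (Submodule.span ℝ (Set.range e)).topologicalClosure = ⊤) :
    ∃ b : HilbertBasis ℕ ℝ (Hs Om), ∀ j, b j = e j :=
  ⟨HilbertBasis.mk he hspan.ge, fun j => by rw [HilbertBasis.coe_mk]⟩

lemma fracPow_eq_of_coord (hb : ∀ j, b j = e j) {v w : Hs Om}
    (h : ∀ j, ⟪w, b j⟫ = lam j ^ ρ * ⟪v, b j⟫) : fracPow lam e ρ v = w := by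
  have h1 := b.hasSum_repr w
  simp only [b.repr_apply_apply, real_inner_comm, h] at h1
  simp only [fracPow, ← hb]
  exact h1.tsum_eq

lemma inDom_of_coord (hb : ∀ j, b j = e j) {v w : Hs Om}
    (h : ∀ j, ⟪w, b j⟫ = lam j ^ ρ * ⟪v, b j⟫) : inDom lam e ρ v := by
  have h1 := (hasSum_coord_sq b w).summable
  rw [inDom]
  refine h1.congr fun j => ?_
  rw [h, hb]

lemma inner_fracPow (hb : ∀ j, b j = e j) {v : Hs Om} (hv : inDom lam e ρ v) (j : ℕ) :
    ⟪fracPow lam e ρ v, b j⟫ = lam j ^ ρ * ⟪v, b j⟫ := by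
  simp only [inDom, ← hb] at hv
  obtain ⟨w, hw⟩ := exists_coord_eq b hv
  rw [fracPow_eq_of_coord hb hw, hw]

/-- The fractional power agrees on its domain with an everywhere defined linear map. -/
lemma exists_linear_extension (hb : ∀ j, b j = e j) (lam : ℕ → ℝ) (ρ : ℝ) :
    ∃ R : Hs Om →ₗ[ℝ] Hs Om, ∀ v, inDom lam e ρ v → R v = fracPow lam e ρ v := by
  have hadd : ∀ {v w : Hs Om}, inDom lam e ρ v → inDom lam e ρ w → ∀ j,
      ⟪fracPow lam e ρ v + fracPow lam e ρ w, b j⟫ = lam j ^ ρ * ⟪v + w, b j⟫ :=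
    fun hv hw j => by
      rw [inner_add_left, inner_add_left, inner_fracPow hb hv, inner_fracPow hb hw, mul_add]
  have hsmul : ∀ (c : ℝ) {v : Hs Om}, inDom lam e ρ v → ∀ j,
      ⟪c • fracPow lam e ρ v, b j⟫ = lam j ^ ρ * ⟪c • v, b j⟫ := fun c v hv j => by
    rw [real_inner_smul_left, real_inner_smul_left, inner_fracPow hb hv]; ring
  let S : Submodule ℝ (Hs Om) :=
    { carrier := {v | inDom lam e ρ v}
      add_mem' := fun hv hw => inDom_of_coord hb (hadd hv hw)
      zero_mem' := inDom_of_coord hb (w := 0) fun j => by simp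
      smul_mem' := fun c v hv => inDom_of_coord hb (hsmul c hv) }
  let f : S →ₗ[ℝ] Hs Om :=
    { toFun := fun v => fracPow lam e ρ v.1
      map_add' := fun v w => fracPow_eq_of_coord hb (hadd v.2 w.2)
      map_smul' := fun c v => fracPow_eq_of_coord hb (hsmul c v.2) }
  obtain ⟨R, hR⟩ := f.exists_extend
  exact ⟨R, fun v hv => LinearMap.congr_fun hR ⟨v, hv⟩⟩

lemma measurable_dualNormSq (R : Hs Om →ₗ[ℝ] Hs Om)
    (hR : ∀ v, inDom lam e ρ v → R v = fracPow lam e ρ v) {ζ : ℝ → Hs Om} {m : Measure ℝ}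
    (hζ : AEStronglyMeasurable ζ m) (d : ℝ → Hs Om →ₗ[ℝ] ℝ) (hd : ∀ t v, d t v = -⟪ζ t, R v⟫) :
    AEStronglyMeasurable (fun t => dualNormSq lam e ρ (d t)) m ∧
      ∀ t, ‖dualNormSq lam e ρ (d t)‖ ≤ ‖ζ t‖ ^ 2 := by
  have h0 : inDom lam e ρ (0 : Hs Om) ∧ gnormSq lam e ρ (0 : Hs Om) ≤ 1 := by
    simp [inDom, gnormSq, fracPow, summable_zero]
  let D := {v : Hs Om // inDom lam e ρ v ∧ gnormSq lam e ρ v ≤ 1}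
  have : Nonempty D := ⟨⟨0, h0⟩⟩
  have hset : ∀ t, dualNormSq lam e ρ (d t) = ⨆ v : D, ⟪ζ t, R v.1⟫ ^ 2 := fun t => by
    rw [dualNormSq, iSup]
    congr 1
    ext a
    constructor
    · rintro ⟨v, h1, h2, rfl⟩
      exact ⟨⟨v, h1, h2⟩, by simp [hd]⟩
    · rintro ⟨v, rfl⟩
      exact ⟨v.1, v.2.1, v.2.2, by simp [hd]⟩
  have hle : ∀ (w : Hs Om) (v : D), ⟪w, R v.1⟫ ^ 2 ≤ ‖w‖ ^ 2 := fun w v => by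
    have h1 : ‖R v.1‖ ^ 2 ≤ 1 := by
      have := v.2.2
      rw [gnormSq, ← hR _ v.2.1] at this
      nlinarith [sq_nonneg ‖v.1‖]
    have h2 := pow_le_pow_left₀ (abs_nonneg _) (abs_real_inner_le_norm w (R v.1)) 2
    rw [sq_abs, mul_pow] at h2
    nlinarith [sq_nonneg ‖w‖]
  have hlsc : LowerSemicontinuous fun w : Hs Om => ⨆ v : D, ⟪w, R v.1⟫ ^ 2 :=
    lowerSemicontinuous_ciSup (fun w => ⟨‖w‖ ^ 2, by rintro _ ⟨v, rfl⟩; exact hle w v⟩)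
      fun v => Continuous.lowerSemicontinuous (by fun_prop)
  constructor
  · borelize ↥(Hs Om)
    simp only [hset]
    exact (hlsc.measurable.comp_aemeasurable hζ.aemeasurable).aestronglyMeasurable
  · intro t
    rw [hset, Real.norm_of_nonneg (Real.iSup_nonneg fun v => sq_nonneg _)]
    exact ciSup_le fun v => hle _ v

end FractionalPower

section Kernel

variable {Om : Set E3}

lemma inner_eq_mul_meanVal (hpos : 0 < volume Om) (hfin : volume Om ≠ ⊤) {e : Hs Om} {c : ℝ}
    (he : ∀ᵐ x ∂(mOm Om), e x = c) (v : Hs Om) :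
    ⟪v, e⟫ = c * (volume Om).toReal * meanVal v := by
  have hV : (volume Om).toReal ≠ 0 := (ENNReal.toReal_pos hpos.ne' hfin).ne'
  have h1 : ⟪v, e⟫ = ∫ x, c * v x ∂(mOm Om) := by
    rw [L2.inner_def]
    refine integral_congr_ae ?_
    filter_upwards [he] with x hx
    rw [hx]; rfl
  rw [h1, integral_const_mul, meanVal, mul_assoc, mul_div_cancel₀ _ hV]

lemma meanVal_of_ae_eq (hpos : 0 < volume Om) (hfin : volume Om ≠ ⊤) {w : Hs Om} {s : ℝ}
    (hw : ∀ᵐ x ∂(mOm Om), w x = s) : meanVal w = s := by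
  have hV : (volume Om).toReal ≠ 0 := (ENNReal.toReal_pos hpos.ne' hfin).ne'
  rw [meanVal, integral_congr_ae (g := fun _ => s) hw, integral_const, smul_eq_mul,
    measureReal_restrict_apply_univ, Measure.real, mul_div_cancel_left₀ _ hV]

lemma exists_of_mem_interior_subdiff {f : ℝ → ℝ≥0∞} {m₀ : ℝ}
    (hm : m₀ ∈ interior {s : ℝ | (subdiff f s).Nonempty}) :
    ∃ δ > 0, f (m₀ - δ) < ⊤ ∧ f (m₀ + δ) < ⊤ := by
  obtain ⟨ε, hε, hball⟩ := Metric.mem_nhds_iff.1 (mem_interior_iff_mem_nhds.1 hm)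
  have h : ∀ s, |s - m₀| < ε → f s < ⊤ := fun s hs => by
    obtain ⟨ξ, hξ⟩ := hball (Metric.mem_ball.2 hs)
    exact hξ.1
  have habs : |ε / 2| < ε := by rw [abs_of_pos (half_pos hε)]; exact half_lt_self hε
  exact ⟨ε / 2, half_pos hε, h _ (by simpa [abs_neg] using habs), h _ (by simpa using habs)⟩

lemma kernelCondition_rpow (hpos : 0 < volume Om) (hfin : volume Om ≠ ⊤) {lam : ℕ → ℝ}
    {r : ℝ} (hr : 0 < r) (hmono : Monotone lam) {b : HilbertBasis ℕ ℝ (Hs Om)}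
    (hlam : 0 < lam 0 ∨ lam 0 = 0 ∧ 0 < lam 1 ∧ ∃ c : ℝ, ∀ᵐ x ∂(mOm Om), b 0 x = c)
    {Ψ : Hs Om → ℝ≥0∞} {y₀ : Hs Om}
    (hΨ : lam 0 = 0 → ∃ δ > 0, ∃ w₁ w₂ : Hs Om, Ψ w₁ < ⊤ ∧ Ψ w₂ < ⊤ ∧
      (∀ᵐ x ∂(mOm Om), w₁ x = meanVal y₀ - δ) ∧ ∀ᵐ x ∂(mOm Om), w₂ x = meanVal y₀ + δ) :
    KernelCondition Ψ b (fun j => lam j ^ r) y₀ := by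
  rcases hlam with h0 | ⟨h0, h1, c, hc⟩
  · exact ⟨lam 0 ^ r, Real.rpow_pos_of_pos h0 r,
      Or.inl fun j => Real.rpow_le_rpow h0.le (hmono (Nat.zero_le j)) hr.le⟩
  refine ⟨lam 1 ^ r, Real.rpow_pos_of_pos h1 r, Or.inr ⟨by simp [h0, hr.ne'],
    fun j => Real.rpow_le_rpow h1.le (hmono (Nat.le_add_left 1 j)) hr.le, ?_⟩⟩
  obtain ⟨δ, hδ, w₁, w₂, hΨ₁, hΨ₂, hw₁, hw₂⟩ := hΨ h0
  have hV : 0 < (volume Om).toReal := ENNReal.toReal_pos hpos.ne' hfin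
  have hin := inner_eq_mul_meanVal hpos hfin hc
  have hm₁ := meanVal_of_ae_eq hpos hfin hw₁
  have hm₂ := meanVal_of_ae_eq hpos hfin hw₂
  have hc0 : c ≠ 0 := by
    rintro rfl
    have h2 := hin (b 0)
    rw [real_inner_self_eq_norm_sq, b.orthonormal.norm_eq_one] at h2
    simp at h2
  simp only [hin]
  rcases hc0.lt_or_gt with hneg | hcpos
  · have hk : c * (volume Om).toReal < 0 := mul_neg_of_neg_of_pos hneg hV
    refine ⟨w₂, w₁, hΨ₂, hΨ₁, ?_, ?_⟩
    · exact mul_lt_mul_of_neg_left (by linarith) hk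
    · exact mul_lt_mul_of_neg_left (by linarith) hk
  · have hk : 0 < c * (volume Om).toReal := mul_pos hcpos hV
    exact ⟨w₁, w₂, hΨ₁, hΨ₂, mul_lt_mul_of_pos_left (by linarith) hk,
      mul_lt_mul_of_pos_left (by linarith) hk⟩

end Kernel

section Identification

variable {Om : Set E3} {lam : ℕ → ℝ} {e : ℕ → Hs Om} {ρ : ℝ} {b : HilbertBasis ℕ ℝ (Hs Om)}

lemma inner_eq_of_coord_evolution (hb : ∀ j, b j = e j) {ζ : ℝ → Hs Om} {y y₀ v : Hs Om}
    {t : ℝ} (ht : 0 ≤ t) (hζ : MemLp ζ 2 (volume.restrict (Ioc (0 : ℝ) t)))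
    (h : ∀ j, ⟪y, b j⟫ = ⟪y₀, b j⟫ - lam j ^ ρ * ∫ s in (0 : ℝ)..t, ⟪ζ s, b j⟫)
    (hv : inDom lam e ρ v) :
    ⟪y, v⟫ = ⟪y₀, v⟫ + ∫ s in (0 : ℝ)..t, -⟪ζ s, fracPow lam e ρ v⟫ := by
  have hint : IntegrableOn ζ (Ioc 0 t) := hζ.integrable (by norm_num)
  have hI : ∀ w : Hs Om, ⟪∫ s in Ioc 0 t, ζ s, w⟫ = ∫ s in (0 : ℝ)..t, ⟪ζ s, w⟫ := fun w => by
    rw [intervalIntegral.integral_of_le ht, real_inner_comm, ← integral_inner hint w]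
    exact integral_congr_ae (Eventually.of_forall fun s => real_inner_comm _ _)
  rw [intervalIntegral.integral_neg, ← hI]
  refine (hasSum_coord_mul b y v).unique ?_
  refine ((hasSum_coord_mul b y₀ v).add
    (hasSum_coord_mul b (∫ s in Ioc 0 t, ζ s) (fracPow lam e ρ v)).neg).congr_fun fun j => ?_
  rw [h, inner_fracPow hb hv, hI]
  ring

lemma inner_eq_of_coord_rate (hb : ∀ j, b j = e j) {τ : ℝ} {z ζ v : Hs Om}
    (h : ∀ j, ⟪z, b j⟫ = -(τ * lam j ^ ρ) * ⟪ζ, b j⟫) (hv : inDom lam e ρ v) :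
    ⟪z, v⟫ = τ * -⟪ζ, fracPow lam e ρ v⟫ := by
  refine (hasSum_coord_mul b z v).unique ?_
  refine ((hasSum_coord_mul b ζ (fracPow lam e ρ v)).neg.mul_left τ).congr_fun fun j => ?_
  rw [h, inner_fracPow hb hv]
  ring

lemma gnormSq_le_of_quadEnergy_le (hb : ∀ j, b j = e j) {v : Hs Om} {C : ℝ} (hC : 0 ≤ C)
    (hv : quadEnergy b (fun j => lam j ^ ρ) v ≤ ENNReal.ofReal C) :
    inDom lam e ρ v ∧ gnormSq lam e ρ v ≤ ‖v‖ ^ 2 + 2 * C := by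
  have hdom : inDom lam e ρ v := by
    have := (quadEnergy_lt_top_iff b _).1 (hv.trans_lt ENNReal.ofReal_lt_top)
    simpa only [inDom, hb] using this
  refine ⟨hdom, ?_⟩
  rw [quadEnergy_eq_of_coord (inner_fracPow hb hdom),
    ENNReal.ofReal_le_ofReal_iff hC] at hv
  rw [gnormSq]
  linarith

end Identification

section Existence

variable {Om : Set E3}

lemma integral_reaction_eq_inner [IsFiniteMeasure (mOm Om)] {q : ℝ → ℝ} {K : ℝ≥0}
    (hq : LipschitzWith K q) (y u v : Hs Om) :
    ∫ x, (q (y x) - u x) * (y x - v x) ∂(mOm Om) = ⟪nemytskii hq y - u, y - v⟫ := by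
  rw [L2.inner_def]
  refine integral_congr_ae ?_
  filter_upwards [coeFn_nemytskii hq y, Lp.coeFn_sub (nemytskii hq y) u, Lp.coeFn_sub y v]
    with x h1 h2 h3
  rw [h2, h3, Pi.sub_apply, Pi.sub_apply, h1]
  exact mul_comm _ _

lemma lintegral_comp_ae_const_lt_top (hfin : volume Om ≠ ⊤) {f : ℝ → ℝ≥0∞} {w : Hs Om} {s : ℝ}
    (hw : ∀ᵐ x ∂(mOm Om), w x = s) (hs : f s < ⊤) : ∫⁻ x, f (w x) ∂(mOm Om) < ⊤ := by
  rw [lintegral_congr_ae (g := fun _ => f s) (hw.mono fun x hx => by simp only [hx]),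
    lintegral_const, Measure.restrict_apply_univ]
  exact ENNReal.mul_lt_top hs hfin.lt_top

end Existence

/-- **Theorem 2.1 (existence).** Under the structural assumptions and the assumptions on
the data, there exists a pair `(y, μ)` (together with the representations `dy` of
`∂_t y ∈ V_A^{-r}` and `z` of `τ ∂_t y ∈ H`) satisfying the regularity requirements and
solving the weak formulation of the fractional Cahn--Hilliard system. -/
theorem existence_of_solution
    (Om : Set E3) (lamA lamB : ℕ → ℝ) (eA eB : ℕ → Hs Om) (r σ τ : ℝ)
    (betah : ℝ → ℝ≥0∞) (pih piF : ℝ → ℝ) (Lpi : ℝ≥0)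
    (u u' : ℝ → Hs Om) (y0 : Hs Om)
    (hset : SettingHyps Om lamA lamB eA eB r σ τ)
    (hdata : DataHyps Om lamA lamB eB σ betah pih piF Lpi u u' y0) :
    ∃ (y μ : ℝ → Hs Om) (dy : ℝ → Hs Om →ₗ[ℝ] ℝ) (z : ℝ → Hs Om),
      IsSolution Om lamA lamB eA eB r σ τ betah piF u y0 y μ dy z := by
  obtain ⟨hopen, hconn, hbdd, hA0, hB0, hAmono, -, -, hBlim, hAon, hBon, hAspan, hBspan, hr, hσ,
    hτ, hAker, hconst⟩ := hset
  obtain ⟨hconv, hlsc, -, hder, hlip, ⟨α, hα, hcoer⟩, hu', hu, hy0, hy0f, hmean⟩ := hdata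
  have hfin : volume Om ≠ ⊤ := hbdd.measure_lt_top.ne
  have hpos : 0 < volume Om := hopen.measure_pos volume hconn.nonempty
  have : IsFiniteMeasure (mOm Om) := ⟨by simpa using hfin.lt_top⟩
  have : Fact ((2 : ℝ≥0∞) ≠ ∞) := ⟨by norm_num⟩
  have : SecondCountableTopology (Hs Om) := inferInstance
  obtain ⟨bA, hbA⟩ := exists_hilbertBasis hAon hAspan
  obtain ⟨bB, hbB⟩ := exists_hilbertBasis hBon hBspan
  have hν : Tendsto (fun j => lamB j ^ σ) atTop atTop := (_root_.tendsto_rpow_atTop hσ).comp hBlim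
  have hdomB : ∀ v, inDom lamB eB σ v ↔ quadEnergy bB (fun j => lamB j ^ σ) v < ⊤ := fun v => by
    rw [quadEnergy_lt_top_iff]; simp only [inDom, hbB]
  obtain ⟨C₀, hC₀⟩ := exists_global_coercive hder hcoer
  have hE := isEnergy_quadEnergy_add bB hν hlsc hconv hder hlip hα hC₀
  have hΨ : ∀ v : Hs Om, inDom lamB eB σ v → ∫⁻ x, betah (v x) ∂(mOm Om) < ⊤ →
      quadEnergy bB (fun j => lamB j ^ σ) v + ∫⁻ x, betah (v x) ∂(mOm Om) < ⊤ :=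
    fun v h1 h2 => ENNReal.add_lt_top.2 ⟨(hdomB v).1 h1, h2⟩
  have hK := kernelCondition_rpow hpos hfin hr hAmono (b := bA) (by simpa only [hbA] using hAker)
    (Ψ := fun v => quadEnergy bB (fun j => lamB j ^ σ) v + ∫⁻ x, betah (v x) ∂(mOm Om))
    (y₀ := y0) fun h0 => by
      obtain ⟨δ, hδ, h1, h2⟩ := exists_of_mem_interior_subdiff (hmean h0)
      obtain ⟨w₁, hd₁, hw₁⟩ := hconst h0 (meanVal y0 - δ)
      obtain ⟨w₂, hd₂, hw₂⟩ := hconst h0 (meanVal y0 + δ)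
      exact ⟨δ, hδ, w₁, w₂, hΨ w₁ hd₁ (lintegral_comp_ae_const_lt_top hfin hw₁ h1),
        hΨ w₂ hd₂ (lintegral_comp_ae_const_lt_top hfin hw₂ h2), hw₁, hw₂⟩
  have hubound : ∀ t : ℝ, 0 ≤ t → ‖u t‖ ≤ ‖u 0‖ + ∫ x in Ioi (0 : ℝ), ‖u' x‖ := fun t ht => by
    have h1 := norm_sub_le_integral_norm hu' hu le_rfl ht
    have h2 := integral_norm_le_of_nonneg hu' ht
    have h3 := norm_sub_norm_le (u t) (u 0)
    linarith
  obtain ⟨y, μ, ζ, z, C, hym, hμm, hζm, hzm, hμ2, hζ2, hz2, hyC, hevol, hζμ, hrate, hineq⟩ :=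
    hE.exists_solution bA (fun j => Real.rpow_nonneg (hA0 j) r) hτ (hΨ y0 hy0 hy0f) hK
      (continuousOn_of_eq_primitive hu' hu) hubound fun h hh n => sum_norm_sub_le hu' hu hh n
  have hC : 0 ≤ C := (norm_nonneg _).trans (hyC 0 le_rfl).1
  have hyB : ∀ t, 0 ≤ t → inDom lamB eB σ (y t) ∧ gnormSq lamB eB σ (y t) ≤ C ^ 2 + 2 * C :=
    fun t ht => by
      obtain ⟨h1, h2⟩ := gnormSq_le_of_quadEnergy_le hbB hC (le_self_add.trans (hyC t ht).2)
      exact ⟨h1, h2.trans (by gcongr; exact (hyC t ht).1)⟩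
  have hsq : ∀ {x : ℝ → Hs Om} {T : ℝ}, MemLp x 2 (volume.restrict (Ioc (0 : ℝ) T)) →
      IntegrableOn (fun t => ‖x t‖ ^ 2) (Ioc 0 T) := fun hx =>
    (memLp_two_iff_integrable_sq_norm hx.1).1 hx
  have hsub : ∀ T : ℝ, volume.restrict (Ioc (0 : ℝ) T) ≤ volume.restrict (Ioi 0) := fun T =>
    Measure.restrict_mono Ioc_subset_Ioi_self le_rfl
  have hpos' : ∀ᵐ t ∂(volume.restrict (Ioi (0 : ℝ))), 0 < t := ae_restrict_mem measurableSet_Ioi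
  obtain ⟨R, hR⟩ := exists_linear_extension hbA lamA r
  have hy00 : y 0 = y0 := eq_of_coord_eq bA fun j => by simpa using hevol 0 le_rfl j
  let dy : ℝ → Hs Om →ₗ[ℝ] ℝ := fun t => -((innerₗ (Hs Om) (ζ t)).comp R)
  have hdy : ∀ t v, dy t v = -⟪ζ t, R v⟫ := fun t v => rfl
  have hdy' : ∀ t v, inDom lamA eA r v → dy t v = -⟪ζ t, fracPow lamA eA r v⟫ := fun t v hv => by
    rw [hdy, hR v hv]
  have hμfrac : ∀ᵐ t ∂(volume.restrict (Ioi (0 : ℝ))), inDom lamA eA r (μ t) ∧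
      fracPow lamA eA r (μ t) = ζ t := hζμ.mono fun t ht =>
    ⟨inDom_of_coord hbA ht, fracPow_eq_of_coord hbA ht⟩
  refine ⟨y, μ, dy, z, hym, ?_, ?_, ?_, ?_, ?_, hzm, ?_, fun T _ => hsq (hz2 T), hμm,
    hμfrac.mono fun t ht => ht.1, ?_, ?_, ?_, ?_, hy00⟩
  · exact hpos'.mono fun t ht => (hyB t ht.le).1
  · exact fun T _ => ⟨C ^ 2 + 2 * C, (ae_restrict_mem measurableSet_Ioc).mono
      fun t ht => (hyB t ht.1.le).2⟩
  · exact fun v _ T _ => (integrableOn_coord (hζ2 T) (R v)).neg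
  · intro v hv t ht
    simp only [hdy' _ v hv, hy00]
    exact inner_eq_of_coord_evolution hbA ht (hζ2 t) (hevol t ht) hv
  · intro T _
    obtain ⟨h1, h2⟩ := measurable_dualNormSq R hR (hζ2 T).1 dy hdy
    exact (hsq (hζ2 T)).mono' h1 (Eventually.of_forall h2)
  · filter_upwards [hrate] with t ht v hv
    rw [hdy' t v hv]
    exact inner_eq_of_coord_rate hbA ht hv
  · intro T _
    refine ((hsq (hμ2 T)).add (hsq (hζ2 T))).congr ?_
    filter_upwards [ae_mono (hsub T) hμfrac] with t ht
    simp only [gnormSq, ht.2, Pi.add_apply]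
  · intro T _
    calc ∫⁻ t in Ioc (0 : ℝ) T, ∫⁻ x, betah (y t x) ∂(mOm Om)
        ≤ ∫⁻ _ in Ioc (0 : ℝ) T, ENNReal.ofReal C :=
          setLIntegral_mono measurable_const fun t ht => le_add_self.trans (hyC t ht.1.le).2
      _ < ⊤ := by
          rw [setLIntegral_const]
          exact ENNReal.mul_lt_top ENNReal.ofReal_lt_top measure_Ioc_lt_top
  · filter_upwards [hμfrac] with t ht v hv
    rw [hdy' t v hv, ht.2, neg_add_cancel]
  · filter_upwards [hineq, hpos'] with t ht htpos v hv hvf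
    have h1 := variational_ineq_of_energy (b := bB) (ν := fun j => lamB j ^ σ)
      (J := fun v : Hs Om => ∫⁻ x, betah (v x) ∂(mOm Om))
      (fun v w s h0 h1 => lintegral_comp_convex hlsc.measurable hconv v w h0 h1)
      (inner_fracPow hbB (hyB t htpos.le).1) (inner_fracPow hbB hv)
      ((le_add_self.trans (hyC t htpos.le).2).trans_lt ENNReal.ofReal_lt_top) hvf ht
    rw [integral_reaction_eq_inner hlip]
    rw [add_sub_assoc (z t), inner_sub_left, inner_add_left] at h1
    linarith

end FracCH
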